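/- For every classical solution of the two-piston system with input u and with the normalization ∫_{a(t)}^{b(t)} ρ(t,x)dx = 1 for all t ≥ 0, the functional W satisfies, for all t > 0, d/dt W(a(t), b(t), ρ[t], v[t]) = −∫_{a(t)}^{b(t)} ρ^{-2}(t,x) P'(ρ(t,x)) μ(ρ(t,x)) ρ_x²(t,x) dx − k(ρ(t,b(t)))(P(ρ(t,b(t))) − P_ext) − k(ρ(t,a(t)))(P(ρ(t,a(t))) − P_ext) + (v(t,a(t)) + k(ρ(t,a(t)))) u(t). -/

import Mathlib

open MeasureTheory Set Filter

/-- `Q(ρ) = ρ ∫_{ρ*}^{ρ} P(τ)/τ² dτ − (P(ρ*)/ρ*)ρ + P(ρ*)`. -/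
noncomputable def Qf (P : ℝ → ℝ) (ρs x : ℝ) : ℝ :=
  x * (∫ τ in ρs..x, P τ / τ ^ 2) - (P ρs / ρs) * x + P ρs

/-- `k(ρ) = ∫_{ρ*}^{ρ} μ(τ)/τ dτ`. -/
noncomputable def kf (μ : ℝ → ℝ) (ρs x : ℝ) : ℝ :=
  ∫ τ in ρs..x, μ τ / τ

/-- `G(ρ) = ∫_{ρ*}^{ρ} μ(l) l^{-3/2} √(Q(l)) dl`. -/
noncomputable def Gf (P μ : ℝ → ℝ) (ρs x : ℝ) : ℝ :=
  ∫ l in ρs..x, μ l / l ^ ((3 : ℝ) / 2) * Real.sqrt (Qf P ρs l)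

/-- Assumption (H): `G(ρ) → +∞` as `ρ → +∞`, `G(ρ) → −∞` as `ρ → 0⁺`,
and `k(ρ) → +∞` as `ρ → +∞`. -/
def AssumpH (P μ : ℝ → ℝ) (ρs : ℝ) : Prop :=
  Tendsto (Gf P μ ρs) atTop atTop ∧
  Tendsto (Gf P μ ρs) (nhdsWithin 0 (Ioi 0)) atBot ∧
  Tendsto (kf μ ρs) atTop atTop

/-- Potential energy `U(a,b,ρ) = ∫_a^b Q(ρ(x)) dx`. -/
noncomputable def Uf (P : ℝ → ℝ) (ρs a b : ℝ) (ρ : ℝ → ℝ) : ℝ :=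
  ∫ x in a..b, Qf P ρs (ρ x)

/-- Total mechanical energy `E`. -/
noncomputable def Ef (P : ℝ → ℝ) (ρs a b : ℝ) (ρ v : ℝ → ℝ) : ℝ :=
  (v a) ^ 2 / 2 + (v b) ^ 2 / 2 + (1 / 2) * (∫ x in a..b, ρ x * (v x) ^ 2)
    + Uf P ρs a b ρ

/-- Transformed energy `W`. -/
noncomputable def Wf (P μ : ℝ → ℝ) (ρs a b : ℝ) (ρ ρx v : ℝ → ℝ) : ℝ :=
  (1 / 2) * (∫ x in a..b, (ρ x)⁻¹ * (ρ x * v x + μ (ρ x) * (ρ x)⁻¹ * ρx x) ^ 2)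
    + (1 / 2) * (v b - kf μ ρs (ρ b)) ^ 2
    + (1 / 2) * (v a + kf μ ρs (ρ a)) ^ 2
    + Uf P ρs a b ρ

/-- Control Lyapunov functional `V = W + r E`. -/
noncomputable def Vf (P μ : ℝ → ℝ) (ρs r a b : ℝ) (ρ ρx v : ℝ → ℝ) : ℝ :=
  Wf P μ ρs a b ρ ρx v + r * Ef P ρs a b ρ v

/-- `f ∈ H¹(a,b)` with weak derivative `f'`:  `f' ∈ L¹ ∩ L²(a,b)` and
`f(x) = f(a) + ∫_a^x f'(s) ds` on `[a,b]`. -/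
def H1On (a b : ℝ) (f f' : ℝ → ℝ) : Prop :=
  IntervalIntegrable f' volume a b ∧
  IntervalIntegrable (fun s => (f' s) ^ 2) volume a b ∧
  ∀ x ∈ Icc a b, f x = f a + ∫ s in a..x, f' s

/-- A classical solution of the two-piston system (2.1)-(2.5) with boundary input `u`:
piston positions `a < b` (with velocities `a'`, `b'` and accelerations `a''`, `b''`),
gas density `ρ > 0` and velocity `v` on the moving domain `{(t,x) : a(t) ≤ x ≤ b(t)}`,
with the indicated partial derivatives, satisfying mass conservation, the momentum
(Navier–Stokes) equation, the kinematic boundary conditions, and Newton's law for the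
two pistons. -/
structure PistonSol (P μ : ℝ → ℝ) (Pext : ℝ) where
  /-- position of the left piston -/
  a : ℝ → ℝ
  /-- position of the right piston -/
  b : ℝ → ℝ
  a' : ℝ → ℝ
  b' : ℝ → ℝ
  a'' : ℝ → ℝ
  b'' : ℝ → ℝ
  /-- boundary control input -/
  u : ℝ → ℝ
  /-- gas density -/
  ρ : ℝ → ℝ → ℝ
  /-- gas velocity -/
  v : ℝ → ℝ → ℝ
  ρt : ℝ → ℝ → ℝ
  ρx : ℝ → ℝ → ℝ
  vt : ℝ → ℝ → ℝ
  vx : ℝ → ℝ → ℝ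
  u_cont : ContinuousOn u (Ici 0)
  hab : ∀ t, 0 ≤ t → a t < b t
  ha' : ∀ t, 0 ≤ t → HasDerivWithinAt a (a' t) (Ici 0) t
  hb' : ∀ t, 0 ≤ t → HasDerivWithinAt b (b' t) (Ici 0) t
  ha'_cont : ContinuousOn a' (Ici 0)
  hb'_cont : ContinuousOn b' (Ici 0)
  ha'' : ∀ t, 0 < t → HasDerivAt a' (a'' t) t
  hb'' : ∀ t, 0 < t → HasDerivAt b' (b'' t) t
  ρ_pos : ∀ t, 0 ≤ t → ∀ x ∈ Icc (a t) (b t), 0 < ρ t x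
  ρ_cont : ContinuousOn (fun p : ℝ × ℝ => ρ p.1 p.2)
    {p : ℝ × ℝ | 0 ≤ p.1 ∧ p.2 ∈ Icc (a p.1) (b p.1)}
  v_cont : ContinuousOn (fun p : ℝ × ℝ => v p.1 p.2)
    {p : ℝ × ℝ | 0 ≤ p.1 ∧ p.2 ∈ Icc (a p.1) (b p.1)}
  hρt : ∀ t, 0 < t → ∀ x ∈ Icc (a t) (b t), HasDerivAt (fun s => ρ s x) (ρt t x) t
  hρx : ∀ t, 0 ≤ t → ∀ x ∈ Icc (a t) (b t), HasDerivAt (fun y => ρ t y) (ρx t x) x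
  hvt : ∀ t, 0 < t → ∀ x ∈ Icc (a t) (b t), HasDerivAt (fun s => v s x) (vt t x) t
  hvx : ∀ t, 0 < t → ∀ x ∈ Icc (a t) (b t), HasDerivAt (fun y => v t y) (vx t x) x
  ρx_cont : ∀ t, 0 ≤ t → ContinuousOn (ρx t) (Icc (a t) (b t))
  vx_cont : ∀ t, 0 < t → ContinuousOn (vx t) (Icc (a t) (b t))
  /-- mass conservation `ρ_t + (ρ v)_x = 0` on `[a(t), b(t)]` -/
  mass_eq : ∀ t, 0 < t → ∀ x ∈ Icc (a t) (b t),
    ρt t x + (ρx t x * v t x + ρ t x * vx t x) = 0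
  /-- momentum equation `ρ(v_t + v v_x) = (μ(ρ) v_x − P(ρ))_x` on `(a(t), b(t))` -/
  momentum_eq : ∀ t, 0 < t → ∀ x ∈ Ioo (a t) (b t),
    HasDerivAt (fun y => μ (ρ t y) * vx t y - P (ρ t y))
      (ρ t x * (vt t x + v t x * vx t x)) x
  /-- `v(t, a(t)) = a'(t)` -/
  bc_a : ∀ t, 0 ≤ t → v t (a t) = a' t
  /-- `v(t, b(t)) = b'(t)` -/
  bc_b : ∀ t, 0 ≤ t → v t (b t) = b' t
  /-- Newton's law for the right piston -/
  newton_b : ∀ t, 0 < t →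
    b'' t = P (ρ t (b t)) - μ (ρ t (b t)) * vx t (b t) - Pext
  /-- Newton's law for the left (actuated) piston -/
  newton_a : ∀ t, 0 < t →
    a'' t = u t + Pext - P (ρ t (a t)) + μ (ρ t (a t)) * vx t (a t)


open scoped Topology
local notation "FFF" => ℝ → ℝ → ℝ
local notation "FF" => ℝ → ℝ
local notation "RR" => ℝ × ℝ
local notation "Zr" => (0:ℝ)
local notation "UI" => Icc (0:ℝ) 1
local notation "UO" => Ioo (0:ℝ) 1
local notation "occ" => Ioo_subset_Icc_self
local notation "mll" => mul_le_mul_of_nonneg_left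
local notation "mlr" => mul_le_mul_of_nonneg_right
local notation "nwn" => nhdsWithin_le_nhds
local notation "HD" => HasDerivAt
local notation "CO" => ContinuousOn
local notation "II" => IntervalIntegrable
local notation "ouc" => uIoc_subset_uIcc
local notation "omn" => Ioo_mem_nhds
local notation "smn" => self_mem_nhdsWithin
local notation "ihr" => intervalIntegral.integral_hasDerivAt_right
local notation "isb" => intervalIntegral.integral_sub
local notation "icm" => intervalIntegral.integral_const_mul
local notation "isl" => intervalIntegral.integral_interval_sub_left
local notation "iad" => intervalIntegral.integral_add
local notation "zlo" => zero_le_one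
local notation "lmr" => le_max_right
local notation "lml" => le_max_left
local notation "ccn" => continuous_const
local notation "csn" => continuous_snd
local notation "cfs" => continuous_fst
local notation "mir" => min_le_right
local notation "oIs" => ordConnected_Icc.uIcc_subset
local notation "nea" => Real.norm_eq_abs
local notation "uol" => uIcc_of_le
local notation "ann" => abs_nonneg
local notation "las" => le_abs_self
local notation "asc" => abs_sub_comm

lemma IsCompact.ebc {α E : Type*} [TopologicalSpace α] [SeminormedAddCommGroup E] {s : Set α} (hs : IsCompact s)
    {f : α → E} (hf : ContinuousOn f s) : ∃ C, ∀ x ∈ s, ‖f x‖ ≤ C := hs.exists_bound_of_continuousOn hf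
lemma bIcc {a b : ℝ} {f : ℝ → ℝ} (hf : ContinuousOn f (Icc a b)) : ∃ C, ∀ x ∈ Icc a b, ‖f x‖ ≤ C :=
  isCompact_Icc.exists_bound_of_continuousOn hf
lemma HasDerivAt.cw {f : ℝ → ℝ} {f' x : ℝ} {s : Set ℝ} (h : HasDerivAt f f' x) : ContinuousWithinAt f s x :=
  h.continuousAt.continuousWithinAt
lemma Continuous.co {X Y : Type*} [TopologicalSpace X] [TopologicalSpace Y] {f : X → Y} {s : Set X}
    (h : Continuous f) : ContinuousOn f s := h.continuousOn
lemma ContDiffOn.co {f : ℝ → ℝ} {n : WithTop ℕ∞} {s : Set ℝ} (h : ContDiffOn ℝ n f s) : ContinuousOn f s := h.continuousOn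
lemma Continuous.ii {f : ℝ → ℝ} (h : Continuous f) (a b : ℝ) : IntervalIntegrable f volume a b := h.intervalIntegrable a b
lemma ContinuousOn.ii {f : ℝ → ℝ} {a b : ℝ} (h : ContinuousOn f (uIcc a b)) : IntervalIntegrable f volume a b :=
  h.intervalIntegrable
lemma cif {X Y : Type*} [TopologicalSpace X] [TopologicalSpace Y] {f : X → Y} (h : ∀ x, ContinuousAt f x) : Continuous f :=
  continuous_iff_continuousAt.2 h

lemma HasDerivAt.cg {f g : FF} {f' g' x : ℝ} (h : HD f f' x) (hfg : ∀ y, g y = f y)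
    (h' : g' = f') : HD g g' x := by
  have : g = f := funext hfg
  rw [this, h']; exact h

lemma inv_lemma {f f' : FF} {c : ℝ} (hc : 0 < c) (hf : ∀ x, HD f (f' x) x)
    (hf' : ∀ x, c ≤ f' x) :
    ∃ g : FF, Continuous g ∧ (∀ x, g (f x) = x) ∧ (∀ y, f (g y) = y) ∧
      (∀ y, HD g (f' (g y))⁻¹ y) ∧ StrictMono g := by
  have hcont : Continuous f := cif fun x => (hf x).continuousAt
  have hmono : StrictMono f := strictMono_of_hasDerivAt_pos hf (fun x => hc.trans_le (hf' x))
  have hm2 : Monotone (fun x => f x - c * x) := by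
    apply monotone_of_hasDerivAt_nonneg (f' := fun x => f' x - c)
    · intro x; exact ((hf x).sub ((hasDerivAt_id x).const_mul c)).cg (fun y => by simp) (by simp)
    · intro x; simpa using hf' x
  have hsurj : Function.Surjective f := by
    apply hcont.surjective
    · refine tendsto_atTop_mono' _ ?_ (tendsto_atTop_add_const_left _ (f 0) (tendsto_id.const_mul_atTop hc))
      filter_upwards [eventually_ge_atTop 0] with x hx
      have := hm2 hx
      simp at this ⊢; linarith
    · refine tendsto_atBot_mono' _ ?_ (tendsto_atBot_add_const_left _ (f 0) (tendsto_id.const_mul_atBot hc))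
      filter_upwards [eventually_le_atBot 0] with x hx
      have := hm2 hx
      simp at this ⊢; linarith
  let e := StrictMono.orderIsoOfSurjective f hmono hsurj
  have h1 : ∀ y, f (e.symm y) = y := fun y => e.apply_symm_apply y
  refine ⟨e.symm, e.symm.continuous, fun x => e.symm_apply_apply x, h1, ?_, e.symm.strictMono⟩
  intro y
  exact HasDerivAt.of_local_left_inverse e.symm.continuous.continuousAt (hf _)
    (ne_of_gt (hc.trans_le (hf' _))) (Eventually.of_forall h1)

lemma sd_lemma {f f1 : FF} {x l : ℝ} (hf : ∀ᶠ y in 𝓝 x, HD f (f1 y) y)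
    (hf1 : HD f1 l x) :
    Tendsto (fun h => (f (x + h) + f (x - h) - 2 * f x) / h ^ 2) (𝓝[>] 0) (𝓝 l) := by
  have t1 : Tendsto (fun h : ℝ => x + h) (𝓝 0) (𝓝 x) := by
    have : Continuous (fun h : ℝ => x + h) := by fun_prop
    simpa using this.tendsto 0
  have t2 : Tendsto (fun h : ℝ => x - h) (𝓝 0) (𝓝 x) := by
    have : Continuous (fun h : ℝ => x - h) := by fun_prop
    simpa using this.tendsto 0
  have hfx : ContinuousAt f x := hf.self_of_nhds.continuousAt
  apply HasDerivAt.lhopital_zero_nhdsGT (f' := fun h => f1 (x + h) - f1 (x - h))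
    (g' := fun h => 2 * h)
  · apply nwn
    filter_upwards [t1.eventually hf, t2.eventually hf] with h h1 h2
    have a1 := h1.comp_const_add x h
    have a2 := h2.comp_const_sub x h
    exact ((a1.add a2).sub_const (2 * f x)).cg (fun y => by simp) (by ring)
  · refine Eventually.of_forall fun h => ?_
    simpa using hasDerivAt_pow 2 h
  · filter_upwards [smn] with h hh
    have : Zr < h := hh
    positivity
  · have : Tendsto (fun h => f (x + h) + f (x - h) - 2 * f x) (𝓝 0) (𝓝 (f x + f x - 2 * f x)) :=
      ((hfx.tendsto.comp t1).add (hfx.tendsto.comp t2)).sub_const _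
    rw [show f x + f x - 2 * f x = 0 by ring] at this
    exact this.mono_left nwn
  · have : Continuous (fun h : ℝ => h ^ 2) := by fun_prop
    have := this.tendsto 0
    simp at this
    exact this.mono_left nwn
  · have b1 : HD (fun h => f1 (x + h) - f1 (x - h)) (l - (-l)) 0 := by
      have a1 := HasDerivAt.comp_const_add (f := f1) (f' := l) x 0 (by simpa using hf1)
      have a2 := HasDerivAt.comp_const_sub (f := f1) (f' := l) x 0 (by simpa using hf1)
      exact a1.sub a2
    have b2 := b1.tendsto_slope_zero_right
    have b3 := b2.const_mul (1/2)
    rw [show 1 / 2 * (l - -l) = l by ring] at b3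
    refine b3.congr fun h => ?_
    simp [div_eq_mul_inv, mul_comm, mul_left_comm, mul_assoc]

/-- second difference MVT -/
lemma sd_mvt {f f1 f2 : FF} (hf : ∀ y, HD f (f1 y) y) (hf1 : ∀ y, HD f1 (f2 y) y)
    (x : ℝ) {h : ℝ} (hh : 0 < h) :
    ∃ c ∈ Icc (x - h) (x + h), (f (x + h) + f (x - h) - 2 * f x) / h ^ 2 = f2 c := by
  have key := exists_ratio_hasDerivAt_eq_ratio_slope
    (fun r => f (x + r) + f (x - r) - 2 * f x) (fun r => f1 (x + r) - f1 (x - r)) hh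
    (by
      intro r _
      have c1 : Continuous f := cif fun y => (hf y).continuousAt
      exact (by fun_prop : Continuous fun r => f (x + r) + f (x - r) - 2 * f x).continuousWithinAt)
    (by
      intro r _
      have a1 := (hf (x + r)).comp_const_add x r
      have a2 := (hf (x - r)).comp_const_sub x r
      exact ((a1.add a2).sub_const (2 * f x)).cg (fun y => by simp) (by ring))
    (fun r => r ^ 2) (fun r => 2 * r) (by fun_prop) (by
      intro r _; simpa using hasDerivAt_pow 2 r)
  obtain ⟨r, hr, hre⟩ := key
  have hr0 := hr.1
  obtain ⟨c, hc, hce⟩ := exists_hasDerivAt_eq_slope f1 f2 (a := x - r) (b := x + r) (by linarith)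
    (cif fun y => (hf1 y).continuousAt).co (fun y _ => hf1 y)
  have hr1 := hr.2
  refine ⟨c, ⟨by linarith [hc.1], by linarith [hc.2]⟩, ?_⟩
  rw [hce]
  simp at hre
  have hh2 : h ≠ 0 := hh.ne'
  have hr2 : r ≠ 0 := hr0.ne'
  rw [div_eq_div_iff (by positivity) (by simp; positivity)]
  ring_nf at hre ⊢
  linarith

lemma left_dini {f : FF} {s t E : ℝ} (hst : s ≤ t) (hf : CO f (Icc s t))
    (H : ∀ r ∈ Ioc s t, ∀ᶠ h in 𝓝[>] 0, f r - f (r - h) ≤ E * h) :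
    f t - f s ≤ E * (t - s) := by
  have key := image_le_of_liminf_slope_right_le_deriv_boundary (f := fun r => - f (s + t - r))
    (a := s) (b := t) (B := fun r => - f t + E * (r - s)) (B' := fun _ => E)
    (by
      apply ContinuousOn.neg
      apply hf.comp (by fun_prop)
      intro r hr
      exact ⟨by linarith [hr.2], by linarith [hr.1]⟩) (by simp)
    (by fun_prop)
    (by
      intro r _
      have : HD (fun r => - f t + E * (r - s)) E r := by
        simpa using (((hasDerivAt_id r).sub_const s).const_mul E).const_add (- f t)
      exact this.hasDerivWithinAt)
    (by
      intro x hx r hr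
      apply Eventually.frequently
      have h1 := H (s + t - x) ⟨by linarith [hx.2], by linarith [hx.1]⟩
      have t1 : Tendsto (fun z => z - x) (𝓝[>] x) (𝓝[>] 0) := by
        apply tendsto_nhdsWithin_of_tendsto_nhds_of_eventually_within
        · have : Continuous (fun z : ℝ => z - x) := by fun_prop
          have := this.tendsto x
          simp at this
          exact this.mono_left nwn
        · filter_upwards [smn] with z hz
          simpa using hz
      filter_upwards [t1.eventually h1, smn] with z hz hz2
      have hz2 : x < z := hz2
      rw [slope_def_field, div_lt_iff₀ (by linarith)]
      have : s + t - x - (z - x) = s + t - z := by ring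
      rw [this] at hz
      nlinarith)
  have := key (right_mem_Icc.2 hst)
  simp at this
  linarith

/-- the box -/
def bx (α β : ℝ) : Set (RR) := Icc α β ×ˢ UI

noncomputable def supc (α β : ℝ) (U ξ : FFF) (A t η : ℝ) : ℝ :=
  sSup ((fun z : RR => U z.1 z.2 - A * ((z.1 - t) ^ 2 + (ξ z.1 z.2 - η) ^ 2)) '' bx α β)

structure ALD (α β C : ℝ) (U ξ m ξt r θ : FFF) : Prop where
  hαβ : α < β
  hC : 0 < C
  Uc : Continuous fun z : RR => U z.1 z.2
  ξc : Continuous fun z : RR => ξ z.1 z.2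
  mc : Continuous fun z : RR => m z.1 z.2
  mpos : ∀ t y, 0 < m t y
  mle : ∀ t y, m t y ≤ C
  ξy : ∀ t y, HD (ξ t) (1 / m t y) y
  ξt' : ∀ t ∈ Icc α β, ∀ y ∈ UI, HD (fun s => ξ s y) (ξt t y) t
  ξtc : CO (fun z : RR => ξt z.1 z.2) (bx α β)
  rc : CO (fun z : RR => r z.1 z.2) (bx α β)
  mLip : ∀ s ∈ Icc α β, ∀ t ∈ Icc α β, ∀ y ∈ UI, ∀ y' ∈ UI,
    |m s y - m t y'| ≤ C * (|s - t| + |y - y'|)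
  Uy : ∀ t ∈ Icc α β, ∀ y ∈ UO, HD (U t) (θ t y / m t y) y
  θb : ∀ t ∈ Icc α β, ∀ y ∈ UO, |θ t y| ≤ C
  touch : ∀ s ∈ Ioo α β, ∀ y ∈ UO, ∀ A t η : ℝ,
    IsLocalMax (fun z : RR => U z.1 z.2 - A * ((z.1 - t) ^ 2 + (ξ z.1 z.2 - η) ^ 2)) (s, y) →
    HD (θ s) (A * (2 * (s - t) + 2 * (ξ s y - η) * ξt s y) + r s y) y

section
variable {α β C : ℝ} {U ξ m ξt r θ : FFF}

lemma bx_compact (α β : ℝ) : IsCompact (bx α β) := isCompact_Icc.prod isCompact_Icc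

lemma bx_nonempty (h : α < β) : (bx α β).Nonempty := ⟨(α, 0), ⟨⟨le_rfl, h.le⟩, by simp⟩⟩

lemma mem_bx {t y : ℝ} (ht : t ∈ Icc α β) (hy : y ∈ UI) : (t, y) ∈ bx α β := ⟨ht, hy⟩

lemma supc_cont (D : ALD α β C U ξ m ξt r θ) (A : ℝ) :
    Continuous fun p : RR => supc α β U ξ A p.1 p.2 := by
  have hU := D.Uc
  have hξ := D.ξc
  apply IsCompact.continuous_sSup (f := fun (p : RR) (z : RR) =>
    U z.1 z.2 - A * ((z.1 - p.1) ^ 2 + (ξ z.1 z.2 - p.2) ^ 2)) (bx_compact α β)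
  have h1 : Continuous fun q : (RR) × (RR) => U q.2.1 q.2.2 :=
    hU.comp csn
  have h2 : Continuous fun q : (RR) × (RR) => ξ q.2.1 q.2.2 :=
    hξ.comp csn
  simp only [Function.HasUncurry.uncurry, id]
  fun_prop

lemma supc_bdd (D : ALD α β C U ξ m ξt r θ) (A t η : ℝ) :
    CO (fun z : RR => U z.1 z.2 - A * ((z.1 - t) ^ 2 + (ξ z.1 z.2 - η) ^ 2)) (bx α β) := by
  have hU := D.Uc
  have hξ := D.ξc
  exact Continuous.co (by fun_prop)

lemma supc_ge (D : ALD α β C U ξ m ξt r θ) (A t η : ℝ) {z : RR} (hz : z ∈ bx α β) :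
    U z.1 z.2 - A * ((z.1 - t) ^ 2 + (ξ z.1 z.2 - η) ^ 2) ≤ supc α β U ξ A t η :=
  le_csSup ((bx_compact α β).bddAbove_image (supc_bdd D A t η)) (mem_image_of_mem _ hz)

lemma supc_att (D : ALD α β C U ξ m ξt r θ) (A t η : ℝ) :
    ∃ z ∈ bx α β, supc α β U ξ A t η = U z.1 z.2 - A * ((z.1 - t) ^ 2 + (ξ z.1 z.2 - η) ^ 2) := by
  obtain ⟨z, hz, h⟩ := (bx_compact α β).exists_sSup_image_eq (bx_nonempty D.hαβ) (supc_bdd D A t η)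
  exact ⟨z, hz, h⟩

lemma supc_sd (D : ALD α β C U ξ m ξt r θ) (A t η : ℝ) {h : ℝ} (hh : 0 < h) :
    -(2 * A) ≤ (supc α β U ξ A t (η + h) + supc α β U ξ A t (η - h) - 2 * supc α β U ξ A t η) / h ^ 2 := by
  obtain ⟨z, hz, h0⟩ := supc_att D A t η
  have h1 := supc_ge D A t (η + h) hz
  have h2 := supc_ge D A t (η - h) hz
  rw [le_div_iff₀ (by positivity)]
  nlinarith

lemma AL_bd (D : ALD α β C U ξ m ξt r θ) : ∃ L > 0, (∀ t ∈ Icc α β, ∀ y ∈ UI,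
    |ξt t y| ≤ L ∧ |r t y| ≤ L ∧ |U t y| ≤ L) := by
  obtain ⟨L1, h1⟩ := (bx_compact α β).ebc D.ξtc
  obtain ⟨L2, h2⟩ := (bx_compact α β).ebc D.rc
  obtain ⟨L3, h3⟩ := (bx_compact α β).ebc D.Uc.co
  refine ⟨max (max L1 L2) (max L3 1), by positivity, fun t ht y hy => ⟨?_, ?_, ?_⟩⟩
  · exact (h1 _ (mem_bx ht hy)).trans (by simp)
  · exact (h2 _ (mem_bx ht hy)).trans (by simp)
  · exact (h3 _ (mem_bx ht hy)).trans (by simp)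

lemma AL_ξ (D : ALD α β C U ξ m ξt r θ) (t y y' : ℝ) : |y - y'| ≤ C * |ξ t y - ξ t y'| := by
  have key : ∀ y y', y' ≤ y → y - y' ≤ C * (ξ t y - ξ t y') := by
    intro y y' hy
    have hm2 : Monotone (fun x => C * ξ t x - x) := by
      apply monotone_of_hasDerivAt_nonneg (f' := fun x => C * (1 / m t x) - 1)
      · intro x; exact (((D.ξy t x).const_mul C).sub (hasDerivAt_id x)).cg (fun y => by simp) rfl
      · intro x
        have := D.mpos t x
        simp
        rw [← div_eq_mul_inv, le_div_iff₀ this]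
        linarith [D.mle t x]
    have := hm2 hy
    simp at this
    linarith
  rcases le_total y' y with h | h
  · rw [abs_of_nonneg (by linarith)]
    exact (key _ _ h).trans (mll (las _) D.hC.le)
  · rw [asc, asc (ξ t y), abs_of_nonneg (by linarith)]
    exact (key _ _ h).trans (mll (las _) D.hC.le)

lemma AL_max (D : ALD α β C U ξ m ξt r θ) : ∃ C1 > 0, ∀ e > 0, ∃ A0 > 0, ∀ A ≥ A0,
    ∀ t ∈ Icc α β, ∀ y ∈ UI, ∀ z ∈ bx α β,
    supc α β U ξ A t (ξ t y) = U z.1 z.2 - A * ((z.1 - t) ^ 2 + (ξ z.1 z.2 - ξ t y) ^ 2) →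
    ∃ d, 0 ≤ d ∧ d ≤ e ∧ A * d ^ 2 ≤ e ∧ |z.1 - t| ≤ d ∧ |ξ z.1 z.2 - ξ t y| ≤ d ∧
      |z.2 - y| ≤ C1 * d ∧ C1 * d ≤ e ∧ U z.1 z.2 ≤ U t y + e := by
  obtain ⟨L, hL, hb⟩ := AL_bd D
  have hC := D.hC
  refine ⟨C * (1 + L), by positivity, fun e he => ?_⟩
  have huc := (bx_compact α β).uniformContinuousOn_of_continuous D.Uc.co
  rw [Metric.uniformContinuousOn_iff] at huc
  obtain ⟨δ, hδ, hu⟩ := huc e he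
  set C1 := C * (1 + L) with hC1
  have hC1p : 0 < C1 := by positivity
  obtain ⟨ε, hε, hε1, hε2, hε3, hε4⟩ : ∃ ε > 0, ε ≤ e ∧ C1 * ε ≤ e ∧ ε < δ ∧ C1 * ε < δ := by
    refine ⟨min (min e (e / C1)) (min (δ / 2) (δ / (2 * C1))), by positivity, ?_, ?_, ?_, ?_⟩
    · exact (min_le_left _ _).trans (min_le_left _ _)
    · have : min (min e (e / C1)) (min (δ / 2) (δ / (2 * C1))) ≤ e / C1 :=
        (min_le_left _ _).trans (mir _ _)
      rw [le_div_iff₀ hC1p] at this; linarith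
    · have : min (min e (e / C1)) (min (δ / 2) (δ / (2 * C1))) ≤ δ / 2 :=
        (mir _ _).trans (min_le_left _ _)
      linarith
    · have : min (min e (e / C1)) (min (δ / 2) (δ / (2 * C1))) ≤ δ / (2 * C1) :=
        (mir _ _).trans (mir _ _)
      rw [le_div_iff₀ (by positivity)] at this; nlinarith
  refine ⟨2 * L / ε ^ 2, by positivity, fun A hA t ht y hy z hz hmax => ?_⟩
  have hAp : 0 < A := lt_of_lt_of_le (by positivity) hA
  have hge := supc_ge D A t (ξ t y) (mem_bx ht hy)
  rw [hmax] at hge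
  simp at hge
  set q := (z.1 - t) ^ 2 + (ξ z.1 z.2 - ξ t y) ^ 2 with hq
  have hq0 : 0 ≤ q := by positivity
  have hUz := abs_le.1 (hb z.1 hz.1 z.2 hz.2).2.2
  have hUt := abs_le.1 (hb t ht y hy).2.2
  have hd : Real.sqrt q ≤ ε := by
    rw [Real.sqrt_le_left hε.le]
    have : A * q ≤ 2 * L := by linarith
    rw [ge_iff_le, div_le_iff₀ (by positivity)] at hA
    by_contra hcon
    push Not at hcon
    nlinarith
  have hs : Real.sqrt q ^ 2 = q := Real.sq_sqrt hq0
  have a1 : |z.1 - t| ≤ Real.sqrt q := Real.abs_le_sqrt (by rw [hq]; nlinarith [sq_nonneg (ξ z.1 z.2 - ξ t y)])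
  have a2 : |ξ z.1 z.2 - ξ t y| ≤ Real.sqrt q := Real.abs_le_sqrt (by rw [hq]; nlinarith [sq_nonneg (z.1 - t)])
  have a3 : |ξ z.1 y - ξ t y| ≤ L * |z.1 - t| := by
    have := Convex.norm_image_sub_le_of_norm_hasDerivWithin_le (f := fun s => ξ s y)
      (f' := fun s => ξt s y) (s := Icc α β) (C := L) (fun s hs => (D.ξt' s hs y hy).hasDerivWithinAt)
      (fun s hs => (hb s hs y hy).1) (convex_Icc _ _) ht hz.1
    simpa using this
  have a4 : |z.2 - y| ≤ C1 * Real.sqrt q := by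
    have := AL_ξ D z.1 z.2 y
    have h5 : |ξ z.1 z.2 - ξ z.1 y| ≤ |ξ z.1 z.2 - ξ t y| + |ξ z.1 y - ξ t y| := by
      rw [asc (ξ z.1 y)]
      exact abs_sub_le _ _ _
    have h6 : |ξ z.1 z.2 - ξ z.1 y| ≤ (1 + L) * Real.sqrt q := by nlinarith
    calc _ ≤ _ := this
      _ ≤ C * ((1 + L) * Real.sqrt q) := mll h6 hC.le
      _ = _ := by rw [hC1]; ring
  have a5 : C1 * Real.sqrt q ≤ C1 * ε := mll hd hC1p.le
  have a6 := hu z hz (t, y) (mem_bx ht hy) (by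
    rw [Prod.dist_eq]
    apply max_lt
    · exact lt_of_le_of_lt (a1.trans hd) hε3
    · exact lt_of_le_of_lt (a4.trans a5) hε4)
  rw [Real.dist_eq, abs_lt] at a6
  simp at a6
  refine ⟨Real.sqrt q, Real.sqrt_nonneg _, hd.trans hε1, ?_, a1, a2, a4, a5.trans hε2, by linarith⟩
  rw [hs]
  linarith

lemma AL_close (D : ALD α β C U ξ m ξt r θ) : ∀ e > 0, ∃ A0 > 0, ∀ A ≥ A0,
    ∀ t ∈ Icc α β, ∀ y ∈ UI,
    U t y ≤ supc α β U ξ A t (ξ t y) ∧ supc α β U ξ A t (ξ t y) ≤ U t y + e := by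
  obtain ⟨C1, _, h⟩ := AL_max D
  intro e he
  obtain ⟨A0, hA0, h1⟩ := h e he
  refine ⟨A0, hA0, fun A hA t ht y hy => ⟨?_, ?_⟩⟩
  · have hge := supc_ge D A t (ξ t y) (mem_bx ht hy)
    simpa using hge
  · obtain ⟨z, hz, hmax⟩ := supc_att D A t (ξ t y)
    obtain ⟨d, _, _, _, _, _, _, _, h5⟩ := h1 A hA t ht y hy z hz hmax
    rw [hmax]
    have : 0 ≤ A * ((z.1 - t) ^ 2 + (ξ z.1 z.2 - ξ t y) ^ 2) := by
      have : 0 < A := hA0.trans_le hA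
      positivity
    linarith
end

section
variable {α β C : ℝ} {U ξ m ξt r θ : FFF}

/-- At an interior maximizer: second difference lower bound. -/
lemma AL_sd (D : ALD α β C U ξ m ξt r θ) {A t η s y : ℝ} (hs : s ∈ Ioo α β) (hy : y ∈ UO)
    (hmax : supc α β U ξ A t η = U s y - A * ((s - t) ^ 2 + (ξ s y - η) ^ 2)) :
    θ s y = 2 * A * (ξ s y - η) ∧
    ∀ ε > 0, ∀ᶠ h in 𝓝[>] Zr,
      m s y * (2 * A * (s - t) + θ s y * ξt s y + r s y) - ε ≤
      (supc α β U ξ A t (η + h) + supc α β U ξ A t (η - h) - 2 * supc α β U ξ A t η) / h ^ 2 := by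
  have hloc : IsLocalMax (fun z : RR => U z.1 z.2 - A * ((z.1 - t) ^ 2 + (ξ z.1 z.2 - η) ^ 2)) (s, y) := by
    have : bx α β ∈ 𝓝 (s, y) := prod_mem_nhds (Icc_mem_nhds hs.1 hs.2) (Icc_mem_nhds hy.1 hy.2)
    filter_upwards [this] with z hz
    have := supc_ge D A t η hz
    rw [hmax] at this
    exact this
  have hsI : s ∈ Icc α β := occ hs
  have hloc2 : IsLocalMax (fun y' => U s y' - A * ((s - t) ^ 2 + (ξ s y' - η) ^ 2)) y := by
    have ht : Tendsto (fun y' : ℝ => (s, y')) (𝓝 y) (𝓝 (s, y)) := by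
      have : Continuous (fun y' : ℝ => (s, y')) := by fun_prop
      exact this.tendsto y
    exact ht.eventually hloc
  have hmp := D.mpos s y
  have hd : HD (fun y' => U s y' - A * ((s - t) ^ 2 + (ξ s y' - η) ^ 2))
      (θ s y / m s y - A * (2 * (ξ s y - η) * (1 / m s y))) y := by
    have h1 := D.Uy s hsI y hy
    have h2 := (((D.ξy s y).sub_const η).pow 2).const_add ((s - t) ^ 2)
    exact (h1.sub (h2.const_mul A)).cg (fun y => by simp) (by simp)
  have hz := hloc2.hasDerivAt_eq_zero hd
  have hθ : θ s y = 2 * A * (ξ s y - η) := by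
    field_simp at hz
    linarith
  refine ⟨hθ, ?_⟩
  have htouch := D.touch s hs y hy A t η hloc
  obtain ⟨g, gc, g1, g2, gd, -⟩ := inv_lemma (f := ξ s) (f' := fun y => 1 / m s y) (c := 1 / C)
    (by have := D.hC; positivity) (fun y => D.ξy s y)
    (fun y => one_div_le_one_div_of_le (D.mpos s y) (D.mle s y))
  have hgy : g (ξ s y) = y := g1 y
  have hgt : Tendsto g (𝓝 (ξ s y)) (𝓝 y) := by
    have := gc.tendsto (ξ s y); rwa [hgy] at this
  have hgI : ∀ᶠ x in 𝓝 (ξ s y), g x ∈ UO := hgt.eventually (omn hy.1 hy.2)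
  have hH1 : ∀ᶠ x in 𝓝 (ξ s y), HD (fun x => U s (g x)) (θ s (g x)) x := by
    filter_upwards [hgI] with x hx
    have h3 := (D.Uy s hsI (g x) hx).comp x (gd x)
    have := D.mpos s (g x)
    refine h3.cg (fun y => by simp) ?_
    field_simp
  have hH2 : HD (fun x => θ s (g x))
      (m s y * (2 * A * (s - t) + θ s y * ξt s y + r s y)) (ξ s y) := by
    have h3 := HasDerivAt.comp (ξ s y) (h₂ := θ s) (by rw [hgy]; exact htouch) (gd (ξ s y))
    refine h3.cg (fun y => by simp) ?_
    simp [hgy, hθ]; ring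
  have hsd := sd_lemma hH1 hH2
  intro ε hε
  have ev1 := hsd.eventually (lt_mem_nhds (show m s y * (2 * A * (s - t) + θ s y * ξt s y + r s y) - ε < _ by linarith))
  have t1 : Tendsto (fun h : ℝ => ξ s y + h) (𝓝 0) (𝓝 (ξ s y)) := by
    have : Continuous (fun h : ℝ => ξ s y + h) := by fun_prop
    simpa using this.tendsto 0
  have t2 : Tendsto (fun h : ℝ => ξ s y - h) (𝓝 0) (𝓝 (ξ s y)) := by
    have : Continuous (fun h : ℝ => ξ s y - h) := by fun_prop
    simpa using this.tendsto 0
  filter_upwards [ev1, nwn (t1.eventually hgI), nwn (t2.eventually hgI),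
    smn] with h hh1 hh2 hh3 hh4
  have hh4 : 0 < h := hh4
  refine hh1.le.trans ?_
  apply div_le_div_of_nonneg_right _ (by positivity)
  have q1 := supc_ge D A t (η + h) (mem_bx hsI (occ hh2))
  have q2 := supc_ge D A t (η - h) (mem_bx hsI (occ hh3))
  simp only [g2, g1] at q1 q2 ⊢
  rw [hmax]
  have e1 : ξ s y + h - (η + h) = ξ s y - η := by ring
  have e2 : ξ s y - h - (η - h) = ξ s y - η := by ring
  rw [e1] at q1
  rw [e2] at q2
  linarith

set_option maxHeartbeats 1000000 in
lemma AL_pt (D : ALD α β C U ξ m ξt r θ) {t1 t2 δ : ℝ} (h1 : α < t1) (h2 : t2 < β) (hδ : 0 < δ) :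
    ∀ e > 0, ∃ A0 > 0, ∀ A ≥ A0, ∃ h0 > 0, ∀ t ∈ Icc t1 t2, ∀ y ∈ Icc δ (1 - δ), ∃ l,
    (∀ ε > 0, ∀ᶠ h in 𝓝[>] Zr, l - ε ≤
      (supc α β U ξ A t (ξ t y + h) + supc α β U ξ A t (ξ t y - h)
        - 2 * supc α β U ξ A t (ξ t y)) / h ^ 2) ∧
    (∀ h, 0 < h → h ≤ h0 → m t y * ((supc α β U ξ A t (ξ t y)
        - supc α β U ξ A (t - h) (ξ (t - h) y)) / h + r t y - e) ≤ l) := by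
  intro e he
  obtain ⟨L, hL, hb⟩ := AL_bd D
  obtain ⟨C1, hC1, hmx⟩ := AL_max D
  have hC := D.hC
  obtain ⟨z0, hz0, hmin⟩ := (bx_compact α β).exists_isMinOn (bx_nonempty D.hαβ) D.mc.co
  set mm := m z0.1 z0.2 with hmm
  have hmmp : 0 < mm := D.mpos _ _
  have hmml : ∀ t ∈ Icc α β, ∀ y ∈ UI, mm ≤ m t y := fun t ht y hy => hmin (mem_bx ht hy)
  have uc1 := (bx_compact α β).uniformContinuousOn_of_continuous D.ξtc
  have uc2 := (bx_compact α β).uniformContinuousOn_of_continuous D.rc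
  rw [Metric.uniformContinuousOn_iff] at uc1 uc2
  obtain ⟨δ1, hδ1, uc1⟩ := uc1 (e / (4 * C)) (by positivity)
  obtain ⟨δ2, hδ2, uc2⟩ := uc2 (e / 4) (by positivity)
  set Ke := (C * (1 + C1)) * (2 + C * L + L) with hKe
  have hKep : 0 < Ke := by positivity
  obtain ⟨e', he', b1, b2, b3, b4, b5, b6⟩ : ∃ e' > 0, e' < t1 - α ∧ e' < β - t2 ∧ e' < δ ∧
      e' < δ1 / 2 ∧ e' < δ2 ∧ Ke * e' ≤ mm * (e / 4) := by
    have q1 : 0 < t1 - α := by linarith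
    have q2 : 0 < β - t2 := by linarith
    have : ∀ᶠ x in 𝓝[>] Zr, x < t1 - α ∧ x < β - t2 ∧ x < δ ∧
      x < δ1 / 2 ∧ x < δ2 ∧ x < mm * (e / 4) / Ke := by
      refine nwn ?_
      filter_upwards [gt_mem_nhds q1, gt_mem_nhds q2, gt_mem_nhds hδ, gt_mem_nhds (half_pos hδ1),
        gt_mem_nhds hδ2, gt_mem_nhds (show 0 < mm * (e / 4) / Ke by positivity)] with x a1 a2 a3 a4 a5 a6
      exact ⟨a1, a2, a3, a4, a5, a6⟩
    obtain ⟨x, ⟨a1, a2, a3, a4, a5, a6⟩, hx⟩ := (this.and smn).exists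
    refine ⟨x, hx, a1, a2, a3, a4, a5, ?_⟩
    rw [lt_div_iff₀ hKep] at a6
    linarith
  obtain ⟨A0, hA0, hmx⟩ := hmx e' he'
  refine ⟨A0, hA0, fun A hA => ?_⟩
  have hAp : 0 < A := hA0.trans_le hA
  refine ⟨min (t1 - α) (min (δ1 / 2) (e / (4 * (A * (1 + L ^ 2))))), ?_, ?_⟩
  · have q1 : 0 < t1 - α := by linarith
    positivity
  intro t ht y hy
  have htI : t ∈ Icc α β := ⟨by linarith [ht.1], by linarith [ht.2]⟩
  have hyI : y ∈ UI := ⟨by linarith [hy.1], by linarith [hy.2]⟩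
  obtain ⟨⟨s, y'⟩, hz, hmax⟩ := supc_att D A t (ξ t y)
  obtain ⟨d, d0, d1, d2, d3, d4, d5, d6, -⟩ := hmx A hA t htI y hyI _ hz hmax
  simp only at hmax d3 d4 d5
  have d3' := abs_le.1 d3
  have d5' := abs_le.1 (d5.trans d6)
  have hs : s ∈ Ioo α β := ⟨by linarith [ht.1], by linarith [ht.2]⟩
  have hy' : y' ∈ UO := ⟨by linarith [hy.1], by linarith [hy.2]⟩
  have hsI : s ∈ Icc α β := occ hs
  have hyI' : y' ∈ UI := occ hy'
  obtain ⟨hθ, hsd⟩ := AL_sd D hs hy' hmax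
  refine ⟨_, hsd, fun h hh hh0 => ?_⟩
  have k1 : h ≤ t1 - α := hh0.trans (min_le_left _ _)
  have k2 : h ≤ δ1 / 2 := hh0.trans ((mir _ _).trans (min_le_left _ _))
  have k3 : h ≤ e / (4 * (A * (1 + L ^ 2))) := hh0.trans ((mir _ _).trans (mir _ _))
  have k3' : A * h * (1 + L ^ 2) ≤ e / 4 := by
    rw [le_div_iff₀ (by positivity)] at k3
    linarith
  have hth : t - h ∈ Icc α β := ⟨by linarith [ht.1], by linarith [htI.2]⟩
  obtain ⟨t', ht', hte⟩ := exists_hasDerivAt_eq_slope (fun s => ξ s y) (fun s => ξt s y)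
    (a := t - h) (b := t) (by linarith)
    (fun x hx => (D.ξt' x ⟨hth.1.trans hx.1, hx.2.trans htI.2⟩ y hyI).cw)
    (fun x hx => D.ξt' x ⟨hth.1.trans hx.1.le, hx.2.le.trans htI.2⟩ y hyI)
  have htI' : t' ∈ Icc α β := ⟨hth.1.trans ht'.1.le, ht'.2.le.trans htI.2⟩
  have hdiff : ξ t y - ξ (t - h) y = h * ξt t' y := by
    rw [hte]; simp; field_simp
  have g1 := supc_ge D A (t - h) (ξ (t - h) y) (mem_bx hsI hyI')
  simp only at g1
  set p := 2 * A * (s - t) + θ s y' * ξt s y' with hp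
  have bθ := D.θb s hsI y' hy'
  have bξ := (hb t' htI' y hyI).1
  have bξ2 : (ξt t' y) ^ 2 ≤ L ^ 2 := by
    have := abs_le.1 bξ
    exact sq_le_sq' this.1 this.2
  have e1 : |ξt t' y - ξt s y'| ≤ e / (4 * C) := by
    have := uc1 (t', y) (mem_bx htI' hyI) (s, y') (mem_bx hsI hyI') (by
      rw [Prod.dist_eq]
      apply max_lt
      · simp only [Real.dist_eq]
        rw [abs_lt]
        constructor <;> linarith [ht'.1, ht'.2]
      · simp only [Real.dist_eq]
        rw [abs_lt]
        constructor <;> linarith)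
    exact this.le
  have e2 : |r t y - r s y'| ≤ e / 4 := by
    have := uc2 (t, y) (mem_bx htI hyI) (s, y') (mem_bx hsI hyI') (by
      rw [Prod.dist_eq]
      apply max_lt
      · simp only [Real.dist_eq]
        rw [abs_lt]
        constructor <;> linarith
      · simp only [Real.dist_eq]
        rw [abs_lt]
        constructor <;> linarith)
    exact this.le
  have e3 : θ s y' * (ξt t' y - ξt s y') ≤ e / 4 := by
    calc _ ≤ |θ s y' * (ξt t' y - ξt s y')| := las _
      _ = |θ s y'| * |ξt t' y - ξt s y'| := abs_mul _ _
      _ ≤ C * (e / (4 * C)) := by gcongr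
      _ = e / 4 := by field_simp
  have slope : (supc α β U ξ A t (ξ t y) - supc α β U ξ A (t - h) (ξ (t - h) y)) / h ≤
      p + θ s y' * (ξt t' y - ξt s y') + A * h * (1 + L ^ 2) := by
    rw [div_le_iff₀ hh, hmax]
    have hη : ξ (t - h) y = ξ t y - h * ξt t' y := by linarith
    rw [hη] at g1
    have : 2 * A * (s - t) * h + A * h ^ 2 + h * θ s y' * ξt t' y + A * h ^ 2 * ξt t' y ^ 2 ≤
        (p + θ s y' * (ξt t' y - ξt s y') + A * h * (1 + L ^ 2)) * h := by
      rw [hp]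
      have : A * h ^ 2 * ξt t' y ^ 2 ≤ A * h ^ 2 * L ^ 2 := by gcongr
      linarith
    rw [hη]
    have ex : A * ((s - (t - h)) ^ 2 + (ξ s y' - (ξ t y - h * ξt t' y)) ^ 2)
        - A * ((s - t) ^ 2 + (ξ s y' - ξ t y) ^ 2) =
        2 * A * (s - t) * h + A * h ^ 2 + h * θ s y' * ξt t' y + A * h ^ 2 * ξt t' y ^ 2 := by
      rw [hθ]; ring
    linarith
  have e4 : |m t y - m s y'| ≤ C * (1 + C1) * d := by
    have := D.mLip t htI s hsI y hyI y' hyI'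
    rw [asc t, asc y] at this
    calc _ ≤ _ := this
      _ ≤ C * (d + C1 * d) := by gcongr
      _ = _ := by ring
  have e5 : |p + r s y'| ≤ 2 * A * d + C * L + L := by
    calc |p + r s y'| ≤ |p| + |r s y'| := abs_add_le _ _
      _ ≤ (|2 * A * (s - t)| + |θ s y' * ξt s y'|) + |r s y'| := by gcongr; exact abs_add_le _ _
      _ = (2 * A * |s - t| + |θ s y'| * |ξt s y'|) + |r s y'| := by
        rw [abs_mul (2 * A), abs_mul (θ s y'), abs_of_pos (show 0 < 2 * A by positivity)]
      _ ≤ (2 * A * d + C * L) + L := by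
        gcongr
        · exact (hb s hsI y' hyI').1
        · exact (hb s hsI y' hyI').2.1
  have e6 : (m t y - m s y') * (p + r s y') ≤ mm * (e / 4) := by
    calc _ ≤ |(m t y - m s y') * (p + r s y')| := las _
      _ = |m t y - m s y'| * |p + r s y'| := abs_mul _ _
      _ ≤ (C * (1 + C1) * d) * (2 * A * d + C * L + L) := by gcongr
      _ = (C * (1 + C1)) * (2 * (A * d ^ 2) + (C * L + L) * d) := by ring
      _ ≤ (C * (1 + C1)) * (2 * e' + (C * L + L) * e') := by gcongr
      _ = Ke * e' := by rw [hKe]; ring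
      _ ≤ _ := b6
  have e7 := hmml t htI y hyI
  have e2' := abs_le.1 e2
  have f1 : (supc α β U ξ A t (ξ t y) - supc α β U ξ A (t - h) (ξ (t - h) y)) / h + r t y - e ≤
    p + r s y' - e / 4 := by linarith [e2'.2]
  have f2 := mll f1 (D.mpos t y).le
  have : mm * (e / 4) ≤ m t y * (e / 4) := by gcongr
  linarith
end

noncomputable def sdf (f : FF) (x h : ℝ) : ℝ := (f (x + h) + f (x - h) - 2 * f x) / h ^ 2

lemma sdf_cont {f : FF} (hf : Continuous f) (h : ℝ) : Continuous fun x => sdf f x h := by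
  unfold sdf
  fun_prop

lemma sdf_deriv {f f1 : FF} (hf : ∀ x, HD f (f1 x) x) (h x : ℝ) :
    HD (fun x => sdf f x h) (sdf f1 x h) x := by
  unfold sdf
  have a1 := (hf (x + h)).comp_add_const x h
  have a2 := (hf (x - h)).comp_sub_const x h
  exact (((a1.add a2).sub ((hf x).const_mul 2)).div_const (h ^ 2)).cg (fun y => by simp) (by simp)

lemma sd_int {f m ξ φ φ' Λ G : FF} {B : ℝ} (hf : Continuous f)
    (hm : Continuous m) (hmpos : ∀ y, 0 < m y) (hξ : ∀ y, HD ξ (1 / m y) y)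
    (hφ : ∀ y, HD φ (φ' y) y) (hφ' : Continuous φ') (hφ0 : ∀ y, 0 ≤ φ y)
    (b1 : φ 0 = 0) (b2 : φ 1 = 0) (b3 : φ' 0 = 0) (b4 : φ' 1 = 0)
    (hΛ : ∀ y ∈ UO, HD (fun y => m y * φ' y) (Λ y) y)
    (hΛc : CO Λ (Icc 0 1)) (hG : CO G (Icc 0 1))
    (hl : ∀ y ∈ UI, φ y ≠ 0 → ∃ l, (∀ ε > 0, ∀ᶠ h in 𝓝[>] Zr, l - ε ≤ sdf f (ξ y) h) ∧ G y ≤ l)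
    (hB : ∀ h > 0, ∀ x, -B ≤ sdf f x h) :
    ∫ y in Zr..1, φ y / m y * G y ≤ ∫ y in Zr..1, Λ y * f (ξ y) := by
  have hφc : Continuous φ := cif fun y => (hφ y).continuousAt
  have hξc : Continuous ξ := cif fun y => (hξ y).continuousAt
  have hu : uIcc Zr 1 = Icc 0 1 := uol zlo
  set f1 : FF := fun x => ∫ s in Zr..x, f s with hf1
  set f2 : FF := fun x => ∫ s in Zr..x, f1 s with hf2
  have d1 : ∀ x, HD f1 (f x) x := fun x =>
    ihr (hf.ii _ _)
      hf.stronglyMeasurable.stronglyMeasurableAtFilter hf.continuousAt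
  have hf1c : Continuous f1 := cif fun y => (d1 y).continuousAt
  have d2 : ∀ x, HD f2 (f1 x) x := fun x =>
    ihr (hf1c.ii _ _)
      hf1c.stronglyMeasurable.stronglyMeasurableAtFilter hf1c.continuousAt
  have hf2c : Continuous f2 := cif fun y => (d2 y).continuousAt
  have hmne : ∀ y, m y ≠ 0 := fun y => (hmpos y).ne'
  have cdiv : Continuous fun y => φ y / m y := hφc.div hm hmne
  have ibp : ∀ h, ∫ y in Zr..1, φ y / m y * sdf f (ξ y) h = ∫ y in Zr..1, Λ y * sdf f2 (ξ y) h := by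
    intro h
    have i1 : II (fun y => φ y / m y * sdf f (ξ y) h) volume 0 1 :=
      (cdiv.mul ((sdf_cont hf h).comp hξc)).ii _ _
    have i2 : II (fun y => Λ y * sdf f2 (ξ y) h) volume 0 1 := by
      apply ContinuousOn.ii
      rw [hu]
      exact hΛc.mul ((sdf_cont hf2c h).comp hξc).co
    have key := intervalIntegral.integral_eq_sub_of_hasDerivAt_of_le (a := 0) (b := 1)
      (f := fun y => φ y * sdf f1 (ξ y) h - m y * φ' y * sdf f2 (ξ y) h)
      (f' := fun y => φ y / m y * sdf f (ξ y) h - Λ y * sdf f2 (ξ y) h) zlo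
      (by
        have c1 := (sdf_cont hf1c h).comp hξc
        have c2 := (sdf_cont hf2c h).comp hξc
        exact ((hφc.mul c1).sub ((hm.mul hφ').mul c2)).co)
      (by
        intro y hy
        have e1 := (sdf_deriv d1 h (ξ y)).comp y (hξ y)
        have e2 := (sdf_deriv d2 h (ξ y)).comp y (hξ y)
        refine (((hφ y).mul e1).sub ((hΛ y hy).mul e2)).cg (fun y => by simp) ?_
        simp
        have := hmne y
        field_simp
        ring) (i1.sub i2)
    rw [isb i1 i2] at key
    simp [b1, b2, b3, b4] at key
    linarith
  have hGb : ∃ K, ∀ y ∈ UI, |φ y / m y| ≤ K ∧ |G y| ≤ K ∧ |Λ y| ≤ K := by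
    obtain ⟨K1, h1⟩ := bIcc (cdiv.co (s := UI))
    obtain ⟨K2, h2⟩ := bIcc hG
    obtain ⟨K3, h3⟩ := bIcc hΛc
    exact ⟨max K1 (max K2 K3), fun y hy => ⟨(h1 y hy).trans (by simp), (h2 y hy).trans (by simp),
      (h3 y hy).trans (by simp)⟩⟩
  obtain ⟨K, hK⟩ := hGb
  have hK0 : 0 ≤ K := (ann _).trans (hK 0 (by simp)).1
  have hui : uIoc Zr 1 = Ioc 0 1 := uIoc_of_le zlo
  have hsub : ∀ y, y ∈ uIoc Zr 1 → y ∈ UI := fun y hy => by rw [hui] at hy; exact ⟨hy.1.le, hy.2⟩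
  have minc : ∀ h, CO (fun y => φ y / m y * min (sdf f (ξ y) h) (G y)) (Icc 0 1) := fun h =>
    cdiv.co.mul (ContinuousOn.inf ((sdf_cont hf h).comp hξc).co hG)
  have lim1 : Tendsto (fun h => ∫ y in Zr..1, φ y / m y * min (sdf f (ξ y) h) (G y)) (𝓝[>] 0)
      (𝓝 (∫ y in Zr..1, φ y / m y * G y)) := by
    apply intervalIntegral.tendsto_integral_filter_of_dominated_convergence (fun _ => K * (K + |B|))
    · refine Eventually.of_forall fun h => ?_
      exact ((minc h).mono hsub).aestronglyMeasurable measurableSet_uIoc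
    · filter_upwards [smn] with h hh
      refine Eventually.of_forall fun y hy => ?_
      obtain ⟨k1, k2, _⟩ := hK y (hsub y hy)
      rw [nea, abs_mul]
      apply mul_le_mul k1 _ (ann _) hK0
      rw [abs_le]
      have k2' := abs_le.1 k2
      refine ⟨?_, ?_⟩
      · apply le_min
        · linarith [hB h hh (ξ y), las B]
        · linarith [ann B]
      · exact (mir _ _).trans (by linarith [ann B])
    · simp
    · refine Eventually.of_forall fun y hy => ?_
      by_cases h0 : φ y = 0
      · simp [h0]
      · obtain ⟨l, hl1, hl2⟩ := hl y (hsub y hy) h0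
        apply Tendsto.const_mul
        rw [Metric.tendsto_nhds]
        intro ε hε
        filter_upwards [hl1 (ε / 2) (half_pos hε)] with h hh
        rw [Real.dist_eq, abs_lt]
        constructor
        · have : G y - ε / 2 ≤ min (sdf f (ξ y) h) (G y) := le_min (by linarith) (by linarith)
          linarith
        · have := mir (sdf f (ξ y) h) (G y)
          linarith
  have lim2 : Tendsto (fun h => ∫ y in Zr..1, Λ y * sdf f2 (ξ y) h) (𝓝[>] 0)
      (𝓝 (∫ y in Zr..1, Λ y * f (ξ y))) := by
    obtain ⟨K1, h1⟩ := bIcc (hξc.co (s := UI))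
    obtain ⟨K2, h2⟩ := bIcc
      (hf.co (s := Icc (-(K1 + 1)) (K1 + 1)))
    apply intervalIntegral.tendsto_integral_filter_of_dominated_convergence (fun _ => K * K2)
    · refine Eventually.of_forall fun h => ?_
      exact ((hΛc.mul ((sdf_cont hf2c h).comp hξc).co).mono hsub).aestronglyMeasurable
        measurableSet_uIoc
    · filter_upwards [smn, nwn (Iio_mem_nhds (zero_lt_one' ℝ))] with h hh hh1
      have hh : 0 < h := hh
      have hh1 : h < 1 := hh1
      refine Eventually.of_forall fun y hy => ?_
      obtain ⟨_, _, k3⟩ := hK y (hsub y hy)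
      rw [nea, abs_mul]
      apply mul_le_mul k3 _ (ann _) hK0
      obtain ⟨c, hc, hce⟩ := sd_mvt d2 d1 (ξ y) hh
      unfold sdf
      rw [hce]
      have := abs_le.1 (h1 y (hsub y hy))
      exact h2 c ⟨by linarith [hc.1], by linarith [hc.2]⟩
    · simp
    · refine Eventually.of_forall fun y hy => ?_
      apply Tendsto.const_mul
      exact sd_lemma (Eventually.of_forall d2) (d1 (ξ y))
  refine le_of_tendsto_of_tendsto lim1 lim2 ?_
  refine Eventually.of_forall fun h => ?_
  simp only
  rw [← ibp h]
  apply intervalIntegral.integral_mono_on zlo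
  · apply ContinuousOn.ii
    rw [hu]; exact minc h
  · exact (cdiv.mul ((sdf_cont hf h).comp hξc)).ii _ _
  · intro y hy
    have : 0 ≤ φ y / m y := div_nonneg (hφ0 y) (hmpos y).le
    exact mll (min_le_left _ _) this

lemma slice_right {f : FFF} (h : Continuous fun z : RR => f z.1 z.2) (t : ℝ) : Continuous (f t) :=
  h.comp (by fun_prop : Continuous fun y : ℝ => (t, y))

lemma slice_left {f : FFF} (h : Continuous fun z : RR => f z.1 z.2) (y : ℝ) : Continuous fun t => f t y :=
  h.comp (by fun_prop : Continuous fun t : ℝ => (t, y))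

set_option maxHeartbeats 1000000 in
theorem AL_main {α β C : ℝ} {U ξ m ξt r θ : FFF} (D : ALD α β C U ξ m ξt r θ)
    {φ φ' K : FF} {Λ : FFF} {δ : ℝ} (hδ : 0 < δ)
    (hφ : ∀ y, HD φ (φ' y) y) (hφ' : Continuous φ') (hφ0 : ∀ y, 0 ≤ φ y)
    (hφs : ∀ y, y ∉ Icc δ (1 - δ) → φ y = 0) (hφs' : ∀ y, y ∉ Icc δ (1 - δ) → φ' y = 0)
    (hΛ : ∀ t ∈ Icc α β, ∀ y ∈ UO, HD (fun y => m t y * φ' y) (Λ t y) y)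
    (hΛc : ∀ t ∈ Icc α β, CO (Λ t) (Icc 0 1)) (hΛb : ∀ t ∈ Icc α β, ∀ y ∈ UI, |Λ t y| ≤ C)
    (hK : ∀ t ∈ Ioo α β, HD K ((∫ y in Zr..1, Λ t y * U t y) - ∫ y in Zr..1, φ y * r t y) t) :
    AntitoneOn (fun t => (∫ y in Zr..1, φ y * U t y) - K t) (Ioo α β) := by
  intro t1 ht1 t2 ht2 h12
  have hφc : Continuous φ := cif fun y => (hφ y).continuousAt
  have hu : uIcc Zr 1 = Icc 0 1 := uol zlo
  have n0 : Zr ∉ Icc δ (1 - δ) := fun h => by linarith [h.1]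
  have n1 : (1:ℝ) ∉ Icc δ (1 - δ) := fun h => by linarith [h.2]
  have hC := D.hC
  set I := ∫ y in Zr..1, φ y with hI
  have hI0 : 0 ≤ I := intervalIntegral.integral_nonneg zlo fun y _ => hφ0 y
  suffices H : ∀ e > 0, ((∫ y in Zr..1, φ y * U t2 y) - K t2) - ((∫ y in Zr..1, φ y * U t1 y) - K t1) ≤
      e * ((I + C + 1) * (t2 - t1) + I) by
    simp only
    by_contra hcon
    push Not at hcon
    set X := ((∫ y in Zr..1, φ y * U t2 y) - K t2) - ((∫ y in Zr..1, φ y * U t1 y) - K t1) with hX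
    have hXp : 0 < X := by linarith
    have hY : 0 ≤ (I + C + 1) * (t2 - t1) + I := by
      have : 0 ≤ t2 - t1 := by linarith
      positivity
    have := H (X / (2 * ((I + C + 1) * (t2 - t1) + I + 1))) (by positivity)
    have h2 : X / (2 * ((I + C + 1) * (t2 - t1) + I + 1)) * ((I + C + 1) * (t2 - t1) + I) ≤ X / 2 := by
      rw [div_mul_eq_mul_div, div_le_div_iff₀ (by positivity) (by positivity)]
      have : 0 ≤ X * 2 := by linarith
      linarith
    linarith
  intro e he
  obtain ⟨A1, hA1, hpt⟩ := AL_pt D ht1.1 ht2.2 hδ e he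
  obtain ⟨A2, hA2, hcl⟩ := AL_close D e he
  set A := max A1 A2 with hA
  obtain ⟨h0, hh0, hpt⟩ := hpt A (lml _ _)
  have hcl := hcl A (lmr _ _)
  set w : FFF := fun t y => supc α β U ξ A t (ξ t y) with hw
  have hsc := supc_cont D A
  have hξc := D.ξc
  have hUc := D.Uc
  have hwc : Continuous fun z : RR => w z.1 z.2 := by
    have : Continuous fun z : RR => (z.1, ξ z.1 z.2) := by fun_prop
    exact hsc.comp this
  have hwt : ∀ t, Continuous (w t) := fun t => slice_right hwc t
  have hUt : ∀ t, Continuous (U t) := fun t => slice_right hUc t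
  have hmt : ∀ t, Continuous (m t) := fun t => slice_right D.mc t
  have hpar : Continuous fun t => ∫ y in Zr..1, φ y * w t y := by
    apply intervalIntegral.continuous_parametric_intervalIntegral_of_continuous'
    have : Continuous fun z : RR => φ z.2 * w z.1 z.2 := (hφc.comp csn).mul hwc
    exact this
  have hsubI : ∀ t ∈ Icc t1 t2, t ∈ Ioo α β := fun t ht => ⟨ht1.1.trans_le ht.1, ht.2.trans_lt ht2.2⟩
  have hdini := left_dini (f := fun t => (∫ y in Zr..1, φ y * w t y) - K t)
    (E := e * (I + C + 1)) h12
    (hpar.co.sub fun t ht => (hK t (hsubI t ht)).cw)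
    (by
      intro t ht
      have htc : t ∈ Icc t1 t2 := ⟨ht.1.le, ht.2⟩
      have htI : t ∈ Ioo α β := hsubI t htc
      have htI' : t ∈ Icc α β := occ htI
      have hKt := hK t htI
      set K' := (∫ y in Zr..1, Λ t y * U t y) - ∫ y in Zr..1, φ y * r t y with hK'
      have hrc : CO (r t) (Icc 0 1) := by
        have := D.rc.comp (by fun_prop : Continuous fun y : ℝ => (t, y)).co
          (s := Icc 0 1) (fun y hy => mem_bx htI' hy)
        exact this
      have hKs : ∀ᶠ h in 𝓝[>] Zr, (K' - e) * h ≤ K t - K (t - h) := by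
        have hd : HD (fun h => K (t - h)) (-K') 0 :=
          HasDerivAt.comp_const_sub t 0 (by simpa using hKt)
        have := hd.tendsto_slope_zero_right
        have ev := this.eventually (gt_mem_nhds (show -K' < -K' + e by linarith))
        filter_upwards [ev, smn] with h h1 h2
        have h2 : 0 < h := h2
        have h3 : h⁻¹ * (K (t - h) - K t) < e - K' := by
          simp at h1
          linarith
        rw [inv_mul_lt_iff₀ h2] at h3
        linarith
      filter_upwards [hKs, smn, nwn (Iic_mem_nhds hh0)] with h hks hp hle
      have hp : 0 < h := hp
      have hle : h ≤ h0 := hle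
      have hGc : CO (fun y => m t y * ((w t y - w (t - h) y) / h + r t y - e)) (Icc 0 1) := by
        have c1 : Continuous fun y => (w t y - w (t - h) y) / h := ((hwt t).sub (hwt (t - h))).div_const h
        exact (hmt t).co.mul ((c1.co.add hrc).sub continuousOn_const)
      have key := sd_int (f := fun η => supc α β U ξ A t η) (m := m t) (ξ := ξ t) (φ := φ) (φ' := φ')
        (Λ := Λ t) (G := fun y => m t y * ((w t y - w (t - h) y) / h + r t y - e)) (B := 2 * A)
        (slice_right hsc t) (hmt t) (D.mpos t) (D.ξy t) hφ hφ' hφ0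
        (hφs 0 n0) (hφs 1 n1) (hφs' 0 n0) (hφs' 1 n1) (hΛ t htI') (hΛc t htI') hGc
        (by
          intro y hy hne
          have hy2 : y ∈ Icc δ (1 - δ) := by
            by_contra hcon
            exact hne (hφs y hcon)
          obtain ⟨l, l1, l2⟩ := hpt t htc y hy2
          exact ⟨l, l1, l2 h hp hle⟩)
        (fun h hh x => supc_sd D A t x hh)
      have iw : ∀ t, II (fun y => φ y * w t y) volume 0 1 := fun t =>
        (hφc.mul (hwt t)).ii _ _
      have ir : II (fun y => φ y * r t y) volume 0 1 := by
        apply ContinuousOn.ii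
        rw [hu]
        exact hφc.co.mul hrc
      have iφ : II φ volume 0 1 := hφc.ii _ _
      have ilhs : ∫ y in Zr..1, φ y / m t y * (m t y * ((w t y - w (t - h) y) / h + r t y - e)) =
          ((∫ y in Zr..1, φ y * w t y) - ∫ y in Zr..1, φ y * w (t - h) y) / h
            + (∫ y in Zr..1, φ y * r t y) - e * I := by
        rw [hI, ← isb (iw t) (iw (t - h)), ← intervalIntegral.integral_div,
          ← icm,
          ← iad (((iw t).sub (iw (t - h))).div_const h) ir,
          ← isb ((((iw t).sub (iw (t - h))).div_const h).add ir) (iφ.const_mul e)]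
        congr 1
        ext y
        have := (D.mpos t y).ne'
        field_simp
      have irhs : ∫ y in Zr..1, Λ t y * w t y ≤ (∫ y in Zr..1, Λ t y * U t y) + C * e := by
        have i1 : II (fun y => Λ t y * w t y) volume 0 1 := by
          apply ContinuousOn.ii
          rw [hu]
          exact (hΛc t htI').mul (hwt t).co
        have i2 : II (fun y => Λ t y * U t y) volume 0 1 := by
          apply ContinuousOn.ii
          rw [hu]
          exact (hΛc t htI').mul (hUt t).co
        have : (∫ y in Zr..1, Λ t y * U t y) + C * e = ∫ y in Zr..1, (Λ t y * U t y + C * e) := by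
          rw [iad i2 (by simp)]; simp
        rw [this]
        apply intervalIntegral.integral_mono_on zlo i1 (i2.add (by simp))
        intro y hy
        obtain ⟨c1, c2⟩ := hcl t htI' y hy
        have c3 := abs_le.1 (hΛb t htI' y hy)
        change Λ t y * supc α β U ξ A t (ξ t y) ≤ _
        clear_value I A w
        generalize supc α β U ξ A t (ξ t y) = S at c1 c2 ⊢
        generalize U t y = S' at c1 c2 ⊢
        generalize Λ t y = l at c3 ⊢
        have q1 : l * (S - S') ≤ C * (S - S') := mlr c3.2 (by linarith)
        have q2 : C * (S - S') ≤ C * e := mll (by linarith) hC.le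
        linarith
      rw [ilhs] at key
      have key2 := key.trans irhs
      have key3 : ((∫ y in Zr..1, φ y * w t y) - ∫ y in Zr..1, φ y * w (t - h) y) / h ≤
          K' + e * I + C * e := by rw [hK']; linarith
      rw [div_le_iff₀ hp] at key3
      linarith)
  have iw : ∀ t, II (fun y => φ y * w t y) volume 0 1 := fun t =>
        (hφc.mul (hwt t)).ii _ _
  have iU : ∀ t, II (fun y => φ y * U t y) volume 0 1 := fun t =>
        (hφc.mul (hUt t)).ii _ _
  have f1 : ∫ y in Zr..1, φ y * U t2 y ≤ ∫ y in Zr..1, φ y * w t2 y := by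
    apply intervalIntegral.integral_mono_on zlo (iU t2) (iw t2)
    intro y hy
    exact mll (hcl t2 (occ ht2) y hy).1 (hφ0 y)
  have f2 : ∫ y in Zr..1, φ y * w t1 y ≤ (∫ y in Zr..1, φ y * U t1 y) + e * I := by
    have iφ : II φ volume 0 1 := hφc.ii _ _
    rw [hI, ← icm, ← iad (iU t1) (iφ.const_mul e)]
    apply intervalIntegral.integral_mono_on zlo (iw t1) ((iU t1).add (iφ.const_mul e))
    intro y hy
    have := mll (hcl t1 (occ ht1) y hy).2 (hφ0 y)
    change φ y * supc α β U ξ A t1 (ξ t1 y) ≤ _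
    linarith
  linarith

section
variable {P μ : FF} {Pext : ℝ} (sol : PistonSol P μ Pext)

noncomputable def eA (t : ℝ) : ℝ := sol.a (max t 0)
noncomputable def eB (t : ℝ) : ℝ := sol.b (max t 0)
noncomputable def ecl (t x : ℝ) : ℝ := max (eA sol t) (min x (eB sol t))
noncomputable def eR (t x : ℝ) : ℝ := sol.ρ (max t 0) (ecl sol t x)
noncomputable def eV (t x : ℝ) : ℝ := sol.v (max t 0) (ecl sol t x)

lemma eA_cont : Continuous (eA sol) := by
  have h : CO sol.a (Ici 0) := fun t ht => (sol.ha' t ht).continuousWithinAt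
  exact h.comp_continuous (by fun_prop) (fun t => mem_Ici.2 (lmr _ _))

lemma eB_cont : Continuous (eB sol) := by
  have h : CO sol.b (Ici 0) := fun t ht => (sol.hb' t ht).continuousWithinAt
  exact h.comp_continuous (by fun_prop) (fun t => mem_Ici.2 (lmr _ _))

lemma eAB (t : ℝ) : eA sol t < eB sol t := sol.hab _ (lmr _ _)

lemma ecl_cont : Continuous fun z : RR => ecl sol z.1 z.2 := by
  have h1 := eA_cont sol
  have h2 := eB_cont sol
  unfold ecl
  fun_prop

lemma ecl_mem (t x : ℝ) : ecl sol t x ∈ Icc (eA sol t) (eB sol t) :=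
  ⟨lml _ _, max_le (eAB sol t).le (mir _ _)⟩

lemma ecl_eq {t x : ℝ} (hx : x ∈ Icc (eA sol t) (eB sol t)) : ecl sol t x = x := by
  unfold ecl
  rw [min_eq_left hx.2, max_eq_right hx.1]

lemma eR_cont : Continuous fun z : RR => eR sol z.1 z.2 := by
  have h1 := ecl_cont sol
  have : Continuous fun z : RR => (max z.1 0, ecl sol z.1 z.2) := by fun_prop
  exact sol.ρ_cont.comp_continuous this fun z => ⟨lmr _ _, ecl_mem sol z.1 z.2⟩

lemma eV_cont : Continuous fun z : RR => eV sol z.1 z.2 := by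
  have h1 := ecl_cont sol
  have : Continuous fun z : RR => (max z.1 0, ecl sol z.1 z.2) := by fun_prop
  exact sol.v_cont.comp_continuous this fun z => ⟨lmr _ _, ecl_mem sol z.1 z.2⟩

lemma eR_pos (t x : ℝ) : 0 < eR sol t x := sol.ρ_pos _ (lmr _ _) _ (ecl_mem sol t x)

lemma eA_eq {t : ℝ} (ht : 0 ≤ t) : eA sol t = sol.a t := by unfold eA; rw [max_eq_left ht]
lemma eB_eq {t : ℝ} (ht : 0 ≤ t) : eB sol t = sol.b t := by unfold eB; rw [max_eq_left ht]

lemma eR_eq {t x : ℝ} (ht : 0 ≤ t) (hx : x ∈ Icc (sol.a t) (sol.b t)) : eR sol t x = sol.ρ t x := by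
  unfold eR
  rw [ecl_eq sol (by rwa [eA_eq sol ht, eB_eq sol ht]), max_eq_left ht]

lemma eV_eq {t x : ℝ} (ht : 0 ≤ t) (hx : x ∈ Icc (sol.a t) (sol.b t)) : eV sol t x = sol.v t x := by
  unfold eV
  rw [ecl_eq sol (by rwa [eA_eq sol ht, eB_eq sol ht]), max_eq_left ht]

noncomputable def eY (t x : ℝ) : ℝ := ∫ z in eA sol t..x, eR sol t z

lemma eR_int (t x y : ℝ) : II (eR sol t) volume x y :=
  (slice_right (eR_cont sol) t).ii _ _

lemma eY_cont : Continuous fun z : RR => eY sol z.1 z.2 := by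
  have h0 : Continuous fun z : RR => ∫ y in Zr..z.2, eR sol z.1 y := by
    have := intervalIntegral.continuous_parametric_intervalIntegral_of_continuous (μ := volume)
      (f := fun (z : RR) y => eR sol z.1 y) (a₀ := 0) (s := fun z : RR => z.2)
      (by
        have : Continuous fun q : (RR) × ℝ => (q.1.1, q.2) := by fun_prop
        exact (eR_cont sol).comp this) csn
    exact this
  have h1 : Continuous fun z : RR => (z.1, eA sol z.1) := by
    have := eA_cont sol
    fun_prop
  have := h0.sub (h0.comp h1)
  refine this.congr fun z => ?_
  change (∫ y in Zr..z.2, eR sol z.1 y) - (∫ y in Zr..eA sol z.1, eR sol z.1 y) = ∫ y in eA sol z.1..z.2, eR sol z.1 y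
  rw [isl (eR_int sol _ _ _) (eR_int sol _ _ _)]

lemma eY_deriv (t x : ℝ) : HD (eY sol t) (eR sol t x) x :=
  ihr (eR_int sol _ _ _)
    (slice_right (eR_cont sol) t).stronglyMeasurable.stronglyMeasurableAtFilter
    (slice_right (eR_cont sol) t).continuousAt

lemma eR_lb (t : ℝ) : ∃ c > 0, ∀ x, c ≤ eR sol t x := by
  obtain ⟨z, hz, h⟩ := (isCompact_Icc (a := eA sol t) (b := eB sol t)).exists_isMinOn
    (nonempty_Icc.2 (eAB sol t).le) (slice_right (eR_cont sol) t).co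
  refine ⟨eR sol t z, eR_pos sol t z, fun x => ?_⟩
  have h1 : eR sol t x = eR sol t (ecl sol t x) := by
    unfold eR
    rw [ecl_eq sol (ecl_mem sol t x)]
  rw [h1]
  exact h (ecl_mem sol t x)

lemma eX_ex (t : ℝ) : ∃ g : FF, Continuous g ∧ (∀ x, g (eY sol t x) = x) ∧ (∀ y, eY sol t (g y) = y) ∧
    (∀ y, HD g (eR sol t (g y))⁻¹ y) ∧ StrictMono g := by
  obtain ⟨c, hc, h⟩ := eR_lb sol t
  exact inv_lemma hc (eY_deriv sol t) h

noncomputable def eX (t : ℝ) : FF := Classical.choose (eX_ex sol t)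

lemma eXY (t x : ℝ) : eX sol t (eY sol t x) = x := (Classical.choose_spec (eX_ex sol t)).2.1 x
lemma eYX (t y : ℝ) : eY sol t (eX sol t y) = y := (Classical.choose_spec (eX_ex sol t)).2.2.1 y
lemma eX_mono (t : ℝ) : StrictMono (eX sol t) := (Classical.choose_spec (eX_ex sol t)).2.2.2.2
lemma eX_deriv (t y : ℝ) : HD (eX sol t) (eR sol t (eX sol t y))⁻¹ y :=
  (Classical.choose_spec (eX_ex sol t)).2.2.2.1 y

lemma eX_lt {t x y : ℝ} : x < eX sol t y ↔ eY sol t x < y := by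
  conv_lhs => rw [← eXY sol t x]
  exact (eX_mono sol t).lt_iff_lt
lemma lt_eX {t x y : ℝ} : eX sol t y < x ↔ y < eY sol t x := by
  conv_lhs => rw [← eXY sol t x]
  exact (eX_mono sol t).lt_iff_lt

lemma eX_cont : Continuous fun z : RR => eX sol z.1 z.2 := by
  rw [continuous_iff_continuousAt]
  rintro ⟨t0, y0⟩
  refine tendsto_order.2 ⟨fun c hc => ?_, fun c hc => ?_⟩
  · have hc' : eY sol t0 c < y0 := (eX_lt sol).1 hc
    have h1 : Continuous fun z : RR => eY sol z.1 c := (slice_left (eY_cont sol) c).comp cfs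
    filter_upwards [(isOpen_lt h1 csn).mem_nhds (show (t0, y0) ∈ _ from hc')] with z hz
    exact (eX_lt sol).2 hz
  · have hc' : y0 < eY sol t0 c := (lt_eX sol).1 hc
    have h1 : Continuous fun z : RR => eY sol z.1 c := (slice_left (eY_cont sol) c).comp cfs
    filter_upwards [(isOpen_lt csn h1).mem_nhds (show (t0, y0) ∈ _ from hc')] with z hz
    exact (lt_eX sol).2 hz

lemma eX_zero (t : ℝ) : eX sol t 0 = eA sol t := by
  have : eY sol t (eA sol t) = 0 := by simp [eY]
  rw [← this, eXY]

variable (hmass : ∀ t, 0 ≤ t → (∫ x in sol.a t..sol.b t, sol.ρ t x) = 1)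
include hmass in
lemma eX_one (t : ℝ) : eX sol t 1 = eB sol t := by
  have : eY sol t (eB sol t) = 1 := by
    rw [← hmass (max t 0) (lmr _ _)]
    unfold eY
    apply intervalIntegral.integral_congr
    intro x hx
    change x ∈ uIcc (eA sol t) (eB sol t) at hx
    rw [uol (eAB sol t).le] at hx
    simp only [eR]
    rw [ecl_eq sol hx]
  rw [← this, eXY]

include hmass in
lemma eX_mem {t y : ℝ} (hy : y ∈ UI) : eX sol t y ∈ Icc (eA sol t) (eB sol t) := by
  rw [← eX_zero sol t, ← eX_one sol hmass t]
  exact ⟨(eX_mono sol t).monotone hy.1, (eX_mono sol t).monotone hy.2⟩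

include hmass in
lemma eX_mem' {t y : ℝ} (hy : y ∈ UO) : eX sol t y ∈ Ioo (eA sol t) (eB sol t) := by
  rw [← eX_zero sol t, ← eX_one sol hmass t]
  exact ⟨(eX_mono sol t) hy.1, (eX_mono sol t) hy.2⟩

include hmass in
lemma eY_mem {t x : ℝ} (hx : x ∈ Icc (eA sol t) (eB sol t)) : eY sol t x ∈ UI := by
  rw [← eX_zero sol t, ← eX_one sol hmass t] at hx
  constructor
  · rw [← (eX_mono sol t).le_iff_le, eXY]; exact hx.1
  · rw [← (eX_mono sol t).le_iff_le, eXY]; exact hx.2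

include hmass in
end

lemma mvt_uIcc {f f' : FF} (hf : ∀ x, HD f (f' x) x) (x0 x1 : ℝ) :
    ∃ ζ ∈ uIcc x0 x1, f x1 - f x0 = f' ζ * (x1 - x0) := by
  rcases lt_trichotomy x0 x1 with h | h | h
  · obtain ⟨c, hc, e⟩ := exists_hasDerivAt_eq_slope f f' h (fun x _ => (hf x).cw)
      (fun x _ => hf x)
    refine ⟨c, ?_, ?_⟩
    · rw [uol h.le]; exact occ hc
    · rw [e, div_mul_cancel₀]; linarith
  · subst h; exact ⟨x0, by simp, by simp⟩
  · obtain ⟨c, hc, e⟩ := exists_hasDerivAt_eq_slope f f' h (fun x _ => (hf x).cw)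
      (fun x _ => hf x)
    refine ⟨c, ?_, ?_⟩
    · rw [uIcc_of_ge h.le]; exact occ hc
    · rw [e]
      have : x0 - x1 ≠ 0 := by linarith
      field_simp
      ring

lemma mvt_lim {Y R : FFF} {x : FF} {t0 : ℝ} (hY : ∀ t x, HD (Y t) (R t x) x)
    (hR : Continuous fun z : RR => R z.1 z.2) (hx : ContinuousAt x t0) :
    ∃ ζ : FF, (∀ t, Y t (x t) - Y t (x t0) = R t (ζ t) * (x t - x t0)) ∧
      Tendsto (fun t => R t (ζ t)) (𝓝 t0) (𝓝 (R t0 (x t0))) := by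
  have h : ∀ t, ∃ ζ ∈ uIcc (x t0) (x t), Y t (x t) - Y t (x t0) = R t ζ * (x t - x t0) :=
    fun t => mvt_uIcc (hY t) _ _
  choose ζ h1 h2 using h
  refine ⟨ζ, h2, ?_⟩
  have hz : Tendsto ζ (𝓝 t0) (𝓝 (x t0)) := by
    rw [tendsto_iff_dist_tendsto_zero]
    have h3 : Tendsto (fun t => dist (x t) (x t0)) (𝓝 t0) (𝓝 0) := tendsto_iff_dist_tendsto_zero.1 hx
    refine squeeze_zero (fun _ => dist_nonneg) (fun t => ?_) h3
    rw [Real.dist_eq, Real.dist_eq]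
    have := abs_sub_left_of_mem_uIcc (h1 t)
    rwa [asc, asc (x t)] at *
  have : Tendsto (fun t => (t, ζ t)) (𝓝 t0) (𝓝 (t0, x t0)) := tendsto_id.prodMk_nhds hz
  exact (hR.continuousAt (x := (t0, x t0))).tendsto.comp this

lemma chain2 {Y R : FFF} {x : FF} {t0 Yt x' : ℝ} (hY : ∀ t x, HD (Y t) (R t x) x)
    (hR : Continuous fun z : RR => R z.1 z.2) (hx : HD x x' t0)
    (hYt : HD (fun t => Y t (x t0)) Yt t0) :
    HD (fun t => Y t (x t)) (Yt + R t0 (x t0) * x') t0 := by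
  obtain ⟨ζ, h1, h2⟩ := mvt_lim hY hR hx.continuousAt
  have h3 : HD (fun t => Y t (x t) - Y t (x t0)) (R t0 (x t0) * x') t0 := by
    rw [hasDerivAt_iff_tendsto_slope] at hx ⊢
    have := (h2.mono_left nwn).mul hx
    refine this.congr fun t => ?_
    simp only [slope_def_field, h1]
    ring
  exact (hYt.add h3).cg (fun y => by simp) rfl

lemma impl2 {Y R : FFF} {x : FF} {t0 Yt y : ℝ} (hY : ∀ t x, HD (Y t) (R t x) x)
    (hR : Continuous fun z : RR => R z.1 z.2) (hp : ∀ t x, 0 < R t x) (hx : ContinuousAt x t0)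
    (hYt : HD (fun t => Y t (x t0)) Yt t0) (hy : ∀ t, Y t (x t) = y) :
    HD x (-Yt / R t0 (x t0)) t0 := by
  obtain ⟨ζ, h1, h2⟩ := mvt_lim hY hR hx
  rw [hasDerivAt_iff_tendsto_slope] at hYt ⊢
  have := hYt.neg.div (h2.mono_left nwn) (hp t0 (x t0)).ne'
  refine this.congr fun t => ?_
  simp only [slope_def_field, Pi.neg_apply, Pi.div_apply]
  have e1 := h1 t
  rw [hy t] at e1
  have e2 := hy t0
  have := (hp t (ζ t)).ne'
  rw [← neg_div, div_div, mul_comm, ← div_div]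
  congr 1
  rw [div_eq_iff this, mul_comm, ← e1, ← e2]
  ring

section
variable {P μ : FF} {Pext : ℝ} (sol : PistonSol P μ Pext)

def LipAt (N t : ℝ) : Prop := ∀ x1 x2 : ℝ, |eR sol t x1 - eR sol t x2| ≤ N * |x1 - x2| ∧
  |eV sol t x1 - eV sol t x2| ≤ N * |x1 - x2|

variable {sol}

lemma LipAt.mono {N N' t : ℝ} (h : LipAt sol N t) (hN : N ≤ N') : LipAt sol N' t := fun x1 x2 =>
  ⟨(h x1 x2).1.trans (mlr hN (ann _)),
   (h x1 x2).2.trans (mlr hN (ann _))⟩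

lemma LipAt.nonneg {N t : ℝ} (h : LipAt sol N t) : 0 ≤ N := by
  have := (ann _).trans (h 1 0).1
  simpa using this

variable (sol)

lemma LipAt_closed (N : ℝ) : IsClosed {t | LipAt sol N t} := by
  have hR := eR_cont sol
  have hV := eV_cont sol
  simp only [LipAt, setOf_forall, setOf_and]
  refine isClosed_iInter fun x1 => isClosed_iInter fun x2 => ?_
  have a1 := slice_left hR x1
  have a2 := slice_left hR x2
  have a3 := slice_left hV x1
  have a4 := slice_left hV x2
  exact (isClosed_le (a1.sub a2).abs ccn).inter (isClosed_le (a3.sub a4).abs ccn)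

lemma ecl_lip (t x1 x2 : ℝ) : |ecl sol t x1 - ecl sol t x2| ≤ |x1 - x2| := by
  unfold ecl
  refine (abs_max_sub_max_le_max _ _ _ _).trans ?_
  simp only [sub_self, abs_zero]
  refine max_le (ann _) ((abs_min_sub_min_le_max _ _ _ _).trans ?_)
  simp

lemma LipAt_of {N t : ℝ} (ht : 0 < t) (hN : 0 ≤ N)
    (h : ∀ x1 ∈ Icc (sol.a t) (sol.b t), ∀ x2 ∈ Icc (sol.a t) (sol.b t),
      |sol.ρ t x1 - sol.ρ t x2| ≤ N * |x1 - x2| ∧ |sol.v t x1 - sol.v t x2| ≤ N * |x1 - x2|) :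
    LipAt sol N t := by
  intro x1 x2
  have m1 := ecl_mem sol t x1
  have m2 := ecl_mem sol t x2
  rw [eA_eq sol ht.le, eB_eq sol ht.le] at m1 m2
  have h3 := mll (ecl_lip sol t x1 x2) hN
  have := h _ m1 _ m2
  unfold eR eV
  rw [max_eq_left ht.le]
  exact ⟨this.1.trans h3, this.2.trans h3⟩

lemma LipAt_ex {t : ℝ} (ht : 0 < t) : ∃ N, LipAt sol N t := by
  obtain ⟨C1, h1⟩ := bIcc (sol.ρx_cont t ht.le)
  obtain ⟨C2, h2⟩ := bIcc (sol.vx_cont t ht)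
  refine ⟨max (max C1 C2) 0, LipAt_of sol ht (lmr _ _) fun x1 m1 x2 m2 => ⟨?_, ?_⟩⟩
  · have := (convex_Icc (sol.a t) (sol.b t)).norm_image_sub_le_of_norm_hasDerivWithin_le
      (f := sol.ρ t) (C := max (max C1 C2) 0)
      (fun x hx => (sol.hρx t ht.le x hx).hasDerivWithinAt)
      (fun x hx => (h1 x hx).trans ((lml _ _).trans (lml _ _))) m2 m1
    exact this
  · have := (convex_Icc (sol.a t) (sol.b t)).norm_image_sub_le_of_norm_hasDerivWithin_le
      (f := sol.v t) (C := max (max C1 C2) 0)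
      (fun x hx => (sol.hvx t ht x hx).hasDerivWithinAt)
      (fun x hx => (h2 x hx).trans ((lmr _ _).trans (lml _ _))) m2 m1
    exact this

lemma eR_evx {t x : ℝ} (ht : 0 ≤ t) (hx : x ∈ Ioo (sol.a t) (sol.b t)) :
    eR sol t =ᶠ[𝓝 x] sol.ρ t := by
  filter_upwards [omn hx.1 hx.2] with y hy
  exact eR_eq sol ht (occ hy)

lemma eV_evx {t x : ℝ} (ht : 0 ≤ t) (hx : x ∈ Ioo (sol.a t) (sol.b t)) :
    eV sol t =ᶠ[𝓝 x] sol.v t := by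
  filter_upwards [omn hx.1 hx.2] with y hy
  exact eV_eq sol ht (occ hy)

lemma dom_ev {t x : ℝ} (ht : 0 < t) (hx : x ∈ Ioo (sol.a t) (sol.b t)) :
    ∀ᶠ s in 𝓝 t, 0 < s ∧ x ∈ Ioo (sol.a s) (sol.b s) := by
  have h1 : ∀ᶠ s in 𝓝 t, eA sol s < x :=
    (eA_cont sol).continuousAt.eventually_lt continuousAt_const (by rw [eA_eq sol ht.le]; exact hx.1)
  have h2 : ∀ᶠ s in 𝓝 t, x < eB sol s :=
    continuousAt_const.eventually_lt (eB_cont sol).continuousAt (by rw [eB_eq sol ht.le]; exact hx.2)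
  filter_upwards [h1, h2, Ioi_mem_nhds ht] with s k1 k2 k3
  have k3 : 0 < s := k3
  rw [eA_eq sol k3.le] at k1
  rw [eB_eq sol k3.le] at k2
  exact ⟨k3, k1, k2⟩

lemma eR_dt {t x : ℝ} (ht : 0 < t) (hx : x ∈ Ioo (sol.a t) (sol.b t)) :
    HD (fun s => eR sol s x) (sol.ρt t x) t := by
  refine (sol.hρt t ht x (occ hx)).congr_of_eventuallyEq ?_
  filter_upwards [dom_ev sol ht hx] with s hs
  exact eR_eq sol hs.1.le (occ hs.2)

lemma eV_dt {t x : ℝ} (ht : 0 < t) (hx : x ∈ Ioo (sol.a t) (sol.b t)) :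
    HD (fun s => eV sol s x) (sol.vt t x) t := by
  refine (sol.hvt t ht x (occ hx)).congr_of_eventuallyEq ?_
  filter_upwards [dom_ev sol ht hx] with s hs
  exact eV_eq sol hs.1.le (occ hs.2)

lemma eR_dx {t x : ℝ} (ht : 0 < t) (hx : x ∈ Ioo (sol.a t) (sol.b t)) :
    HD (eR sol t) (sol.ρx t x) x :=
  (sol.hρx t ht.le x (occ hx)).congr_of_eventuallyEq (eR_evx sol ht.le hx)

lemma eV_dx {t x : ℝ} (ht : 0 < t) (hx : x ∈ Ioo (sol.a t) (sol.b t)) :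
    HD (eV sol t) (sol.vx t x) x :=
  (sol.hvx t ht x (occ hx)).congr_of_eventuallyEq (eV_evx sol ht.le hx)

lemma lip_deriv {f : FF} {f' x N : ℝ} (hf : HD f f' x) (h : ∀ x1 x2, |f x1 - f x2| ≤ N * |x1 - x2|)
    (hN : 0 ≤ N) : |f'| ≤ N := by
  have := hf.le_of_lip' hN (Eventually.of_forall fun y => h y x)
  simpa using this

lemma LipAt.rx {N t x : ℝ} (h : LipAt sol N t) (ht : 0 < t) (hx : x ∈ Icc (sol.a t) (sol.b t)) :
    |sol.ρx t x| ≤ N ∧ |sol.vx t x| ≤ N := by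
  have hI : ∀ x ∈ Ioo (sol.a t) (sol.b t), |sol.ρx t x| ≤ N ∧ |sol.vx t x| ≤ N := fun x hx =>
    ⟨lip_deriv (eR_dx sol ht hx) (fun x1 x2 => (h x1 x2).1) h.nonneg,
     lip_deriv (eV_dx sol ht hx) (fun x1 x2 => (h x1 x2).2) h.nonneg⟩
  have hcl : closure (Ioo (sol.a t) (sol.b t)) = Icc (sol.a t) (sol.b t) := closure_Ioo (sol.hab t ht.le).ne
  have hx' : x ∈ closure (Ioo (sol.a t) (sol.b t)) := by rwa [hcl]
  constructor
  · exact le_on_closure (fun x hx => (hI x hx).1) (by rw [hcl]; exact (sol.ρx_cont t ht.le).abs) continuousOn_const hx'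
  · exact le_on_closure (fun x hx => (hI x hx).2) (by rw [hcl]; exact (sol.vx_cont t ht).abs) continuousOn_const hx'

end

section
variable {P μ : FF} {Pext : ℝ} (sol : PistonSol P μ Pext)

lemma rv_dx {t x : ℝ} (ht : 0 < t) (hx : x ∈ Ioo (sol.a t) (sol.b t)) :
    HD (fun x => -(eR sol t x * eV sol t x)) (sol.ρt t x) x := by
  refine ((eR_dx sol ht hx).mul (eV_dx sol ht hx)).neg.cg (fun y => rfl) ?_
  rw [eR_eq sol ht.le (occ hx), eV_eq sol ht.le (occ hx)]
  have := sol.mass_eq t ht x (occ hx)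
  linarith

lemma ρt_cont {t : ℝ} (ht : 0 < t) : CO (sol.ρt t) (Icc (sol.a t) (sol.b t)) := by
  have h1 : CO (sol.ρ t) (Icc (sol.a t) (sol.b t)) := fun x hx =>
    (sol.hρx t ht.le x hx).cw
  have h2 : CO (sol.v t) (Icc (sol.a t) (sol.b t)) := fun x hx =>
    (sol.hvx t ht x hx).cw
  refine (((sol.ρx_cont t ht.le).mul h2).add (h1.mul (sol.vx_cont t ht))).neg.congr fun x hx => ?_
  have := sol.mass_eq t ht x hx
  simp only [Pi.neg_apply, Pi.add_apply, Pi.mul_apply]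
  linarith

lemma eRV_bd (α β c d : ℝ) : ∃ S > 0, ∀ t ∈ Icc α β, ∀ x ∈ Icc c d, |eR sol t x| ≤ S ∧ |eV sol t x| ≤ S := by
  have hK : IsCompact (Icc α β ×ˢ Icc c d) := isCompact_Icc.prod isCompact_Icc
  obtain ⟨C1, h1⟩ := hK.ebc (eR_cont sol).co
  obtain ⟨C2, h2⟩ := hK.ebc (eV_cont sol).co
  refine ⟨max (max C1 C2) 1, by positivity, fun t ht x hx => ⟨?_, ?_⟩⟩
  · exact (h1 (t, x) ⟨ht, hx⟩).trans ((lml _ _).trans (lml _ _))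
  · exact (h2 (t, x) ⟨ht, hx⟩).trans ((lmr _ _).trans (lml _ _))

lemma flux_deriv {α β N t0 x0 c : ℝ} (hα : 0 ≤ α) (hL : ∀ t ∈ Ioo α β, LipAt sol N t) (ht0 : t0 ∈ Ioo α β)
    (hx0 : x0 ∈ Ioo (sol.a t0) (sol.b t0)) (hc : c ∈ Ioo (sol.a t0) (sol.b t0)) :
    HD (fun t => ∫ x in x0..c, eR sol t x)
      (-(eR sol t0 c * eV sol t0 c) + eR sol t0 x0 * eV sol t0 x0) t0 := by
  have tpos : 0 < t0 := hα.trans_lt ht0.1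
  have ev : ∀ᶠ t in 𝓝 t0, t ∈ Ioo α β ∧ ∀ x ∈ uIcc x0 c, x ∈ Ioo (sol.a t) (sol.b t) := by
    filter_upwards [dom_ev sol tpos hx0, dom_ev sol tpos hc, omn ht0.1 ht0.2] with t h1 h2 h3
    refine ⟨h3, fun x hx => ?_⟩
    exact ordConnected_Ioo.uIcc_subset h1.2 h2.2 hx
  obtain ⟨S, hS, hb⟩ := eRV_bd sol α β (min x0 c) (max x0 c)
  have hsub0 : ∀ x ∈ uIcc x0 c, x ∈ Ioo (sol.a t0) (sol.b t0) := ev.self_of_nhds.2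
  have hcont : CO (sol.ρt t0) (uIcc x0 c) :=
    (ρt_cont sol tpos).mono fun x hx => occ (hsub0 x hx)
  have key := (intervalIntegral.hasDerivAt_integral_of_dominated_loc_of_deriv_le (μ := volume)
    (F := fun t x => eR sol t x) (F' := fun t x => sol.ρt t x) (x₀ := t0) (a := x0) (b := c)
    (bound := fun _ => N * S + S * N) ev
    (Eventually.of_forall fun t => (slice_right (eR_cont sol) t).aestronglyMeasurable)
    (eR_int sol _ _ _)
    ((hcont.mono ouc).aestronglyMeasurable measurableSet_uIoc)
    (Eventually.of_forall fun x hx t ht => by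
      have hx1 := ht.2 x (ouc hx)
      have tp : 0 < t := hα.trans_lt ht.1.1
      obtain ⟨b1, b2⟩ := hb t (occ ht.1) x (ouc hx)
      rw [eR_eq sol tp.le (occ hx1)] at b1
      rw [eV_eq sol tp.le (occ hx1)] at b2
      obtain ⟨b3, b4⟩ := (hL t ht.1).rx sol tp (occ hx1)
      have := sol.mass_eq t tp x (occ hx1)
      rw [nea, eq_neg_of_add_eq_zero_left this, abs_neg]
      refine (abs_add_le _ _).trans ?_
      rw [abs_mul, abs_mul]
      have hN := (hL t ht.1).nonneg
      gcongr)
    (by simp)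
    (Eventually.of_forall fun x hx t ht =>
      eR_dt sol (hα.trans_lt ht.1.1) (ht.2 x (ouc hx)))).2
  refine key.cg (fun y => rfl) ?_
  rw [intervalIntegral.integral_eq_sub_of_hasDerivAt (f := fun x => -(eR sol t0 x * eV sol t0 x))
    (fun x hx => rv_dx sol tpos (hsub0 x hx)) hcont.ii]
  ring

lemma eA_dt {t : ℝ} (ht : 0 < t) : HD (eA sol) (sol.a' t) t := by
  refine ((sol.ha' t ht.le).hasDerivAt (Ici_mem_nhds ht)).congr_of_eventuallyEq ?_
  filter_upwards [Ioi_mem_nhds ht] with s hs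
  exact eA_eq sol (le_of_lt hs)

lemma eB_dt {t : ℝ} (ht : 0 < t) : HD (eB sol) (sol.b' t) t := by
  refine ((sol.hb' t ht.le).hasDerivAt (Ici_mem_nhds ht)).congr_of_eventuallyEq ?_
  filter_upwards [Ioi_mem_nhds ht] with s hs
  exact eB_eq sol (le_of_lt hs)

lemma eY_dt {α β N t0 x0 : ℝ} (hα : 0 ≤ α) (hL : ∀ t ∈ Ioo α β, LipAt sol N t) (ht0 : t0 ∈ Ioo α β)
    (hx0 : x0 ∈ Ioo (sol.a t0) (sol.b t0)) :
    HD (fun t => eY sol t x0) (-(eR sol t0 x0 * eV sol t0 x0)) t0 := by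
  have tpos : 0 < t0 := hα.trans_lt ht0.1
  obtain ⟨ε, hε, hε2⟩ : ∃ ε > 0, eA sol t0 + ε < x0 := by
    rw [eA_eq sol tpos.le]
    exact ⟨(x0 - sol.a t0) / 2, by linarith [hx0.1], by linarith [hx0.1]⟩
  have hAc := eA_cont sol
  have hBc := eB_cont sol
  set s : Set ℝ := {t | t ∈ Ioo α β ∧ eA sol t + ε < x0 ∧ x0 < eB sol t} with hs
  have hso : IsOpen s := isOpen_Ioo.inter ((isOpen_lt (hAc.add ccn) ccn).inter
    (isOpen_lt ccn hBc))
  have ht0s : t0 ∈ s := ⟨ht0, hε2, by rw [eB_eq sol tpos.le]; exact hx0.2⟩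
  have spos : ∀ t ∈ s, 0 < t := fun t ht => hα.trans_lt ht.1.1
  obtain ⟨C1, hC1⟩ := (isCompact_Icc (a := α) (b := β)).ebc hAc.co
  obtain ⟨S, hS, hb⟩ := eRV_bd sol α β (-C1) (C1 + ε)
  have hmem : ∀ t ∈ s, ∀ δ ∈ Ioo 0 ε, eA sol t + δ ∈ Ioo (sol.a t) (sol.b t) := by
    intro t ht δ hδ
    have := spos t ht
    have h2 := ht.2
    rw [eA_eq sol this.le, eB_eq sol this.le] at h2
    rw [eA_eq sol this.le]
    exact ⟨by linarith [hδ.1], by linarith [hδ.2]⟩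
  have hδε : ∀ᶠ δ in 𝓝[>] Zr, δ ∈ Ioo 0 ε := Ioo_mem_nhdsGT hε
  have hN : 0 ≤ N := (hL t0 ht0).nonneg
  refine hasDerivAt_of_tendstoLocallyUniformlyOn (l := 𝓝[>] Zr) hso
    (f := fun δ t => ∫ x in (eA sol t + δ)..x0, eR sol t x)
    (f' := fun δ t => -(eR sol t x0 * eV sol t x0) +
      eR sol t (eA sol t + δ) * (eV sol t (eA sol t + δ) - eV sol t (eA sol t)))
    (g' := fun t => -(eR sol t x0 * eV sol t x0)) ?_ ?_ ?_ ht0s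
  · apply TendstoUniformlyOn.tendstoLocallyUniformlyOn
    rw [Metric.tendstoUniformlyOn_iff]
    intro e he
    have h1 : ∀ᶠ δ in 𝓝[>] Zr, S * (N * δ) < e := by
      have : Tendsto (fun δ : ℝ => S * (N * δ)) (𝓝 0) (𝓝 (S * (N * 0))) := by
        apply Continuous.tendsto; fun_prop
      rw [mul_zero, mul_zero] at this
      exact nwn (this.eventually (gt_mem_nhds he))
    filter_upwards [h1, hδε] with δ h1 h2 t ht
    rw [Real.dist_eq]
    have e1 : ∀ a b : ℝ, a - (a + b) = -b := fun a b => by ring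
    rw [e1, abs_neg, abs_mul]
    refine lt_of_le_of_lt ?_ h1
    have l1 := (hL t ht.1 (eA sol t + δ) (eA sol t)).2
    have hA := abs_le.1 (hC1 t (occ ht.1))
    have l2 := (hb t (occ ht.1) (eA sol t + δ)
      ⟨by linarith [h2.1], by linarith [h2.2]⟩).1
    rw [add_sub_cancel_left, abs_of_pos h2.1] at l1
    gcongr
  · filter_upwards [hδε] with δ hδ t ht
    have tp := spos t ht
    have hm := hmem t ht δ hδ
    have hx : x0 ∈ Ioo (sol.a t) (sol.b t) := by
      have h2 := ht.2
      rw [eA_eq sol tp.le, eB_eq sol tp.le] at h2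
      exact ⟨by linarith, h2.2⟩
    have hd : HD (fun t => eA sol t + δ) (sol.a' t) t := (eA_dt sol tp).add_const δ
    have hYx : ∀ t x, HD (fun x => -∫ z in x..x0, eR sol t z) (eR sol t x) x := by
      intro t x
      have := (ihr (eR_int sol t x0 x)
        (slice_right (eR_cont sol) t).stronglyMeasurable.stronglyMeasurableAtFilter
        (slice_right (eR_cont sol) t).continuousAt)
      refine this.cg (fun y => ?_) rfl
      rw [intervalIntegral.integral_symm]
      simp
    have := chain2 (Y := fun t x => -∫ z in x..x0, eR sol t z) hYx (eR_cont sol) hd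
      (flux_deriv sol hα hL ht.1 hm hx).neg
    refine this.neg.cg (fun y => by simp) ?_
    have ha : eV sol t (eA sol t) = sol.a' t := by
      rw [eA_eq sol tp.le, eV_eq sol tp.le (left_mem_Icc.2 (sol.hab t tp.le).le), sol.bc_a t tp.le]
    rw [ha]
    ring
  · intro t ht
    have h1 : Continuous fun δ : ℝ => ∫ x in (eA sol t + δ)..x0, eR sol t x := by
      have h2 : Continuous fun δ : ℝ => ∫ x in x0..(eA sol t + δ), eR sol t x :=
        (intervalIntegral.continuous_primitive (fun a b => eR_int sol t a b) x0).comp (by fun_prop)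
      refine h2.neg.congr fun δ => ?_
      rw [intervalIntegral.integral_symm]
      simp
    have := h1.tendsto 0
    simp only [add_zero] at this
    exact this.mono_left nwn

variable (hmass : ∀ t, 0 ≤ t → (∫ x in sol.a t..sol.b t, sol.ρ t x) = 1)
include hmass in
lemma eX_dt {α β N t0 y : ℝ} (hα : 0 ≤ α) (hL : ∀ t ∈ Ioo α β, LipAt sol N t) (ht0 : t0 ∈ Ioo α β)
    (hy : y ∈ UI) : HD (fun t => eX sol t y) (eV sol t0 (eX sol t0 y)) t0 := by
  have tpos : 0 < t0 := hα.trans_lt ht0.1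
  rcases eq_or_ne y 0 with rfl | h0
  · simp only [eX_zero]
    refine (eA_dt sol tpos).cg (fun _ => rfl) ?_
    rw [eA_eq sol tpos.le, eV_eq sol tpos.le (left_mem_Icc.2 (sol.hab t0 tpos.le).le), sol.bc_a t0 tpos.le]
  rcases eq_or_ne y 1 with rfl | h1
  · simp only [eX_one sol hmass]
    refine (eB_dt sol tpos).cg (fun _ => rfl) ?_
    rw [eB_eq sol tpos.le, eV_eq sol tpos.le (right_mem_Icc.2 (sol.hab t0 tpos.le).le), sol.bc_b t0 tpos.le]
  have hy' : y ∈ UO := ⟨lt_of_le_of_ne hy.1 h0.symm, lt_of_le_of_ne hy.2 h1⟩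
  have hm := eX_mem' sol hmass (t := t0) hy'
  rw [eA_eq sol tpos.le, eB_eq sol tpos.le] at hm
  have := impl2 (Y := eY sol) (R := eR sol) (x := fun t => eX sol t y) (y := y) (t0 := t0) (eY_deriv sol) (eR_cont sol)
    (eR_pos sol) (slice_left (eX_cont sol) y).continuousAt (eY_dt sol hα hL ht0 hm) (fun t => eYX sol t y)
  refine this.cg (fun _ => rfl) ?_
  have := (eR_pos sol t0 (eX sol t0 y)).ne'
  field_simp
end

structure C1I (f f' : FF) : Prop where
  c : CO f (Icc 0 1)
  d : ∀ y ∈ UO, HD f (f' y) y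
  c' : CO f' (Icc 0 1)

lemma C1I.mul {f f' g g' : FF} (hf : C1I f f') (hg : C1I g g') :
    C1I (fun y => f y * g y) (fun y => f' y * g y + f y * g' y) :=
  ⟨hf.c.mul hg.c, fun y hy => (hf.d y hy).mul (hg.d y hy), (hf.c'.mul hg.c).add (hf.c.mul hg.c')⟩

lemma C1I.sub {f f' g g' : FF} (hf : C1I f f') (hg : C1I g g') :
    C1I (fun y => f y - g y) (fun y => f' y - g' y) :=
  ⟨hf.c.sub hg.c, fun y hy => (hf.d y hy).sub (hg.d y hy), hf.c'.sub hg.c'⟩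

lemma C1I.smul {f f' : FF} (c : ℝ) (hf : C1I f f') :
    C1I (fun y => c * f y) (fun y => c * f' y) :=
  ⟨continuousOn_const.mul hf.c, fun y hy => (hf.d y hy).const_mul c, continuousOn_const.mul hf.c'⟩

lemma C1I.of_deriv {f f' : FF} (h : ∀ y, HD f (f' y) y) (hc : CO f' (Icc 0 1)) : C1I f f' :=
  ⟨fun y _ => (h y).cw, fun y _ => h y, hc⟩

lemma C1I.comp {f f' g g' : FF} (hf : C1I f f') (hp : ∀ y ∈ UI, 0 < f y)
    (hg : ∀ x, 0 < x → HD g (g' x) x) (hg' : CO g' (Ioi 0)) :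
    C1I (fun y => g (f y)) (fun y => g' (f y) * f' y) := by
  have hgc : CO g (Ioi 0) := fun x hx => (hg x hx).cw
  refine ⟨hgc.comp hf.c hp, fun y hy => ?_, (hg'.comp hf.c hp).mul hf.c'⟩
  exact (hg _ (hp y (occ hy))).comp y (hf.d y hy)

lemma C1I.ftc {f f' : FF} (hf : C1I f f') {y1 y2 : ℝ} (h1 : y1 ∈ UI) (h2 : y2 ∈ UI) :
    II f' volume y1 y2 ∧ ∫ z in y1..y2, f' z = f y2 - f y1 := by
  have hs : uIcc y1 y2 ⊆ Icc 0 1 := oIs h1 h2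
  have hi : II f' volume y1 y2 := (hf.c'.mono hs).ii
  refine ⟨hi, ?_⟩
  apply intervalIntegral.integral_eq_sub_of_hasDeriv_right (hf.c.mono hs) _ hi
  intro x hx
  refine (hf.d x ?_).hasDerivWithinAt
  exact ⟨lt_of_le_of_lt (le_min h1.1 h2.1) hx.1, lt_of_lt_of_le hx.2 (max_le h1.2 h2.2)⟩

lemma C1I.ibp {w w' F f : FF} (hw : C1I w w') (hF : C1I F f) {y : ℝ} (hy : y ∈ UI) :
    ∫ z in Zr..y, w z * f z = w y * F y - w 0 * F 0 - ∫ z in Zr..y, w' z * F z := by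
  have hs : uIcc 0 y ⊆ Icc 0 1 := oIs (by simp) hy
  apply intervalIntegral.integral_mul_deriv_eq_deriv_mul_of_hasDerivAt (hw.c.mono hs) (hF.c.mono hs)
  · intro x hx
    rw [min_eq_left hy.1, max_eq_right hy.1] at hx
    exact hw.d x ⟨hx.1, hx.2.trans_le hy.2⟩
  · intro x hx
    rw [min_eq_left hy.1, max_eq_right hy.1] at hx
    exact hF.d x ⟨hx.1, hx.2.trans_le hy.2⟩
  · exact (hw.c'.mono hs).ii
  · exact (hF.c'.mono hs).ii

lemma int_abs_le {f : FF} {C y1 y2 : ℝ} (h1 : y1 ∈ UI) (h2 : y2 ∈ UI)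
    (h : ∀ z ∈ UI, |f z| ≤ C) : |∫ z in y1..y2, f z| ≤ C * |y2 - y1| := by
  have := intervalIntegral.norm_integral_le_of_norm_le_const (f := f) (C := C) (a := y1) (b := y2)
    (fun x hx => h x (oIs h1 h2 (ouc hx)))
  exact this

lemma int_abs_le1 {f : FF} {C y : ℝ} (h2 : y ∈ UI) (hC : 0 ≤ C)
    (h : ∀ z ∈ UI, |f z| ≤ C) : |∫ z in Zr..y, f z| ≤ C := by
  refine (int_abs_le (y1 := 0) (by simp) h2 h).trans ?_
  rw [sub_zero, abs_of_nonneg h2.1]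
  exact mul_le_of_le_one_right hC h2.2

lemma weak_bd {w w' F f : FF} (hw : C1I w w') (hF : C1I F f) {y M e : ℝ} (hy : y ∈ UI)
    (hM : 0 ≤ M) (he : 0 ≤ e)
    (h1 : ∀ z ∈ UI, |w z| ≤ M) (h2 : ∀ z ∈ UI, |w' z| ≤ M) (h3 : ∀ z ∈ UI, |F z| ≤ e) :
    |∫ z in Zr..y, w z * f z| ≤ 3 * M * e := by
  rw [hw.ibp hF hy]
  have m : ∀ a b : ℝ, |a| ≤ M → |b| ≤ e → |a * b| ≤ M * e := fun a b ha hb => by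
    rw [abs_mul]; exact mul_le_mul ha hb (ann _) hM
  have a1 := m _ _ (h1 y hy) (h3 y hy)
  have a2 := m _ _ (h1 0 (by simp)) (h3 0 (by simp))
  have a3 := int_abs_le1 (f := fun z => w' z * F z) hy (by positivity : 0 ≤ M * e)
    (fun z hz => m _ _ (h2 z hz) (h3 z hz))
  refine (abs_sub _ _).trans ?_
  have := abs_sub (w y * F y) (w 0 * F 0)
  linarith

lemma hasDerivAt_eps {f : FF} {D t : ℝ}
    (h : ∀ e > 0, ∀ᶠ s in 𝓝 t, |f s - f t - (s - t) * D| ≤ e * |s - t|) : HD f D t := by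
  rw [hasDerivAt_iff_isLittleO, Asymptotics.isLittleO_iff]
  intro e he
  filter_upwards [h e he] with s hs
  simpa using hs

lemma unif_ev {V : FFF} (hV : Continuous fun z : RR => V z.1 z.2) (t0 c d : ℝ) {e : ℝ} (he : 0 < e) :
    ∀ᶠ t in 𝓝 t0, ∀ y ∈ Icc c d, |V t y - V t0 y| ≤ e := by
  apply isCompact_Icc.eventually_forall_of_forall_eventually
  intro y _
  have h0 : Continuous fun z : RR => |V z.1 z.2 - V t0 z.2| :=
    (hV.sub ((slice_right hV t0).comp csn)).abs
  have := h0.continuousAt.eventually_lt (x₀ := (t0, y)) (g := fun _ => e) continuousAt_const (by simpa using he)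
  filter_upwards [this] with z hz using hz.le

structure LD (α β L : ℝ) (X V τ Vy τy : FFF) : Prop where
  hαβ : α < β
  hL : 0 ≤ L
  Xc : Continuous fun z : RR => X z.1 z.2
  Vc : Continuous fun z : RR => V z.1 z.2
  τc : Continuous fun z : RR => τ z.1 z.2
  τpos : ∀ t y, 0 < τ t y
  Xy : ∀ t y, HD (X t) (τ t y) y
  Xt : ∀ t ∈ Icc α β, ∀ y ∈ UI, HD (fun s => X s y) (V t y) t
  VC : ∀ t ∈ Icc α β, C1I (V t) (Vy t)
  Vyb : ∀ t ∈ Icc α β, ∀ y ∈ UI, |Vy t y| ≤ L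
  τC : ∀ t ∈ Icc α β, C1I (τ t) (τy t)
  τyb : ∀ t ∈ Icc α β, ∀ y ∈ UI, |τy t y| ≤ L

section
variable {α β L : ℝ} {X V τ Vy τy : FFF}

lemma C1I.lip {f f' : FF} (hf : C1I f f') {L : ℝ} (hb : ∀ y ∈ UI, |f' y| ≤ L) :
    ∀ y1 ∈ UI, ∀ y2 ∈ UI, |f y2 - f y1| ≤ L * |y2 - y1| := by
  intro y1 h1 y2 h2
  rw [← (hf.ftc h1 h2).2]
  exact int_abs_le h1 h2 hb

lemma LD.τLip (D : LD α β L X V τ Vy τy) {s t y : ℝ} (hs : s ∈ Icc α β) (ht : t ∈ Icc α β) (hy : y ∈ UI) :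
    |τ t y - τ s y| ≤ L * |t - s| := by
  have key : ∀ y1 ∈ UI, ∀ y2 ∈ UI,
      |(X t y2 - X s y2) - (X t y1 - X s y1)| ≤ L * |t - s| * |y2 - y1| := by
    intro y1 h1 y2 h2
    have := (convex_Icc α β).norm_image_sub_le_of_norm_hasDerivWithin_le
      (f := fun r => X r y2 - X r y1) (f' := fun r => V r y2 - V r y1) (C := L * |y2 - y1|)
      (fun r hr => ((D.Xt r hr y2 h2).sub (D.Xt r hr y1 h1)).hasDerivWithinAt)
      (fun r hr => (D.VC r hr).lip (D.Vyb r hr) y1 h1 y2 h2) hs ht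
    rw [nea, nea] at this
    have e : (X t y2 - X s y2) - (X t y1 - X s y1) = X t y2 - X t y1 - (X s y2 - X s y1) := by ring
    rw [e]
    linarith
  have hI : ∀ y ∈ UO, |τ t y - τ s y| ≤ L * |t - s| := by
    intro y hy
    have hd : HD (fun y => X t y - X s y) (τ t y - τ s y) y := (D.Xy t y).sub (D.Xy s y)
    have := hd.le_of_lip' (C := L * |t - s|) (mul_nonneg D.hL (ann _)) (by
      filter_upwards [omn hy.1 hy.2] with y2 h2
      exact key y (occ hy) y2 (occ h2))
    simpa using this
  have hcl : closure (UO) = Icc 0 1 := closure_Ioo zero_ne_one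
  exact le_on_closure hI (((slice_right D.τc t).sub (slice_right D.τc s)).abs.co) continuousOn_const
    (by rwa [hcl])

lemma LD.ran (D : LD α β L X V τ Vy τy) : ∃ c d, 0 < c ∧ c ≤ d ∧ ∀ t ∈ Icc α β, ∀ y ∈ UI, τ t y ∈ Icc c d := by
  obtain ⟨z1, m1, h1⟩ := (bx_compact α β).exists_isMinOn (bx_nonempty D.hαβ) D.τc.co
  obtain ⟨z2, m2, h2⟩ := (bx_compact α β).exists_isMaxOn (bx_nonempty D.hαβ) D.τc.co
  refine ⟨_, _, D.τpos z1.1 z1.2, h1 m2, fun t ht y hy => ⟨h1 (mem_bx ht hy), h2 (mem_bx ht hy)⟩⟩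

/-- constants for ID -/
lemma LD.consts (D : LD α β L X V τ Vy τy) {G G' G'' ψ ψ' : FF}
    (hG : ∀ x, 0 < x → HD G (G' x) x) (hG' : ∀ x, 0 < x → HD G' (G'' x) x)
    (hG'' : CO G'' (Ioi 0)) (hψ : ∀ y, HD ψ (ψ' y) y) (hψ' : Continuous ψ') :
    ∃ C > 0, (∀ s ∈ Icc α β, ∀ t ∈ Icc α β, ∀ y ∈ UI,
        |G (τ s y) - G (τ t y) - G' (τ t y) * (τ s y - τ t y)| ≤ C * |s - t| ^ 2 ∧
        |G' (τ s y) - G' (τ t y)| ≤ C * |s - t|) ∧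
      (∀ t ∈ Icc α β, C1I (fun y => ψ y * G' (τ t y)) (fun y => ψ' y * G' (τ t y) + ψ y * (G'' (τ t y) * τy t y)) ∧
        ∀ y ∈ UI, |ψ y| ≤ C ∧ |ψ y * G' (τ t y)| ≤ C ∧
          |ψ' y * G' (τ t y) + ψ y * (G'' (τ t y) * τy t y)| ≤ C) := by
  obtain ⟨c, d, hc, hcd, hr⟩ := D.ran
  have hsub : Icc c d ⊆ Ioi 0 := fun x hx => hc.trans_le hx.1
  have hG'c : CO G' (Ioi 0) := fun x hx => (hG' x hx).cw
  obtain ⟨C1, h1⟩ := bIcc (hG'c.mono hsub)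
  obtain ⟨C2, h2⟩ := bIcc (hG''.mono hsub)
  have hψc : Continuous ψ := cif fun y => (hψ y).continuousAt
  obtain ⟨C3, h3⟩ := (isCompact_Icc (a := Zr) (b := 1)).ebc hψc.co
  obtain ⟨C4, h4⟩ := (isCompact_Icc (a := Zr) (b := 1)).ebc hψ'.co
  have p1 : 0 ≤ C1 := (norm_nonneg _).trans (h1 c ⟨le_rfl, hcd⟩)
  have p2 : 0 ≤ C2 := (norm_nonneg _).trans (h2 c ⟨le_rfl, hcd⟩)
  have p3 : 0 ≤ C3 := (norm_nonneg _).trans (h3 0 (by simp))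
  have p4 : 0 ≤ C4 := (norm_nonneg _).trans (h4 0 (by simp))
  have hL := D.hL
  have lipG' : ∀ x ∈ Icc c d, ∀ y ∈ Icc c d, |G' y - G' x| ≤ C2 * |y - x| := fun x hx y hy =>
    (convex_Icc c d).norm_image_sub_le_of_norm_hasDerivWithin_le
      (fun z hz => (hG' z (hsub hz)).hasDerivWithinAt) h2 hx hy
  have tay : ∀ x ∈ Icc c d, ∀ y ∈ Icc c d, |G y - G x - G' x * (y - x)| ≤ C2 * |y - x| ^ 2 := by
    intro x hx y hy
    have hs : uIcc x y ⊆ Icc c d := oIs hx hy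
    have := (convex_uIcc x y).norm_image_sub_le_of_norm_hasDerivWithin_le
      (f := fun z => G z - G' x * z) (f' := fun z => G' z - G' x) (C := C2 * |y - x|)
      (fun z hz => (((hG z (hsub (hs hz))).sub ((hasDerivAt_id z).const_mul (G' x))).cg
        (fun _ => rfl) (by simp)).hasDerivWithinAt)
      (fun z hz => (lipG' x hx z (hs hz)).trans (by
        have h5 := abs_sub_left_of_mem_uIcc hz
        gcongr)) left_mem_uIcc right_mem_uIcc
    rw [nea, nea] at this
    have e : G y - G x - G' x * (y - x) = G y - G' x * y - (G x - G' x * x) := by ring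
    rw [e]
    refine this.trans (le_of_eq (by ring))
  refine ⟨C2 * L ^ 2 + C2 * L + C3 + C3 * C1 + (C4 * C1 + C3 * (C2 * L)) + 1, by positivity, ?_, ?_⟩
  · intro s hs t ht y hy
    have l := D.τLip ht hs hy
    have q1 := hr s hs y hy
    have q2 := hr t ht y hy
    constructor
    · refine (tay _ q2 _ q1).trans ?_
      have l2 : |τ s y - τ t y| ^ 2 ≤ (L * |s - t|) ^ 2 := by gcongr
      have l3 : C2 * |τ s y - τ t y| ^ 2 ≤ C2 * (L * |s - t|) ^ 2 := by gcongr
      have l4 : C2 * (L * |s - t|) ^ 2 = (C2 * L ^ 2) * |s - t| ^ 2 := by ring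
      rw [l4] at l3
      refine l3.trans (mlr ?_ (by positivity))
      have : 0 ≤ C2 * L + C3 + C3 * C1 + (C4 * C1 + C3 * (C2 * L)) := by positivity
      linarith
    · refine (lipG' _ q2 _ q1).trans ?_
      have l3 : C2 * |τ s y - τ t y| ≤ C2 * (L * |s - t|) := by gcongr
      rw [← mul_assoc] at l3
      refine l3.trans (mlr ?_ (by positivity))
      have : 0 ≤ C2 * L ^ 2 + C3 + C3 * C1 + (C4 * C1 + C3 * (C2 * L)) := by positivity
      linarith
  · intro t ht
    refine ⟨(C1I.of_deriv hψ hψ'.co).mul ((D.τC t ht).comp (fun y _ => D.τpos t y) hG' hG''), ?_⟩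
    intro y hy
    have b1 := h1 _ (hr t ht y hy)
    have b2 := h2 _ (hr t ht y hy)
    have b3 := h3 y hy
    have b4 := h4 y hy
    have b5 := D.τyb t ht y hy
    rw [nea] at b1 b2 b3 b4
    have n1 : 0 ≤ C2 * L ^ 2 := by positivity
    have n2 : 0 ≤ C2 * L := by positivity
    have n3 : 0 ≤ C3 * C1 := by positivity
    have n4 : 0 ≤ C4 * C1 := by positivity
    have n5 : 0 ≤ C3 * (C2 * L) := by positivity
    refine ⟨by linarith, ?_, ?_⟩
    · have : |ψ y * G' (τ t y)| ≤ C3 * C1 := by rw [abs_mul]; gcongr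
      linarith
    · have : |ψ' y * G' (τ t y) + ψ y * (G'' (τ t y) * τy t y)| ≤ C4 * C1 + C3 * (C2 * L) := by
        refine (abs_add_le _ _).trans ?_
        rw [abs_mul, abs_mul, abs_mul]
        gcongr
      linarith
end

section
variable {α β L : ℝ} {X V τ Vy τy : FFF}

lemma LD.Xdisp (D : LD α β L X V τ Vy τy) {t : ℝ} (ht : t ∈ Ioo α β) {e : ℝ} (he : 0 < e) :
    ∀ᶠ s in 𝓝 t, ∀ z ∈ UI, |X s z - X t z - (s - t) * V t z| ≤ e * |s - t| := by
  obtain ⟨δ, hδ, h⟩ := Metric.eventually_nhds_iff_ball.1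
    ((unif_ev D.Vc t 0 1 he).and (omn ht.1 ht.2))
  filter_upwards [Metric.ball_mem_nhds t hδ] with s hs z hz
  have hs' : uIcc t s ⊆ Metric.ball t δ := by
    rw [Real.ball_eq_Ioo] at hs ⊢
    exact ordConnected_Ioo.uIcc_subset ⟨by linarith, by linarith⟩ hs
  have := (convex_uIcc t s).norm_image_sub_le_of_norm_hasDerivWithin_le
    (f := fun r => X r z - V t z * r) (f' := fun r => V r z - V t z) (C := e)
    (fun r hr => (((D.Xt r (occ (h r (hs' hr)).2) z hz).sub
      ((hasDerivAt_id r).const_mul (V t z))).cg (fun _ => rfl) (by simp)).hasDerivWithinAt)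
    (fun r hr => (h r (hs' hr)).1 z hz) left_mem_uIcc right_mem_uIcc
  rw [nea, nea] at this
  have e : X s z - X t z - (s - t) * V t z = X s z - V t z * s - (X t z - V t z * t) := by ring
  rwa [e]

variable {G G' G'' ψ ψ' : FF}

lemma LD.int_G (D : LD α β L X V τ Vy τy) (hG : CO G (Ioi 0)) (hψ : Continuous ψ) (t y : ℝ) :
    II (fun z => ψ z * G (τ t z)) volume 0 y := by
  refine Continuous.ii (hψ.mul ?_) _ _
  exact hG.comp_continuous (slice_right D.τc t) (fun z => D.τpos t z)

lemma LD.int_V (D : LD α β L X V τ Vy τy) (hG : CO G (Ioi 0)) (hψ : Continuous ψ) {s t y : ℝ}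
    (ht : t ∈ Icc α β) (hy : y ∈ UI) :
    II (fun z => ψ z * (G (τ s z) * Vy t z)) volume 0 y := by
  have hs : uIcc 0 y ⊆ Icc 0 1 := oIs (by simp) hy
  refine ContinuousOn.ii (hψ.co.mul (ContinuousOn.mul ?_ ((D.VC t ht).c'.mono hs)))
  exact (hG.comp_continuous (slice_right D.τc s) (fun z => D.τpos s z)).co

lemma LD.ID (D : LD α β L X V τ Vy τy)
    (hG : ∀ x, 0 < x → HD G (G' x) x) (hG' : ∀ x, 0 < x → HD G' (G'' x) x)
    (hG'' : CO G'' (Ioi 0)) (hψ : ∀ y, HD ψ (ψ' y) y) (hψ' : Continuous ψ')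
    {t y : ℝ} (ht : t ∈ Ioo α β) (hy : y ∈ UI) :
    HD (fun s => ∫ z in Zr..y, ψ z * G (τ s z))
      (∫ z in Zr..y, ψ z * (G' (τ t z) * Vy t z)) t := by
  obtain ⟨C, hC, h1, h2⟩ := D.consts hG hG' hG'' hψ hψ'
  have hGc : CO G (Ioi 0) := fun x hx => (hG x hx).cw
  have hG'c : CO G' (Ioi 0) := fun x hx => (hG' x hx).cw
  have hψc : Continuous ψ := cif fun y => (hψ y).continuousAt
  apply hasDerivAt_eps
  intro e he
  have htI := occ ht
  filter_upwards [D.Xdisp ht (by positivity : 0 < e / (6 * C)), omn ht.1 ht.2,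
    Metric.ball_mem_nhds t (by positivity : 0 < e / (2 * C ^ 2))] with s hs1 hs2 hs3
  have hs3' : |s - t| ≤ e / (2 * C ^ 2) := by
    rw [Metric.mem_ball, Real.dist_eq] at hs3; exact hs3.le
  have hsI := occ hs2
  have hwC := (h2 t htI).1
  have hsub : uIcc 0 y ⊆ Icc 0 1 := oIs (by simp) hy
  have i1 := D.int_G hGc hψc s y
  have i2 := D.int_G hGc hψc t y
  have i3 := D.int_V (s := t) hG'c hψc htI hy
  have i4 : II (fun z => ψ z * G' (τ t z) * τ s z) volume 0 y :=
    ((hwC.c.mono hsub).mul (slice_right D.τc s).co).ii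
  have i5 : II (fun z => ψ z * G' (τ t z) * τ t z) volume 0 y :=
    ((hwC.c.mono hsub).mul (slice_right D.τc t).co).ii
  have hFC : C1I (fun z => X s z - X t z - (s - t) * V t z) (fun z => τ s z - τ t z - (s - t) * Vy t z) :=
    ((C1I.of_deriv (D.Xy s) (slice_right D.τc s).co).sub
      (C1I.of_deriv (D.Xy t) (slice_right D.τc t).co)).sub ((D.VC t htI).smul (s - t))
  have b1 := weak_bd hwC hFC hy hC.le (by positivity : 0 ≤ e / (6 * C) * |s - t|)
    (fun z hz => ((h2 t htI).2 z hz).2.1) (fun z hz => ((h2 t htI).2 z hz).2.2) hs1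
  have b2 := int_abs_le1 (f := fun z => ψ z * (G (τ s z) - G (τ t z) - G' (τ t z) * (τ s z - τ t z)))
    (C := C * (C * |s - t| ^ 2)) hy (by positivity) (fun z hz => by
      rw [abs_mul]
      exact mul_le_mul ((h2 t htI).2 z hz).1 (h1 s hsI t htI z hz).1 (ann _) hC.le)
  have e1 : (∫ z in Zr..y, ψ z * G (τ s z)) - (∫ z in Zr..y, ψ z * G (τ t z))
      - (s - t) * (∫ z in Zr..y, ψ z * (G' (τ t z) * Vy t z)) =
      (∫ z in Zr..y, ψ z * (G (τ s z) - G (τ t z) - G' (τ t z) * (τ s z - τ t z)))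
      + ∫ z in Zr..y, ψ z * G' (τ t z) * (τ s z - τ t z - (s - t) * Vy t z) := by
    have r1 : ∀ z, ψ z * (G (τ s z) - G (τ t z) - G' (τ t z) * (τ s z - τ t z))
      = (ψ z * G (τ s z) - ψ z * G (τ t z)) - (ψ z * G' (τ t z) * τ s z - ψ z * G' (τ t z) * τ t z) :=
      fun z => by ring
    have r2 : ∀ z, ψ z * G' (τ t z) * (τ s z - τ t z - (s - t) * Vy t z)
      = (ψ z * G' (τ t z) * τ s z - ψ z * G' (τ t z) * τ t z) - (s - t) * (ψ z * (G' (τ t z) * Vy t z)) :=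
      fun z => by ring
    simp only [r1, r2]
    rw [isb (i1.sub i2) (i4.sub i5), isb i1 i2,
      isb (i4.sub i5) (i3.const_mul _), icm]
    ring
  rw [e1]
  refine (abs_add_le _ _).trans ?_
  have k1 : 3 * C * (e / (6 * C) * |s - t|) = e / 2 * |s - t| := by field_simp; ring
  have k2 : C * (C * |s - t| ^ 2) ≤ e / 2 * |s - t| := by
    have : C * (C * |s - t| ^ 2) = C ^ 2 * |s - t| * |s - t| := by ring
    rw [this]
    have k3 : C ^ 2 * |s - t| ≤ C ^ 2 * (e / (2 * C ^ 2)) := by gcongr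
    have k4 : C ^ 2 * (e / (2 * C ^ 2)) = e / 2 := by field_simp
    rw [k4] at k3
    gcongr
  linarith

/-- joint continuity of the derivative -/
lemma LD.IDc (D : LD α β L X V τ Vy τy)
    (hG : ∀ x, 0 < x → HD G (G' x) x) (hG' : ∀ x, 0 < x → HD G' (G'' x) x)
    (hG'' : CO G'' (Ioi 0)) (hψ : ∀ y, HD ψ (ψ' y) y) (hψ' : Continuous ψ') :
    CO (fun p : RR => ∫ z in Zr..p.2, ψ z * (G' (τ p.1 z) * Vy p.1 z)) (bx α β) := by
  obtain ⟨C, hC, h1, h2⟩ := D.consts hG hG' hG'' hψ hψ'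
  have hG'c : CO G' (Ioi 0) := fun x hx => (hG' x hx).cw
  have hψc : Continuous ψ := cif fun y => (hψ y).continuousAt
  have hL := D.hL
  rintro ⟨t0, y0⟩ hp0
  obtain ⟨ht0, hy0⟩ := mem_prod.1 hp0
  simp only at ht0 hy0
  rw [ContinuousWithinAt, Metric.tendsto_nhds]
  intro e he
  have hcont : Tendsto (fun p : RR => C * L * |p.2 - y0| + C * (C * |p.1 - t0| * L)) (𝓝 (t0, y0)) (𝓝 0) := by
    have : Continuous fun p : RR => C * L * |p.2 - y0| + C * (C * |p.1 - t0| * L) := by fun_prop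
    simpa using this.tendsto (t0, y0)
  have hu := unif_ev D.Vc t0 0 1 (by positivity : 0 < e / (6 * C))
  have hu' : ∀ᶠ p : RR in 𝓝 (t0, y0), ∀ y ∈ UI, |V p.1 y - V t0 y| ≤ e / (6 * C) :=
    (continuous_fst.tendsto (t0, y0)).eventually hu
  filter_upwards [smn, mem_nhdsWithin_of_mem_nhds (hcont.eventually (gt_mem_nhds (half_pos he))),
    mem_nhdsWithin_of_mem_nhds hu'] with p hp hp1 hp2
  obtain ⟨ht, hy⟩ := mem_prod.1 hp
  obtain ⟨t, y⟩ := p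
  simp only at ht hy hp1 hp2 ⊢
  have i0 := D.int_V (s := t0) hG'c hψc ht0 hy0
  have i1 := D.int_V (s := t) hG'c hψc ht hy
  have i1' := D.int_V (s := t) hG'c hψc ht hy0
  have i2 := D.int_V (s := t0) hG'c hψc ht hy0
  have b1 := weak_bd (h2 t0 ht0).1 ((D.VC t ht).sub (D.VC t0 ht0)) hy0 hC.le (by positivity : 0 ≤ e / (6 * C))
    (fun z hz => ((h2 t0 ht0).2 z hz).2.1) (fun z hz => ((h2 t0 ht0).2 z hz).2.2) hp2
  have b2 := int_abs_le1 (f := fun z => ψ z * ((G' (τ t z) - G' (τ t0 z)) * Vy t z))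
    (C := C * (C * |t - t0| * L)) hy0 (by positivity) (fun z hz => by
      rw [abs_mul, abs_mul]
      exact mul_le_mul ((h2 t ht).2 z hz).1 (mul_le_mul (h1 t ht t0 ht0 z hz).2 (D.Vyb t ht z hz) (ann _)
        (by positivity)) (by positivity) hC.le)
  have b3 := int_abs_le (f := fun z => ψ z * (G' (τ t z) * Vy t z)) (C := C * L) hy0 hy (fun z hz => by
      rw [← mul_assoc, abs_mul]
      exact mul_le_mul ((h2 t ht).2 z hz).2.1 (D.Vyb t ht z hz) (ann _) hC.le)
  have e1 : (∫ z in Zr..y, ψ z * (G' (τ t z) * Vy t z)) - (∫ z in Zr..y0, ψ z * (G' (τ t0 z) * Vy t0 z))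
      = (∫ z in y0..y, ψ z * (G' (τ t z) * Vy t z)) + ((∫ z in Zr..y0, ψ z * ((G' (τ t z) - G' (τ t0 z)) * Vy t z))
        + ∫ z in Zr..y0, ψ z * G' (τ t0 z) * (Vy t z - Vy t0 z)) := by
    have r1 : ∀ z, ψ z * ((G' (τ t z) - G' (τ t0 z)) * Vy t z) = ψ z * (G' (τ t z) * Vy t z) - ψ z * (G' (τ t0 z) * Vy t z) :=
      fun z => by ring
    have r2 : ∀ z, ψ z * G' (τ t0 z) * (Vy t z - Vy t0 z) = ψ z * (G' (τ t0 z) * Vy t z) - ψ z * (G' (τ t0 z) * Vy t0 z) :=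
      fun z => by ring
    simp only [r1, r2]
    rw [← isl i1 i1', isb i1' i2,
      isb i2 i0]
    ring
  rw [Real.dist_eq, e1]
  have k1 : 3 * C * (e / (6 * C)) = e / 2 := by field_simp; norm_num
  have := abs_add_le (∫ z in y0..y, ψ z * (G' (τ t z) * Vy t z)) ((∫ z in Zr..y0, ψ z * ((G' (τ t z) - G' (τ t0 z)) * Vy t z))
        + ∫ z in Zr..y0, ψ z * G' (τ t0 z) * (Vy t z - Vy t0 z))
  have := abs_add_le (∫ z in Zr..y0, ψ z * ((G' (τ t z) - G' (τ t0 z)) * Vy t z))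
        (∫ z in Zr..y0, ψ z * G' (τ t0 z) * (Vy t z - Vy t0 z))
  linarith
end

lemma cd2 {G : FF} (h : ContDiffOn ℝ 2 G (Ioi 0)) : (∀ x, 0 < x → HD G (deriv G x) x) ∧
    (∀ x, 0 < x → HD (deriv G) (deriv (deriv G) x) x) ∧ CO (deriv (deriv G)) (Ioi 0) := by
  have h1 : ContDiffOn ℝ 1 (deriv G) (Ioi 0) := h.deriv_of_isOpen isOpen_Ioi (by norm_num)
  have h2 : ContDiffOn ℝ 0 (deriv (deriv G)) (Ioi 0) := h1.deriv_of_isOpen isOpen_Ioi (by norm_num)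
  refine ⟨fun x hx => ?_, fun x hx => ?_, h2.co⟩
  · exact ((h.differentiableOn (by norm_num)).differentiableAt (Ioi_mem_nhds hx)).hasDerivAt
  · exact ((h1.differentiableOn (by norm_num)).differentiableAt (Ioi_mem_nhds hx)).hasDerivAt

noncomputable def gm (μ : FF) (τ : ℝ) : ℝ := μ τ⁻¹ * τ⁻¹
noncomputable def gp (P : FF) (τ : ℝ) : ℝ := P τ⁻¹
noncomputable def gk (μ : FF) (ρs τ : ℝ) : ℝ := kf μ ρs τ⁻¹

lemma inv_cd : ContDiffOn ℝ 2 (fun x : ℝ => x⁻¹) (Ioi 0) :=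
  contDiffOn_id.inv fun _ hx => (ne_of_gt hx)

lemma gp_cd {P : FF} (hP : ContDiffOn ℝ 2 P (Ioi 0)) : ContDiffOn ℝ 2 (gp P) (Ioi 0) :=
  hP.comp inv_cd fun x hx => by simpa using hx

lemma gm_cd {μ : FF} (hμ : ContDiffOn ℝ 2 μ (Ioi 0)) : ContDiffOn ℝ 2 (gm μ) (Ioi 0) :=
  (gp_cd hμ).mul inv_cd

lemma gm_pos {μ : FF} (hμ : ∀ x, 0 < x → 0 < μ x) {x : ℝ} (hx : 0 < x) : 0 < gm μ x :=
  mul_pos (hμ _ (by positivity)) (by positivity)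

lemma kf_deriv {μ : FF} (hμ : CO μ (Ioi 0)) {ρs x : ℝ} (hs : 0 < ρs) (hx : 0 < x) :
    HD (kf μ ρs) (μ x / x) x := by
  have hc : CO (fun τ => μ τ / τ) (Ioi 0) := hμ.div continuousOn_id (fun x hx => ne_of_gt hx)
  have hsub : uIcc ρs x ⊆ Ioi 0 := fun z hz => lt_of_lt_of_le (lt_min hs hx) hz.1
  exact ihr (hc.mono hsub).ii
    (hc.stronglyMeasurableAtFilter isOpen_Ioi x hx) (hc.continuousAt (Ioi_mem_nhds hx))

lemma gk_deriv {μ : FF} (hμ : CO μ (Ioi 0)) {ρs x : ℝ} (hs : 0 < ρs) (hx : 0 < x) :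
    HD (gk μ ρs) (- gm μ x) x := by
  have := (kf_deriv hμ hs (inv_pos.2 hx)).comp x (hasDerivAt_inv hx.ne')
  refine this.cg (fun _ => rfl) ?_
  unfold gm
  field_simp

section
variable {P μ : FF} {Pext : ℝ} (sol : PistonSol P μ Pext)
  (hmass : ∀ t, 0 ≤ t → (∫ x in sol.a t..sol.b t, sol.ρ t x) = 1)

noncomputable def lV (t y : ℝ) : ℝ := eV sol t (eX sol t y)
noncomputable def lτ (t y : ℝ) : ℝ := (eR sol t (eX sol t y))⁻¹
noncomputable def lVy (t y : ℝ) : ℝ := sol.vx t (eX sol t y) * lτ sol t y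
noncomputable def lτy (t y : ℝ) : ℝ := - sol.ρx t (eX sol t y) * lτ sol t y ^ 3

lemma eXp_cont : Continuous fun z : RR => (z.1, eX sol z.1 z.2) := continuous_fst.prodMk (eX_cont sol)

lemma lV_cont : Continuous fun z : RR => lV sol z.1 z.2 := (eV_cont sol).comp (eXp_cont sol)
lemma lR_cont : Continuous fun z : RR => eR sol z.1 (eX sol z.1 z.2) := (eR_cont sol).comp (eXp_cont sol)
lemma lτ_cont : Continuous fun z : RR => lτ sol z.1 z.2 :=
  (lR_cont sol).inv₀ fun _ => (eR_pos sol _ _).ne'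
lemma lτ_pos (t y : ℝ) : 0 < lτ sol t y := inv_pos.2 (eR_pos sol _ _)

include hmass in
lemma LD_sol {α0 β0 α β N : ℝ} (h0 : 0 ≤ α0) (h1 : α0 < α) (h2 : α < β) (h3 : β < β0)
    (hL : ∀ t ∈ Ioo α0 β0, LipAt sol N t) :
    ∃ L, LD α β L (eX sol) (lV sol) (lτ sol) (lVy sol) (lτy sol) := by
  have hsub : Icc α β ⊆ Ioo α0 β0 := fun t ht => ⟨h1.trans_le ht.1, ht.2.trans_lt h3⟩
  have hpos : ∀ t ∈ Icc α β, 0 < t := fun t ht => h0.trans_lt (hsub ht).1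
  have hmem : ∀ t ∈ Icc α β, ∀ y ∈ UI, eX sol t y ∈ Icc (sol.a t) (sol.b t) := fun t ht y hy => by
    have := eX_mem sol hmass (t := t) hy
    rwa [eA_eq sol (hpos t ht).le, eB_eq sol (hpos t ht).le] at this
  have hmem' : ∀ t ∈ Icc α β, ∀ y ∈ UO, eX sol t y ∈ Ioo (sol.a t) (sol.b t) := fun t ht y hy => by
    have := eX_mem' sol hmass (t := t) hy
    rwa [eA_eq sol (hpos t ht).le, eB_eq sol (hpos t ht).le] at this
  obtain ⟨C, hC⟩ := (bx_compact α β).ebc (lτ_cont sol).co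
  have hC' : ∀ t ∈ Icc α β, ∀ y ∈ UI, |lτ sol t y| ≤ C := fun t ht y hy => hC _ (mem_bx ht hy)
  have hC0 : 0 ≤ C := (ann _).trans (hC' α ⟨le_rfl, h2.le⟩ 0 (by simp))
  have hN : 0 ≤ N := LipAt.nonneg (hL α (hsub ⟨le_rfl, h2.le⟩))
  have hXc : ∀ t, Continuous (eX sol t) := fun t => slice_right (eX_cont sol) t
  have hτc : ∀ t, Continuous (lτ sol t) := fun t => slice_right (lτ_cont sol) t
  refine ⟨N * C + N * C ^ 3, h2, by positivity, eX_cont sol, lV_cont sol, lτ_cont sol, lτ_pos sol,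
    fun t y => eX_deriv sol t y, fun t ht y hy => eX_dt sol hmass h0 hL (hsub ht) hy, fun t ht => ?_,
    fun t ht y hy => ?_, fun t ht => ?_, fun t ht y hy => ?_⟩
  · refine ⟨(slice_right (lV_cont sol) t).co, fun y hy => ?_, ?_⟩
    · exact (eV_dx sol (hpos t ht) (hmem' t ht y hy)).comp y (eX_deriv sol t y)
    · exact ((sol.vx_cont t (hpos t ht)).comp (hXc t).co (hmem t ht)).mul (hτc t).co
  · have := (LipAt.rx sol (hL t (hsub ht)) (hpos t ht) (hmem t ht y hy)).2
    have h5 : |lVy sol t y| ≤ N * C := by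
      unfold lVy; rw [abs_mul]; exact mul_le_mul this (hC' t ht y hy) (ann _) hN
    have : 0 ≤ N * C ^ 3 := by positivity
    linarith
  · refine ⟨(hτc t).co, fun y hy => ?_, ?_⟩
    · have := ((eR_dx sol (hpos t ht) (hmem' t ht y hy)).comp y (eX_deriv sol t y)).inv (eR_pos sol t _).ne'
      refine this.cg (fun _ => rfl) ?_
      have h6 := (eR_pos sol t (eX sol t y)).ne'
      unfold lτy lτ
      simp only [Function.comp]
      field_simp
    · exact (((sol.ρx_cont t (hpos t ht).le).comp (hXc t).co (hmem t ht)).neg).mul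
        ((hτc t).pow 3).co
  · have := (LipAt.rx sol (hL t (hsub ht)) (hpos t ht) (hmem t ht y hy)).1
    have h5 : |lτy sol t y| ≤ N * C ^ 3 := by
      unfold lτy; rw [abs_mul, abs_neg, abs_pow]
      exact mul_le_mul this (pow_le_pow_left₀ (ann _) (hC' t ht y hy) 3) (by positivity) hN
    have : 0 ≤ N * C := by positivity
    linarith
end

section
variable {α β L : ℝ} {X V τ Vy τy : FFF} {G : FF}

lemma LD.ID1 (D : LD α β L X V τ Vy τy) (hG : ContDiffOn ℝ 2 G (Ioi 0))
    {t y : ℝ} (ht : t ∈ Ioo α β) (hy : y ∈ UI) :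
    HD (fun s => ∫ z in Zr..y, G (τ s z)) (∫ z in Zr..y, deriv G (τ t z) * Vy t z) t := by
  obtain ⟨h1, h2, h3⟩ := cd2 hG
  have := D.ID h1 h2 h3 (ψ := fun _ => 1) (ψ' := fun _ => 0) (fun y => hasDerivAt_const y 1) ccn ht hy
  simpa only [one_mul] using this

lemma LD.IDc1 (D : LD α β L X V τ Vy τy) (hG : ContDiffOn ℝ 2 G (Ioi 0)) :
    CO (fun p : RR => ∫ z in Zr..p.2, deriv G (τ p.1 z) * Vy p.1 z) (bx α β) := by
  obtain ⟨h1, h2, h3⟩ := cd2 hG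
  have := D.IDc h1 h2 h3 (ψ := fun _ => 1) (ψ' := fun _ => 0) (fun y => hasDerivAt_const y 1) ccn
  simpa only [one_mul] using this
end

lemma par_cont {f : FFF} (hf : Continuous fun z : RR => f z.1 z.2) :
    Continuous fun z : RR => ∫ s in Zr..z.2, f z.1 s := by
  have h : Continuous (Function.uncurry fun (z : RR) s => f z.1 s) := by
    exact hf.comp ((continuous_fst.comp cfs).prodMk csn)
  exact intervalIntegral.continuous_parametric_intervalIntegral_of_continuous h csn

lemma par_dy {f : FFF} (hf : Continuous fun z : RR => f z.1 z.2) (t y : ℝ) :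
    HD (fun y => ∫ s in Zr..y, f t s) (f t y) y := by
  have h := slice_right hf t
  exact ihr (h.ii _ _)
    h.stronglyMeasurable.stronglyMeasurableAtFilter h.continuousAt

def clp (a b x : ℝ) : ℝ := max a (min x b)
lemma clp_cont (a b : ℝ) : Continuous (clp a b) := by unfold clp; fun_prop
lemma clp_mem {a b : ℝ} (h : a ≤ b) (x : ℝ) : clp a b x ∈ Icc a b := ⟨lml _ _, max_le h (mir _ _)⟩
lemma clp_eq {a b x : ℝ} (hx : x ∈ Icc a b) : clp a b x = x := by
  unfold clp; rw [min_eq_left hx.2, max_eq_right hx.1]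

section
variable {P μ : FF} {Pext : ℝ} (sol : PistonSol P μ Pext)
  (hmass : ∀ t, 0 ≤ t → (∫ x in sol.a t..sol.b t, sol.ρ t x) = 1)

lemma lG_cont {G : FF} (hG : ContDiffOn ℝ 2 G (Ioi 0)) : Continuous fun z : RR => G (lτ sol z.1 z.2) :=
  hG.co.comp_continuous (lτ_cont sol) (fun z => lτ_pos sol z.1 z.2)

noncomputable def mh (μ : FF) (τ : ℝ) : ℝ := (gm μ τ)⁻¹
noncomputable def mg (P μ : FF) (τ : ℝ) : ℝ := gp P τ / gm μ τ

noncomputable def zm (α1 β1 t y : ℝ) : ℝ := gm μ (lτ sol (clp α1 β1 t) (clp 0 1 y))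
noncomputable def zξ (α1 β1 t y : ℝ) : ℝ := ∫ z in Zr..y, 1 / zm sol α1 β1 t z
noncomputable def zξt (t y : ℝ) : ℝ := ∫ z in Zr..y, deriv (mh μ) (lτ sol t z) * lVy sol t z
noncomputable def zq (t y : ℝ) : ℝ := ∫ z in Zr..y, mg P μ (lτ sol t z)
noncomputable def zqt (t y : ℝ) : ℝ := ∫ z in Zr..y, deriv (mg P μ) (lτ sol t z) * lVy sol t z
noncomputable def zσ (t y : ℝ) : ℝ := gm μ (lτ sol t y) * lVy sol t y - gp P (lτ sol t y)

variable (hP : ContDiffOn ℝ 2 P (Ioi 0)) (hμ : ContDiffOn ℝ 2 μ (Ioi 0)) (hq : ∀ x, 0 < x → 0 < μ x)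

include hμ hq in
lemma mh_cd : ContDiffOn ℝ 2 (mh μ) (Ioi 0) := (gm_cd hμ).inv fun _ hx => (gm_pos hq hx).ne'
include hP hμ hq in
lemma mg_cd : ContDiffOn ℝ 2 (mg P μ) (Ioi 0) := (gp_cd hP).div (gm_cd hμ) fun _ hx => (gm_pos hq hx).ne'

include hμ in
lemma zm_cont (α1 β1 : ℝ) : Continuous fun z : RR => zm sol α1 β1 z.1 z.2 :=
  (lG_cont sol (gm_cd hμ)).comp (((clp_cont α1 β1).comp cfs).prodMk ((clp_cont 0 1).comp csn))

include hq in
lemma zm_pos (α1 β1 t y : ℝ) : 0 < zm sol α1 β1 t y := gm_pos hq (lτ_pos sol _ _)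

include hμ hq in
lemma zmi_cont (α1 β1 : ℝ) : Continuous fun z : RR => 1 / zm sol α1 β1 z.1 z.2 :=
  continuous_const.div (zm_cont sol hμ α1 β1) fun z => (zm_pos sol hq α1 β1 z.1 z.2).ne'

lemma zm_eq {α1 β1 t y : ℝ} (ht : t ∈ Icc α1 β1) (hy : y ∈ UI) : zm sol α1 β1 t y = gm μ (lτ sol t y) := by
  unfold zm; rw [clp_eq ht, clp_eq hy]

lemma zξ_eq {α1 β1 t y : ℝ} (ht : t ∈ Icc α1 β1) (hy : y ∈ UI) :
    zξ sol α1 β1 t y = ∫ z in Zr..y, mh μ (lτ sol t z) := by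
  apply intervalIntegral.integral_congr
  intro z hz
  have hs : uIcc 0 y ⊆ Icc 0 1 := oIs (by simp) hy
  simp only [zm_eq sol ht (hs hz), mh, one_div]

include hmass in
lemma eX_memI {t y : ℝ} (ht : 0 ≤ t) (hy : y ∈ UI) : eX sol t y ∈ Icc (sol.a t) (sol.b t) := by
  have := eX_mem sol hmass (t := t) hy
  rwa [eA_eq sol ht, eB_eq sol ht] at this

include hmass in
lemma eX_memO {t y : ℝ} (ht : 0 ≤ t) (hy : y ∈ UO) : eX sol t y ∈ Ioo (sol.a t) (sol.b t) := by
  have := eX_mem' sol hmass (t := t) hy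
  rwa [eA_eq sol ht, eB_eq sol ht] at this

include hmass in
/-- stress, and its derivative in mass coordinates -/
lemma zσ_dy {t y : ℝ} (ht : 0 < t) (hy : y ∈ UO) :
    HD (zσ sol t) (sol.vt t (eX sol t y) + sol.v t (eX sol t y) * sol.vx t (eX sol t y)) y := by
  have hx := eX_memO sol hmass ht.le hy
  have := (sol.momentum_eq t ht _ hx).comp y (eX_deriv sol t y)
  have e : eR sol t (eX sol t y) = sol.ρ t (eX sol t y) := eR_eq sol ht.le (occ hx)
  have hρ := (eR_pos sol t (eX sol t y)).ne'
  refine HasDerivAt.congr_of_eventuallyEq (HasDerivAt.congr_deriv this ?_) ?_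
  · rw [e] at hρ ⊢; field_simp
  · filter_upwards [omn hy.1 hy.2] with z hz
    have hx := eX_memO sol hmass ht.le hz
    have e : eR sol t (eX sol t z) = sol.ρ t (eX sol t z) := eR_eq sol ht.le (occ hx)
    have hρ := (eR_pos sol t (eX sol t z)).ne'
    simp only [zσ, gm, gp, lVy, lτ, inv_inv, Function.comp]
    rw [e] at hρ ⊢
    field_simp

include hmass hP hμ hq in
lemma touch_sol {α0 β0 α1 β1 L N s y A t η sg : ℝ} (h0 : 0 ≤ α0) (h1 : α0 < α1) (h3 : β1 < β0)
    (hL : ∀ t ∈ Ioo α0 β0, LipAt sol N t) (D : LD α1 β1 L (eX sol) (lV sol) (lτ sol) (lVy sol) (lτy sol))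
    (hs : s ∈ Ioo α1 β1) (hy : y ∈ UO)
    (hmax : IsLocalMax (fun z : RR => sg * (lV sol z.1 z.2 - zq sol z.1 z.2) - A * ((z.1 - t) ^ 2 + (zξ sol α1 β1 z.1 z.2 - η) ^ 2)) (s, y)) :
    HD (fun y => sg * zσ sol s y) (A * (2 * (s - t) + 2 * (zξ sol α1 β1 s y - η) * zξt sol s y) + sg * zqt sol s y) y := by
  have hs0 : s ∈ Ioo α0 β0 := ⟨h1.trans hs.1, hs.2.trans h3⟩
  have spos : 0 < s := h0.trans_lt hs0.1
  have hyI := occ hy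
  have hx := eX_memO sol hmass spos.le hy
  set x := eX sol s y with hxd
  have hYx : eY sol s x = y := eYX sol s y
  have hρ := eR_pos sol s x
  have eρ : eR sol s x = sol.ρ s x := eR_eq sol spos.le (occ hx)
  have ev : eV sol s x = sol.v s x := eV_eq sol spos.le (occ hx)
  have hm := (zm_pos sol hq α1 β1 s y)
  have dq : HD (fun s => zq sol s y) (zqt sol s y) s := D.ID1 (mg_cd hP hμ hq) hs hyI
  have dξ : HD (fun s => zξ sol α1 β1 s y) (zξt sol s y) s := by
    refine (D.ID1 (mh_cd hμ hq) hs hyI).congr_of_eventuallyEq ?_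
    filter_upwards [omn hs.1 hs.2] with r hr
    exact zξ_eq sol (occ hr) hyI
  have dY := eY_dt sol h0 hL hs0 hx
  have cq := lG_cont sol (mg_cd hP hμ hq)
  have cξ := zmi_cont sol hμ hq α1 β1
  have dq2 := chain2 (Y := zq sol) (R := fun t y => mg P μ (lτ sol t y)) (x := fun r => eY sol r x)
    (par_dy cq) cq dY (by rw [hYx]; exact dq)
  have dξ2 := chain2 (Y := zξ sol α1 β1) (R := fun t y => 1 / zm sol α1 β1 t y) (x := fun r => eY sol r x)
    (par_dy cξ) cξ dY (by rw [hYx]; exact dξ)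
  have dv : HD (fun r => lV sol r (eY sol r x)) (sol.vt s x) s := by
    refine (eV_dt sol spos hx).cg (fun r => ?_) rfl
    simp only [lV, eXY]
  rw [hYx] at dq2 dξ2
  have c1 : HD (fun r => sg * (lV sol r (eY sol r x) - zq sol r (eY sol r x))
      - A * ((r - t) ^ 2 + (zξ sol α1 β1 r (eY sol r x) - η) ^ 2)) _ s :=
    ((dv.sub dq2).const_mul sg).sub ((((hasDerivAt_id' s).sub_const t).pow 2 |>.add ((dξ2.sub_const η).pow 2)).const_mul A)
  have m1 : IsLocalMax (fun r => sg * (lV sol r (eY sol r x) - zq sol r (eY sol r x))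
      - A * ((r - t) ^ 2 + (zξ sol α1 β1 r (eY sol r x) - η) ^ 2)) s := by
    have ct : Tendsto (fun r => (r, eY sol r x)) (𝓝 s) (𝓝 (s, y)) := by
      have := (continuous_id.prodMk (slice_left (eY_cont sol) x)).tendsto s
      simpa [hYx] using this
    have := ct.eventually hmax
    simp only at this
    rw [← hYx] at this
    exact this
  have z1 := m1.hasDerivAt_eq_zero c1
  have dqy : HD (zq sol s) (mg P μ (lτ sol s y)) y := par_dy (f := fun t y => mg P μ (lτ sol t y)) cq s y
  have dξy : HD (zξ sol α1 β1 s) (1 / zm sol α1 β1 s y) y := par_dy (f := fun t y => 1 / zm sol α1 β1 t y) cξ s y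
  have c2 : HD (fun z => sg * (lV sol s z - zq sol s z)
      - A * ((s - t) ^ 2 + (zξ sol α1 β1 s z - η) ^ 2)) _ y :=
    (((D.VC s (occ hs)).d y hy).sub dqy).const_mul sg |>.sub
      (((dξy.sub_const η).pow 2).const_add ((s - t) ^ 2) |>.const_mul A)
  have m2 : IsLocalMax (fun z => sg * (lV sol s z - zq sol s z)
      - A * ((s - t) ^ 2 + (zξ sol α1 β1 s z - η) ^ 2)) y := by
    have ct : Tendsto (fun z => (s, z)) (𝓝 y) (𝓝 (s, y)) :=
      (continuous_const.prodMk continuous_id).tendsto y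
    exact ct.eventually hmax
  have z2 := m2.hasDerivAt_eq_zero c2
  refine ((zσ_dy sol hmass spos hy).const_mul sg).congr_deriv ?_
  rw [← hxd, ← ev]
  have e3 : eR sol s x * lVy sol s y = sol.vx s x := by
    unfold lVy lτ; rw [← hxd]; field_simp
  rw [← e3]
  simp only [hYx] at z1 z2
  change sg * (lVy sol s y - mg P μ (lτ sol s y)) - A * (((2:ℕ):ℝ) * (zξ sol α1 β1 s y - η) ^ (2 - 1) * (1 / zm sol α1 β1 s y)) = 0 at z2
  norm_num at z1 z2
  linear_combination z1 + eR sol s x * eV sol s x * z2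
end

lemma C1I.of_int {f : FF} (hf : CO f (Icc 0 1)) : C1I (fun y => ∫ z in Zr..y, f z) f := by
  have hi : ∀ y ∈ UI, II f volume 0 y := fun y hy =>
    (hf.mono (oIs (by simp) hy)).ii
  refine ⟨?_, fun y hy => ?_, hf⟩
  · have : IntegrableOn f (uIcc 0 1) := by rw [uol zlo]; exact hf.integrableOn_Icc
    have := intervalIntegral.continuousOn_primitive_interval this
    rwa [uol zlo] at this
  · exact ihr (hi y (occ hy))
      ((hf.mono occ).stronglyMeasurableAtFilter isOpen_Ioo y hy) (hf.continuousAt (Icc_mem_nhds hy.1 hy.2))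

section
variable {P μ : FF} {Pext : ℝ} (sol : PistonSol P μ Pext)
  (hmass : ∀ t, 0 ≤ t → (∫ x in sol.a t..sol.b t, sol.ρ t x) = 1)
variable (hP : ContDiffOn ℝ 2 P (Ioi 0)) (hμ : ContDiffOn ℝ 2 μ (Ioi 0)) (hq : ∀ x, 0 < x → 0 < μ x)

include hμ in
lemma gm_lip {α1 β1 L : ℝ} (D : LD α1 β1 L (eX sol) (lV sol) (lτ sol) (lVy sol) (lτy sol)) :
    ∃ C, 0 ≤ C ∧ ∀ s ∈ Icc α1 β1, ∀ t ∈ Icc α1 β1, ∀ y ∈ UI, ∀ y' ∈ UI,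
      |gm μ (lτ sol s y) - gm μ (lτ sol t y')| ≤ C * (|s - t| + |y - y'|) := by
  obtain ⟨c, d, hc, hcd, hr⟩ := D.ran
  have hsub : Icc c d ⊆ Ioi 0 := fun x hx => hc.trans_le hx.1
  obtain ⟨g1, g2, g3⟩ := cd2 (gm_cd hμ)
  have g2' : CO (deriv (gm μ)) (Ioi 0) := fun x hx => (g2 x hx).cw
  obtain ⟨C1, h1⟩ := bIcc (g2'.mono hsub)
  have p1 : 0 ≤ C1 := (norm_nonneg _).trans (h1 c ⟨le_rfl, hcd⟩)
  refine ⟨C1 * L, mul_nonneg p1 D.hL, fun s hs t ht y hy y' hy' => ?_⟩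
  have l1 : |gm μ (lτ sol s y) - gm μ (lτ sol t y')| ≤ C1 * |lτ sol s y - lτ sol t y'| :=
    (convex_Icc c d).norm_image_sub_le_of_norm_hasDerivWithin_le
      (fun z hz => (g1 z (hsub hz)).hasDerivWithinAt) h1 (hr t ht y' hy') (hr s hs y hy)
  have l2 := D.τLip ht hs hy
  have l3 := (D.τC t ht).lip (D.τyb t ht) y' hy' y hy
  have l4 : |lτ sol s y - lτ sol t y'| ≤ L * (|s - t| + |y - y'|) := by
    have := abs_sub_le (lτ sol s y) (lτ sol t y) (lτ sol t y')
    linarith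
  rw [mul_assoc]
  exact l1.trans (mll l4 p1)

include hmass hP hμ hq in
lemma ALD_sol {α0 β0 α1 β1 α β L N sg : ℝ} (h0 : 0 ≤ α0) (h1 : α0 < α1) (h3 : β1 < β0)
    (hL : ∀ t ∈ Ioo α0 β0, LipAt sol N t) (D : LD α1 β1 L (eX sol) (lV sol) (lτ sol) (lVy sol) (lτy sol))
    (k1 : α1 < α) (k2 : α < β) (k3 : β < β1) (hsg : |sg| ≤ 1) :
    ∃ C0, ∀ C ≥ C0, ALD α β C (fun t y => sg * (lV sol t y - zq sol t y)) (zξ sol α1 β1) (zm sol α1 β1) (zξt sol)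
      (fun t y => sg * zqt sol t y) (fun t y => sg * zσ sol t y) := by
  have hsub : Icc α β ⊆ Ioo α1 β1 := fun t ht => ⟨k1.trans_le ht.1, ht.2.trans_lt k3⟩
  have hsub' : Icc α β ⊆ Icc α1 β1 := hsub.trans occ
  have hbx : bx α β ⊆ bx α1 β1 := prod_mono hsub' subset_rfl
  obtain ⟨Cm, hCm⟩ := (bx_compact α1 β1).ebc (lG_cont sol (gm_cd hμ)).co
  obtain ⟨Cp, hCp⟩ := (bx_compact α1 β1).ebc (lG_cont sol (gp_cd hP)).co
  have hCm' : ∀ t ∈ Icc α1 β1, ∀ y ∈ UI, |gm μ (lτ sol t y)| ≤ Cm := fun t ht y hy => hCm _ (mem_bx ht hy)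
  have hCp' : ∀ t ∈ Icc α1 β1, ∀ y ∈ UI, |gp P (lτ sol t y)| ≤ Cp := fun t ht y hy => hCp _ (mem_bx ht hy)
  obtain ⟨Cl, hCl0, hCl⟩ := gm_lip sol hμ D
  have h01 : Zr ∈ UI := by simp
  have hα1 : α1 ∈ Icc α1 β1 := ⟨le_rfl, by linarith⟩
  have p1 : 0 ≤ Cm := (ann _).trans (hCm' _ hα1 _ h01)
  have p2 : 0 ≤ Cp := (ann _).trans (hCp' _ hα1 _ h01)
  have p3 : 0 ≤ Cm * L := mul_nonneg p1 D.hL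
  refine ⟨Cm + Cl + (Cm * L + Cp) + 1, fun C hC => ?_⟩
  have cq := lG_cont sol (mg_cd hP hμ hq)
  refine ⟨k2, by linarith, ?_, par_cont (f := fun t y => 1 / zm sol α1 β1 t y) (zmi_cont sol hμ hq α1 β1), zm_cont sol hμ α1 β1, zm_pos sol hq α1 β1,
    fun t y => ?_, fun t y => ?_, fun t ht y hy => ?_, (D.IDc1 (mh_cd hμ hq)).mono hbx,
    ((D.IDc1 (mg_cd hP hμ hq)).mono hbx).const_smul sg, fun s hs t ht y hy y' hy' => ?_, fun t ht y hy => ?_,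
    fun t ht y hy => ?_, fun s hs y hy A t η hmax =>
      touch_sol sol hmass hP hμ hq h0 h1 h3 hL D (hsub (occ hs)) hy hmax⟩
  · exact ((lV_cont sol).sub (par_cont (f := fun t y => mg P μ (lτ sol t y)) cq)).const_smul sg
  · have := (las _).trans (hCm' _ (clp_mem (by linarith : α1 ≤ β1) t) _ (clp_mem zlo y))
    unfold zm; linarith
  · exact par_dy (f := fun t y => 1 / zm sol α1 β1 t y) (zmi_cont sol hμ hq α1 β1) t y
  · have ht' := hsub ht
    refine (D.ID1 (mh_cd hμ hq) ht' hy).congr_of_eventuallyEq ?_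
    filter_upwards [omn ht'.1 ht'.2] with r hr
    exact zξ_eq sol (occ hr) hy
  · rw [zm_eq sol (hsub' hs) hy, zm_eq sol (hsub' ht) hy']
    exact (hCl s (hsub' hs) t (hsub' ht) y hy y' hy').trans
      (mlr (by linarith) (by positivity))
  · have hm := gm_pos hq (lτ_pos sol t y)
    have dqy : HD (zq sol t) (mg P μ (lτ sol t y)) y := par_dy (f := fun t y => mg P μ (lτ sol t y)) cq t y
    refine ((((D.VC t (hsub' ht)).d y hy).sub dqy).const_mul sg).congr_deriv ?_
    rw [zm_eq sol (hsub' ht) (occ hy)]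
    unfold zσ mg
    field_simp
  · have hy' := occ hy
    have q1 : |zσ sol t y| ≤ Cm * L + Cp := by
      unfold zσ
      refine (abs_sub _ _).trans (add_le_add ?_ (hCp' t (hsub' ht) y hy'))
      rw [abs_mul]
      exact mul_le_mul (hCm' t (hsub' ht) y hy') (D.Vyb t (hsub' ht) y hy') (ann _) p1
    have : |sg * zσ sol t y| ≤ 1 * (Cm * L + Cp) := by
      rw [abs_mul]; exact mul_le_mul hsg q1 (ann _) zlo
    linarith
end

section
variable {P μ : FF} {Pext : ℝ} (sol : PistonSol P μ Pext)
  (hmass : ∀ t, 0 ≤ t → (∫ x in sol.a t..sol.b t, sol.ρ t x) = 1)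
variable (hP : ContDiffOn ℝ 2 P (Ioi 0)) (hμ : ContDiffOn ℝ 2 μ (Ioi 0)) (hq : ∀ x, 0 < x → 0 < μ x)

lemma lG_slice {G : FF} (hG : ContDiffOn ℝ 2 G (Ioi 0)) (t : ℝ) : Continuous fun y => G (lτ sol t y) :=
  slice_right (f := fun t y => G (lτ sol t y)) (lG_cont sol hG) t

include hP in
lemma zp_cont {φ' : FF} (hφ' : Continuous φ') : Continuous fun t => ∫ y in Zr..1, φ' y * gp P (lτ sol t y) :=
  slice_left (f := fun t x => ∫ y in Zr..x, φ' y * gp P (lτ sol t y))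
    (par_cont (f := fun t y => φ' y * gp P (lτ sol t y)) ((hφ'.comp csn).mul (lG_cont sol (gp_cd hP)))) 1

include hmass hP hμ hq in
lemma Gam_le {α0 β0 α1 β1 α β L N sg ρs δ : ℝ} (h0 : 0 ≤ α0) (h1 : α0 < α1) (h3 : β1 < β0) (hρs : 0 < ρs)
    (hL : ∀ t ∈ Ioo α0 β0, LipAt sol N t) (D : LD α1 β1 L (eX sol) (lV sol) (lτ sol) (lVy sol) (lτy sol))
    (k1 : α1 < α) (k2 : α < β) (k3 : β < β1) (hsg : |sg| ≤ 1) (hδ : 0 < δ)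
    {φ φ' φ'' : FF} (hφ : ∀ y, HD φ (φ' y) y) (hφ' : ∀ y, HD φ' (φ'' y) y) (hφ'' : Continuous φ'')
    (hφ0 : ∀ y, 0 ≤ φ y)
    (hφs : ∀ y, y ∉ Icc δ (1 - δ) → φ y = 0) (hφs' : ∀ y, y ∉ Icc δ (1 - δ) → φ' y = 0) :
    AntitoneOn (fun t => sg * ((∫ y in Zr..1, φ y * lV sol t y) - (∫ y in Zr..1, φ' y * gk μ ρs (lτ sol t y))
      - ∫ s in α..t, ∫ y in Zr..1, φ' y * gp P (lτ sol s y))) (Ioo α β) := by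
  have hφc : Continuous φ := cif fun y => (hφ y).continuousAt
  have hφ'c : Continuous φ' := cif fun y => (hφ' y).continuousAt
  have hsub : Icc α β ⊆ Ioo α1 β1 := fun t ht => ⟨k1.trans_le ht.1, ht.2.trans_lt k3⟩
  have hsub' : Icc α β ⊆ Icc α1 β1 := hsub.trans occ
  have n0 : Zr ∉ Icc δ (1 - δ) := fun h => by linarith [h.1]
  have n1 : (1:ℝ) ∉ Icc δ (1 - δ) := fun h => by linarith [h.2]
  have i1 : (1:ℝ) ∈ UI := by simp
  obtain ⟨g1, g2, g3⟩ := cd2 (gm_cd hμ)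
  have g2' : CO (deriv (gm μ)) (Ioi 0) := fun x hx => (g2 x hx).cw
  obtain ⟨C0, hA⟩ := ALD_sol sol hmass hP hμ hq h0 h1 h3 hL D k1 k2 k3 hsg
  obtain ⟨C1, hC1, -, hC2⟩ := D.consts (G := gk μ ρs) (G' := fun x => - gm μ x) (G'' := fun x => - deriv (gm μ) x)
    (fun x hx => gk_deriv hμ.co hρs hx) (fun x hx => (g1 x hx).neg) g2'.neg hφ' hφ''
  set Λ : FFF := fun t y => -(φ'' y * (- gm μ (lτ sol t y)) + φ' y * (- deriv (gm μ) (lτ sol t y) * lτy sol t y)) with hΛ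
  have hC2' : ∀ t ∈ Icc α β, C1I (fun y => gm μ (lτ sol t y) * φ' y) (Λ t) := fun t ht => by
    have := (hC2 t (hsub' ht)).1.smul (-1)
    convert this using 2
    · ring
    · simp only [hΛ]; ring
  have cq := lG_cont sol (mg_cd hP hμ hq)
  have D' := hA (max C0 C1) (lml _ _)
  set K : FF := fun t => sg * ((∫ y in Zr..1, φ' y * gk μ ρs (lτ sol t y))
    + (∫ s in α..t, ∫ y in Zr..1, φ' y * gp P (lτ sol s y)) - ∫ y in Zr..1, φ y * zq sol t y) with hK
  set Φ : FF := fun y => -∫ z in (1:ℝ)..y, φ z with hΦ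
  have dΦ : ∀ y, HD Φ (- φ y) y := fun y =>
    (ihr (hφc.ii _ _)
      hφc.stronglyMeasurable.stronglyMeasurableAtFilter hφc.continuousAt).neg
  have Φ1 : Φ 1 = 0 := by simp [hΦ]
  have cΦ := C1I.of_deriv dΦ hφc.neg.co
  have swap : ∀ f : FF, CO f (Icc 0 1) →
      ∫ y in Zr..1, φ y * (∫ z in Zr..y, f z) = ∫ y in Zr..1, Φ y * f y := fun f hf => by
    rw [cΦ.ibp (C1I.of_int hf) i1, Φ1]
    simp [intervalIntegral.integral_neg]
  have dq : ∀ t ∈ Ioo α β, HD (fun t => ∫ y in Zr..1, φ y * zq sol t y) (∫ y in Zr..1, φ y * zqt sol t y) t := by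
    intro t ht
    have ht' := occ ht
    obtain ⟨q1, q2, q3⟩ := cd2 (mg_cd hP hμ hq)
    have q2' : CO (deriv (mg P μ)) (Ioi 0) := fun x hx => (q2 x hx).cw
    have := D.ID q1 q2 q3 dΦ hφc.neg (hsub ht') i1
    refine this.cg (fun s => ?_) ?_
    · exact swap _ (lG_slice sol (mg_cd hP hμ hq) s).co
    · refine swap _ (ContinuousOn.mul ?_ (D.VC t (hsub' ht')).c')
      exact (q2'.comp_continuous (slice_right (lτ_cont sol) t) (lτ_pos sol t)).co
  have main := AL_main D' (φ := φ) (φ' := φ') (K := K) (Λ := Λ) hδ hφ hφ'c hφ0 hφs hφs'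
    (fun t ht y hy => by
      refine ((hC2' t ht).d y hy).congr_of_eventuallyEq ?_
      filter_upwards [omn hy.1 hy.2] with z hz
      rw [zm_eq sol (hsub' ht) (occ hz)])
    (fun t ht => (hC2' t ht).c')
    (fun t ht y hy => by
      refine le_trans (le_of_eq ?_) (((hC2 t (hsub' ht)).2 y hy).2.2.trans (lmr C0 C1))
      simp only [hΛ, abs_neg])
    (fun t ht => by
      have ht' := occ ht
      have a1 := D.ID (G := gk μ ρs) (G' := fun x => - gm μ x) (G'' := fun x => - deriv (gm μ) x)
        (fun x hx => gk_deriv hμ.co hρs hx) (fun x hx => (g1 x hx).neg) g2'.neg hφ' hφ'' (hsub ht') i1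
      have a2 : HD (fun t => ∫ s in α..t, ∫ y in Zr..1, φ' y * gp P (lτ sol s y))
          (∫ y in Zr..1, φ' y * gp P (lτ sol t y)) t :=
        ihr ((zp_cont sol hP hφ'c).ii _ _)
          (zp_cont sol hP hφ'c).stronglyMeasurable.stronglyMeasurableAtFilter (zp_cont sol hP hφ'c).continuousAt
      refine (((a1.add a2).sub (dq t ht)).const_mul sg).congr_deriv ?_
      have CV := D.VC t (hsub' ht')
      have CU : C1I (fun y => sg * (lV sol t y - zq sol t y)) (fun y => sg * (lVy sol t y - mg P μ (lτ sol t y))) :=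
        (CV.sub (C1I.of_int (lG_slice sol (mg_cd hP hμ hq) t).co)).smul sg
      have ib := (hC2' t ht').ibp CU i1
      rw [hφs' 0 n0, hφs' 1 n1] at ib
      have e1 : ∫ y in Zr..1, Λ t y * (sg * (lV sol t y - zq sol t y)) =
          - ∫ y in Zr..1, gm μ (lτ sol t y) * φ' y * (sg * (lVy sol t y - mg P μ (lτ sol t y))) := by
        rw [ib]; ring
      rw [e1]
      have gmc := lG_slice sol (gm_cd hμ) t
      have j1 : II (fun y => φ' y * (- gm μ (lτ sol t y) * lVy sol t y)) volume 0 1 := by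
        refine ContinuousOn.ii ?_
        rw [uol zlo]
        exact hφ'c.co.mul (gmc.neg.co.mul CV.c')
      have j2 : II (fun y => φ' y * gp P (lτ sol t y)) volume 0 1 :=
        (hφ'c.mul (lG_slice sol (gp_cd hP) t)).ii _ _
      have e2 : ∫ y in Zr..1, gm μ (lτ sol t y) * φ' y * (sg * (lVy sol t y - mg P μ (lτ sol t y))) =
          - (sg * ((∫ y in Zr..1, φ' y * (- gm μ (lτ sol t y) * lVy sol t y)) + ∫ y in Zr..1, φ' y * gp P (lτ sol t y))) := by
        rw [← iad j1 j2, ← icm, ← intervalIntegral.integral_neg]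
        congr 1
        ext y
        have := gm_pos hq (lτ_pos sol t y)
        unfold mg
        field_simp
        ring
      rw [e2]
      have e3 : ∫ y in Zr..1, φ y * (sg * zqt sol t y) = sg * ∫ y in Zr..1, φ y * zqt sol t y := by
        rw [← icm]
        congr 1; ext y; ring
      rw [e3]
      ring)
  refine main.congr fun t _ => ?_
  have f1 : II (fun y => φ y * lV sol t y) volume 0 1 :=
    (hφc.mul (slice_right (lV_cont sol) t)).ii _ _
  have f2 : II (fun y => φ y * zq sol t y) volume 0 1 :=
    (hφc.mul (slice_right (par_cont (f := fun t y => mg P μ (lτ sol t y)) cq) t)).ii _ _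
  have e4 : ∫ y in Zr..1, φ y * (sg * (lV sol t y - zq sol t y)) =
      sg * ((∫ y in Zr..1, φ y * lV sol t y) - ∫ y in Zr..1, φ y * zq sol t y) := by
    rw [← isb f1 f2, ← icm]
    congr 1; ext y; ring
  simp only [hK]
  rw [e4]
  ring

include hmass hP hμ hq in
lemma Gam_const {α0 β0 α1 β1 α β L N ρs δ : ℝ} (h0 : 0 ≤ α0) (h1 : α0 < α1) (h3 : β1 < β0) (hρs : 0 < ρs)
    (hL : ∀ t ∈ Ioo α0 β0, LipAt sol N t) (D : LD α1 β1 L (eX sol) (lV sol) (lτ sol) (lVy sol) (lτy sol))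
    (k1 : α1 < α) (k2 : α < β) (k3 : β < β1) (hδ : 0 < δ)
    {φ φ' φ'' : FF} (hφ : ∀ y, HD φ (φ' y) y) (hφ' : ∀ y, HD φ' (φ'' y) y) (hφ'' : Continuous φ'')
    (hφ0 : ∀ y, 0 ≤ φ y)
    (hφs : ∀ y, y ∉ Icc δ (1 - δ) → φ y = 0) (hφs' : ∀ y, y ∉ Icc δ (1 - δ) → φ' y = 0)
    {s t : ℝ} (hs : s ∈ Ioo α β) (ht : t ∈ Ioo α β) (hst : s ≤ t) :
    (∫ y in Zr..1, φ y * lV sol t y) - (∫ y in Zr..1, φ' y * gk μ ρs (lτ sol t y))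
    - ((∫ y in Zr..1, φ y * lV sol s y) - (∫ y in Zr..1, φ' y * gk μ ρs (lτ sol s y)))
      = ∫ r in s..t, ∫ y in Zr..1, φ' y * gp P (lτ sol r y) := by
  have hφ'c : Continuous φ' := cif fun y => (hφ' y).continuousAt
  have a1 := Gam_le sol hmass hP hμ hq (sg := 1) h0 h1 h3 hρs hL D k1 k2 k3 (by simp) hδ hφ hφ' hφ'' hφ0 hφs hφs' hs ht hst
  have a2 := Gam_le sol hmass hP hμ hq (sg := -1) h0 h1 h3 hρs hL D k1 k2 k3 (by simp) hδ hφ hφ' hφ'' hφ0 hφs hφs' hs ht hst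
  have hi := (zp_cont sol hP hφ'c).intervalIntegrable (μ := volume)
  rw [← isl (hi α t) (hi α s)]
  simp only at a1 a2
  linarith
end

def BFtest (δ : ℝ) (φ φ' φ'' : FF) : Prop := 
  (∀ y, HD φ (φ' y) y) ∧ (∀ y, HD φ' (φ'' y) y) ∧ Continuous φ'' ∧ (∀ y, 0 ≤ φ y) ∧
  (∀ y, y ∉ Icc δ (1 - δ) → φ y = 0) ∧ (∀ y, y ∉ Icc δ (1 - δ) → φ' y = 0)

lemma const_weak1 {Δ : FF} (hΔ : Continuous Δ)
    (h : ∀ δ φ φ' φ'', 0 < δ → BFtest δ φ φ' φ'' → ∫ y in Zr..1, φ' y * Δ y = 0)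
    {y1 y2 : ℝ} (h1 : 0 < y1) (h12 : y1 < y2) (h2 : y2 < 1) : Δ y1 ≤ Δ y2 := by
  by_contra hlt
  push Not at hlt
  set d := y2 - y1 with hd
  have hdpos : 0 < d := by linarith
  have hDc : Continuous fun y => Δ y - Δ (y + d) := by fun_prop
  have hev : ∀ᶠ y in 𝓝 y1, 0 < Δ y - Δ (y + d) := by
    refine hDc.continuousAt.eventually (lt_mem_nhds ?_)
    have : y1 + d = y2 := by rw [hd]; ring
    change 0 < Δ y1 - Δ (y1 + d)
    rw [this]; linarith
  obtain ⟨e0, he0, hball⟩ := Metric.eventually_nhds_iff_ball.1 hev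
  set e := min e0 (min y1 (1 - y2) / 3) with he
  have hepos : 0 < e := lt_min he0 (by have := lt_min h1 (sub_pos.2 h2); positivity)
  have he1 : 3 * e ≤ y1 := by
    have := (mir e0 (min y1 (1 - y2) / 3)).trans (div_le_div_of_nonneg_right (min_le_left _ _) (by norm_num))
    linarith
  have he2 : 3 * e ≤ 1 - y2 := by
    have := (mir e0 (min y1 (1 - y2) / 3)).trans (div_le_div_of_nonneg_right (mir _ _) (by norm_num))
    linarith
  let f : ContDiffBump y1 := ⟨e / 2, e, by positivity, by linarith⟩
  have fc : Continuous f := f.continuous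
  have fcd : ContDiff ℝ 1 f := f.contDiff
  have fz : ∀ y, y ∉ Ioo (y1 - e) (y1 + e) → f y = 0 := fun y hy => by
    apply f.zero_of_le_dist
    rw [Real.dist_eq]
    by_contra hc
    push Not at hc
    exact hy ⟨by linarith [(abs_lt.1 hc).1], by linarith [(abs_lt.1 hc).2]⟩
  have fd : ∀ y, HD f (deriv f y) y := fun y => (fcd.differentiable (by norm_num) y).hasDerivAt
  have fd' : Continuous (deriv f) := fcd.continuous_deriv (by norm_num)
  have dI : ∀ y, HD (fun y => ∫ z in Zr..y, f z) (f y) y := fun y =>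
    ihr (fc.ii _ _)
      fc.stronglyMeasurable.stronglyMeasurableAtFilter fc.continuousAt
  have hsh : ∀ y, HD (fun y : ℝ => y - d) 1 y := fun y => (hasDerivAt_id' y).sub_const d
  have fzero : ∀ a b, (∀ z ∈ uIcc a b, f z = 0) → ∫ z in a..b, f z = 0 := fun a b hz => by
    rw [intervalIntegral.integral_congr (g := fun _ => Zr) hz]; simp
  have hφeq : ∀ y, (∫ z in Zr..y, f z) - (∫ z in Zr..(y - d), f z) = ∫ z in (y - d)..y, f z := fun y =>
    isl (fc.ii _ _) (fc.ii _ _)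
  have key := h e (fun y => (∫ z in Zr..y, f z) - ∫ z in Zr..(y - d), f z) (fun y => f y - f (y - d))
    (fun y => deriv f y - deriv f (y - d)) hepos ⟨fun y => by
      have := (dI y).sub ((dI (y - d)).comp y (hsh y))
      exact this.cg (fun _ => rfl) (by simp), fun y => by
      have := (fd y).sub ((fd (y - d)).comp y (hsh y))
      exact this.cg (fun _ => rfl) (by simp), by fun_prop, fun y => by
      simp only [hφeq]
      exact intervalIntegral.integral_nonneg (by linarith) fun z _ => f.nonneg, fun y hy => by
      simp only [hφeq]
      apply fzero
      intro z hz
      rw [uol (by linarith)] at hz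
      apply fz
      rintro ⟨z1, z2⟩
      exact hy ⟨by linarith [hz.2], by linarith [hz.1]⟩, fun y hy => by
      simp only
      rw [fz y (fun hh => hy ⟨by linarith [hh.1], by linarith [hh.2]⟩),
        fz (y - d) (fun hh => hy ⟨by linarith [hh.1], by linarith [hh.2]⟩), sub_zero]⟩
  have i1 : ∫ y in Zr..1, (f y - f (y - d)) * Δ y = ∫ y, (f y - f (y - d)) * Δ y := by
    apply intervalIntegral.integral_eq_integral_of_support_subset
    intro y hy
    by_contra hc
    apply hy
    change (f y - f (y - d)) * Δ y = 0
    rw [fz y (fun hh => hc ⟨by linarith [hh.1], by linarith [hh.2]⟩),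
        fz (y - d) (fun hh => hc ⟨by linarith [hh.1], by linarith [hh.2]⟩)]
    simp
  have cs : HasCompactSupport fun y => f y * Δ y := f.hasCompactSupport.mul_right
  have cs2 : HasCompactSupport fun y => f y * Δ (y + d) := f.hasCompactSupport.mul_right
  have in1 : Integrable fun y => f y * Δ y := Continuous.integrable_of_hasCompactSupport (by fun_prop) cs
  have in2 : Integrable fun y => f y * Δ (y + d) := Continuous.integrable_of_hasCompactSupport (by fun_prop) cs2
  have in3 : Integrable fun y => f (y - d) * Δ y := by
    have := in2.comp_sub_right d
    simpa using this
  have i2 : ∫ y, f (y - d) * Δ y = ∫ y, f y * Δ (y + d) := by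
    have := integral_sub_right_eq_self (μ := volume) (fun y => f y * Δ (y + d)) d
    rw [← this]; simp
  have i3 : ∫ y, (f y - f (y - d)) * Δ y = ∫ y, f y * (Δ y - Δ (y + d)) := by
    simp only [sub_mul, mul_sub]
    rw [integral_sub in1 in3, i2, ← integral_sub in1 in2]
  have pos : 0 < ∫ y, f y * (Δ y - Δ (y + d)) := by
    apply Continuous.integral_pos_of_hasCompactSupport_nonneg_nonzero (x := y1) (by fun_prop) f.hasCompactSupport.mul_right
    · intro y
      by_cases hy : y ∈ Ioo (y1 - e) (y1 + e)
      · refine mul_nonneg f.nonneg (le_of_lt (hball y ?_))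
        rw [Real.ball_eq_Ioo]
        have : e ≤ e0 := min_le_left _ _
        exact ⟨by linarith [hy.1], by linarith [hy.2]⟩
      · change 0 ≤ f y * (Δ y - Δ (y + d)); rw [fz y hy, zero_mul]
    · have q1 : f y1 = 1 := f.one_of_mem_closedBall (by simp [f.rIn_pos.le])
      have q2 := hball y1 (by simp [he0])
      change f y1 * (Δ y1 - Δ (y1 + d)) ≠ 0
      rw [q1, one_mul]
      exact q2.ne'
  rw [i1, i3] at key
  linarith

lemma const_weak {Δ : FF} (hΔ : Continuous Δ)
    (h : ∀ δ φ φ' φ'', 0 < δ → BFtest δ φ φ' φ'' → ∫ y in Zr..1, φ' y * Δ y = 0)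
    {y : ℝ} (hy : y ∈ UI) : Δ y = Δ (1 / 2) := by
  have h' : ∀ δ φ φ' φ'', 0 < δ → BFtest δ φ φ' φ'' → ∫ y in Zr..1, φ' y * (-Δ y) = 0 := fun δ φ φ' φ'' hδ ht => by
    simp only [mul_neg, intervalIntegral.integral_neg, h δ φ φ' φ'' hδ ht, neg_zero]
  have hI : ∀ y1 y2, 0 < y1 → y1 < y2 → y2 < 1 → Δ y1 = Δ y2 := fun y1 y2 h1 h12 h2 =>
    le_antisymm (const_weak1 hΔ h h1 h12 h2) (neg_le_neg_iff.1 (const_weak1 (Δ := fun y => -Δ y) hΔ.neg h' h1 h12 h2))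
  have hO : ∀ y ∈ UO, Δ y = Δ (1 / 2) := fun y hy => by
    rcases lt_trichotomy y (1 / 2) with h | h | h
    · exact hI _ _ hy.1 h (by norm_num)
    · rw [h]
    · exact (hI _ _ (by norm_num) h hy.2).symm
  have hcl : closure (UO) = Icc 0 1 := closure_Ioo zero_ne_one
  have : y ∈ closure (UO) := by rwa [hcl]
  exact closure_minimal (t := {y | Δ y = Δ (1 / 2)}) hO (isClosed_eq hΔ ccn) this

section
variable {P μ : FF} {Pext : ℝ} (sol : PistonSol P μ Pext)
  (hmass : ∀ t, 0 ≤ t → (∫ x in sol.a t..sol.b t, sol.ρ t x) = 1)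
variable (hP : ContDiffOn ℝ 2 P (Ioi 0)) (hμ : ContDiffOn ℝ 2 μ (Ioi 0)) (hq : ∀ x, 0 < x → 0 < μ x)

noncomputable def zH (ρs t y : ℝ) : ℝ := (∫ z in Zr..y, lV sol t z) + gk μ ρs (lτ sol t y)

include hμ in
lemma gkl_cont {ρs : ℝ} (hρs : 0 < ρs) : Continuous fun z : RR => gk μ ρs (lτ sol z.1 z.2) := by
  have : CO (gk μ ρs) (Ioi 0) := fun x hx => (gk_deriv hμ.co hρs hx).cw
  exact this.comp_continuous (lτ_cont sol) (fun z => lτ_pos sol z.1 z.2)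

include hμ in
lemma zH_cont {ρs : ℝ} (hρs : 0 < ρs) : Continuous fun z : RR => zH sol ρs z.1 z.2 :=
  (par_cont (f := lV sol) (lV_cont sol)).add (gkl_cont sol hμ hρs)

include hP in
lemma pint_cont : Continuous fun z : (RR) × ℝ => ∫ r in z.1.1..z.1.2, gp P (lτ sol r z.2) := by
  have h0 : Continuous fun z : RR => ∫ r in Zr..z.2, gp P (lτ sol r z.1) :=
    par_cont (f := fun y r => gp P (lτ sol r y)) ((lG_cont sol (gp_cd hP)).comp (continuous_snd.prodMk cfs))
  have hi : ∀ y a b, II (fun r => gp P (lτ sol r y)) volume a b := fun y a b =>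
    (slice_left (f := fun t y => gp P (lτ sol t y)) (lG_cont sol (gp_cd hP)) y).ii _ _
  have h1 := (h0.comp (continuous_snd.prodMk (continuous_snd.comp cfs) : Continuous fun z : (RR) × ℝ => (z.2, z.1.2))).sub
    (h0.comp (continuous_snd.prodMk (continuous_fst.comp cfs) : Continuous fun z : (RR) × ℝ => (z.2, z.1.1)))
  refine h1.congr fun z => ?_
  exact isl (hi _ _ _) (hi _ _ _)

include hmass hP hμ hq in
lemma BF_open {α0 β0 N ρs s t y : ℝ} (h0 : 0 ≤ α0) (hρs : 0 < ρs)
    (hL : ∀ t ∈ Ioo α0 β0, LipAt sol N t) (hs : s ∈ Ioo α0 β0) (ht : t ∈ Ioo α0 β0) (hst : s ≤ t)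
    (hy : y ∈ UI) :
    zH sol ρs t y - zH sol ρs s y + ∫ r in s..t, gp P (lτ sol r y) =
    zH sol ρs t (1/2) - zH sol ρs s (1/2) + ∫ r in s..t, gp P (lτ sol r (1/2)) := by
  obtain ⟨α1, a1, a2⟩ := exists_between hs.1
  obtain ⟨α, a3, a4⟩ := exists_between a2
  obtain ⟨β1, b1, b2⟩ := exists_between ht.2
  obtain ⟨β, b3, b4⟩ := exists_between b1
  obtain ⟨L, D⟩ := LD_sol sol hmass h0 a1 (by linarith : α1 < β1) b2 hL
  have hpc : Continuous fun y => ∫ r in s..t, gp P (lτ sol r y) :=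
    (pint_cont sol hP).comp (continuous_const.prodMk continuous_id : Continuous fun y : ℝ => ((s, t), y))
  have cH : ∀ r, Continuous (zH sol ρs r) := fun r => slice_right (zH_cont sol hμ hρs) r
  refine const_weak (Δ := fun y => zH sol ρs t y - zH sol ρs s y + ∫ r in s..t, gp P (lτ sol r y))
    (((cH t).sub (cH s)).add hpc) ?_ hy
  rintro δ φ φ' φ'' hδ ⟨p1, p2, p3, p4, p5, p6⟩
  have g := Gam_const sol hmass hP hμ hq h0 a1 b2 hρs hL D a3 (by linarith : α < β) b4 hδ p1 p2 p3 p4 p5 p6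
    (s := s) (t := t) ⟨a4, by linarith⟩ ⟨by linarith, b3⟩ hst
  have n0 : Zr ∉ Icc δ (1 - δ) := fun h => by linarith [h.1]
  have n1 : (1:ℝ) ∉ Icc δ (1 - δ) := fun h => by linarith [h.2]
  have i1 : (1:ℝ) ∈ UI := by simp
  have hφ'c : Continuous φ' := cif fun y => (p2 y).continuousAt
  have ib : ∀ r, ∫ y in Zr..1, φ y * lV sol r y = - ∫ y in Zr..1, φ' y * ∫ z in Zr..y, lV sol r z := fun r => by
    have := (C1I.of_deriv p1 hφ'c.co).ibp (C1I.of_int (slice_right (lV_cont sol) r).co) i1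
    rw [this, p5 0 n0, p5 1 n1]; ring
  have hVc : ∀ r, Continuous fun y => ∫ z in Zr..y, lV sol r z := fun r =>
    slice_right (f := fun r y => ∫ z in Zr..y, lV sol r z) (par_cont (lV_cont sol)) r
  have hkc : ∀ r, Continuous fun y => gk μ ρs (lτ sol r y) := fun r =>
    slice_right (f := fun r y => gk μ ρs (lτ sol r y)) (gkl_cont sol hμ hρs) r
  have jV : ∀ r, II (fun y => φ' y * ∫ z in Zr..y, lV sol r z) volume 0 1 := fun r =>
    (hφ'c.mul (hVc r)).ii _ _
  have jk : ∀ r, II (fun y => φ' y * gk μ ρs (lτ sol r y)) volume 0 1 := fun r =>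
    (hφ'c.mul (hkc r)).ii _ _
  have jP : II (fun y => φ' y * ∫ r in s..t, gp P (lτ sol r y)) volume 0 1 :=
    (hφ'c.mul hpc).ii _ _
  have eH : ∀ r, (∫ y in Zr..1, φ y * lV sol r y) - (∫ y in Zr..1, φ' y * gk μ ρs (lτ sol r y)) =
      - ∫ y in Zr..1, φ' y * zH sol ρs r y := fun r => by
    rw [ib r]
    unfold zH
    simp only [mul_add]
    rw [iad (jV r) (jk r)]
    ring
  rw [eH, eH] at g
  have sw : ∫ r in s..t, ∫ y in Zr..1, φ' y * gp P (lτ sol r y) = ∫ y in Zr..1, φ' y * ∫ r in s..t, gp P (lτ sol r y) := by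
    rw [MeasureTheory.intervalIntegral_intervalIntegral_swap]
    · congr 1; ext y
      rw [icm]
    · have : Continuous (Function.uncurry fun r y => φ' y * gp P (lτ sol r y)) :=
        (hφ'c.comp csn).mul (lG_cont sol (gp_cd hP))
      exact (this.co.integrableOn_compact (isCompact_uIcc.prod isCompact_uIcc)).mono_set
        (prod_mono ouc ouc)
  rw [sw] at g
  have j : ∀ r, II (fun y => φ' y * zH sol ρs r y) volume 0 1 := fun r =>
    (hφ'c.mul (cH r)).ii _ _
  simp only [mul_add, mul_sub]
  rw [iad ((j t).sub (j s)) jP,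
    isb (j t) (j s), ← g]
  ring
end

lemma mvt_Icc {f f' : FF} {p q : ℝ} (hf : ∀ x ∈ Icc p q, HD f (f' x) x) {x0 x1 : ℝ}
    (h0 : x0 ∈ Icc p q) (h1 : x1 ∈ Icc p q) : ∃ ζ ∈ Icc p q, f x1 - f x0 = f' ζ * (x1 - x0) := by
  have main : ∀ x0 ∈ Icc p q, ∀ x1 ∈ Icc p q, x0 < x1 → ∃ ζ ∈ Icc p q, f x1 - f x0 = f' ζ * (x1 - x0) := by
    intro x0 h0 x1 h1 h
    have hs : ∀ x ∈ Icc x0 x1, x ∈ Icc p q := fun x hx => ⟨h0.1.trans hx.1, hx.2.trans h1.2⟩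
    obtain ⟨c, hc, e⟩ := exists_hasDerivAt_eq_slope f f' h (fun x hx => (hf x (hs x hx)).cw)
      (fun x hx => hf x (hs x (occ hx)))
    refine ⟨c, hs c (occ hc), ?_⟩
    rw [e]
    have : x1 - x0 ≠ 0 := by linarith
    field_simp
  rcases lt_trichotomy x0 x1 with h | h | h
  · exact main x0 h0 x1 h1 h
  · exact ⟨x0, h0, by rw [h]; simp⟩
  · obtain ⟨c, hc, e⟩ := main x1 h1 x0 h0 h
    exact ⟨c, hc, by linarith⟩

lemma damp {B g : FF} {c d M : ℝ} (hB : Continuous B)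
    (h : ∀ s ∈ Icc c d, ∀ t ∈ Icc c d, s ≤ t → B t - B s = - ∫ r in s..t, g r)
    (hpos : ∀ t ∈ Icc c d, M < B t → 0 ≤ g t) (h0 : B c ≤ M) : ∀ t ∈ Icc c d, B t ≤ M := by
  intro t ht
  by_contra hlt
  push Not at hlt
  have hcl : IsCompact (Icc c t ∩ {s | B s ≤ M}) :=
    isCompact_Icc.inter_right (isClosed_le hB ccn)
  obtain ⟨s, ⟨⟨s1, s2⟩, s3⟩, smax⟩ := hcl.exists_isGreatest ⟨c, ⟨le_rfl, ht.1⟩, h0⟩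
  have key := h s ⟨s1, s2.trans ht.2⟩ t ht s2
  have : 0 ≤ ∫ r in s..t, g r := by
    rw [intervalIntegral.integral_of_le s2]
    refine setIntegral_nonneg measurableSet_Ioc fun r hr => hpos r ⟨by linarith [hr.1], hr.2.trans ht.2⟩ ?_
    by_contra hc
    push Not at hc
    have := smax ⟨⟨by linarith [hr.1], hr.2⟩, hc⟩
    linarith [hr.1]
  have s3' : B s ≤ M := s3
  linarith

section
variable {P μ : FF} {Pext : ℝ} (sol : PistonSol P μ Pext)
  (hmass : ∀ t, 0 ≤ t → (∫ x in sol.a t..sol.b t, sol.ρ t x) = 1)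
variable (hP : ContDiffOn ℝ 2 P (Ioi 0)) (hμ : ContDiffOn ℝ 2 μ (Ioi 0)) (hq : ∀ x, 0 < x → 0 < μ x)

def LB (c d : ℝ) : Prop := ∀ s t, c < s → s ≤ t → t < d → ∃ N, ∀ r ∈ Icc s t, LipAt sol N r

include hmass hP hμ hq in
lemma BF {c d ρs s t y : ℝ} (h0 : 0 ≤ c) (hcd : c < d) (hρs : 0 < ρs) (hL : LB sol c d)
    (hs : s ∈ Icc c d) (ht : t ∈ Icc c d) (hy : y ∈ UI) :
    zH sol ρs t y - zH sol ρs s y + ∫ r in s..t, gp P (lτ sol r y) =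
    zH sol ρs t (1/2) - zH sol ρs s (1/2) + ∫ r in s..t, gp P (lτ sol r (1/2)) := by
  have main : ∀ s ∈ Ioo c d, ∀ t ∈ Ioo c d, s ≤ t → 
    zH sol ρs t y - zH sol ρs s y + ∫ r in s..t, gp P (lτ sol r y) =
    zH sol ρs t (1/2) - zH sol ρs s (1/2) + ∫ r in s..t, gp P (lτ sol r (1/2)) := by
    intro s hs t ht hst
    obtain ⟨s', a1, a2⟩ := exists_between hs.1
    obtain ⟨t', b1, b2⟩ := exists_between ht.2
    obtain ⟨N, hN⟩ := hL s' t' a1 (by linarith) b2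
    exact BF_open sol hmass hP hμ hq (α0 := s') (β0 := t') (h0.trans a1.le) hρs
      (fun r hr => hN r (occ hr)) ⟨a2, by linarith⟩ ⟨by linarith, b1⟩ hst hy
  have main2 : Ioo c d ×ˢ Ioo c d ⊆ {z : RR | 
    zH sol ρs z.2 y - zH sol ρs z.1 y + ∫ r in z.1..z.2, gp P (lτ sol r y) =
    zH sol ρs z.2 (1/2) - zH sol ρs z.1 (1/2) + ∫ r in z.1..z.2, gp P (lτ sol r (1/2))} := by
    rintro ⟨s, t⟩ ⟨hs, ht⟩
    simp only [mem_setOf_eq]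
    rcases le_total s t with h | h
    · exact main s hs t ht h
    · have := main t ht s hs h
      rw [intervalIntegral.integral_symm t s, intervalIntegral.integral_symm t s]
      linarith
  have cz : ∀ y, Continuous fun t => zH sol ρs t y := fun y => slice_left (zH_cont sol hμ hρs) y
  have cp : ∀ y, Continuous fun z : RR => ∫ r in z.1..z.2, gp P (lτ sol r y) := fun y =>
    (pint_cont sol hP).comp (continuous_id.prodMk ccn : Continuous fun z : RR => (z, y))
  have := closure_minimal main2 (isClosed_eq
    ((((cz _).comp csn).sub ((cz _).comp cfs)).add (cp _))
    ((((cz _).comp csn).sub ((cz _).comp cfs)).add (cp _)))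
  rw [closure_prod_eq, closure_Ioo hcd.ne] at this
  exact this (mk_mem_prod hs ht)

lemma win_bd (c0 c1 : ℝ) : ∃ r0 r1 S, 0 < r0 ∧ r0 ≤ r1 ∧ 0 < S ∧ ∀ t ∈ Icc c0 c1, ∀ x, 
    eR sol t x ∈ Icc r0 r1 ∧ |eV sol t x| ≤ S := by
  obtain ⟨m, hm⟩ := isCompact_Icc.ebc (s := Icc c0 c1) (eA_cont sol).co
  obtain ⟨M, hM⟩ := isCompact_Icc.ebc (s := Icc c0 c1) (eB_cont sol).co
  have hK : IsCompact (Icc c0 c1 ×ˢ Icc (-m) M) := isCompact_Icc.prod isCompact_Icc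
  obtain ⟨S, hS⟩ := hK.ebc (eV_cont sol).co
  obtain ⟨r1, hr1⟩ := hK.ebc (eR_cont sol).co
  obtain ⟨r0, hr0⟩ := hK.ebc
    ((eR_cont sol).inv₀ (fun z => (eR_pos sol z.1 z.2).ne')).co
  have e : ∀ t ∈ Icc c0 c1, ∀ x, (t, ecl sol t x) ∈ Icc c0 c1 ×ˢ Icc (-m) M ∧ 
      eR sol t x = eR sol t (ecl sol t x) ∧ eV sol t x = eV sol t (ecl sol t x) := fun t ht x => by
    have h1 := ecl_mem sol t x
    have h2 := (abs_le.1 (hm t ht)).1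
    have h3 := (abs_le.1 (hM t ht)).2
    refine ⟨⟨ht, ⟨by linarith [h1.1], by linarith [h1.2]⟩⟩, ?_, ?_⟩
    · unfold eR; rw [ecl_eq sol h1]
    · unfold eV; rw [ecl_eq sol h1]
  have p : 0 < max r0 1 := lt_max_of_lt_right one_pos
  have q : 0 < max S 1 := lt_max_of_lt_right one_pos
  refine ⟨(max r0 1)⁻¹, max r1 (max r0 1)⁻¹, max S 1, inv_pos.2 p, lmr _ _, q, fun t ht x => ?_⟩
  obtain ⟨h1, h2, h3⟩ := e t ht x
  have i1 := hS _ h1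
  have i2 := hr1 _ h1
  have i3 := hr0 _ h1
  simp only [nea] at i1 i2 i3
  rw [h2, h3]
  have pp := eR_pos sol t (ecl sol t x)
  refine ⟨⟨?_, (las _).trans (i2.trans (lml _ _))⟩, i1.trans (lml _ _)⟩
  rw [inv_le_comm₀ p pp]
  exact (las _).trans (i3.trans (lml _ _))

end

lemma lτi {P μ : FF} {Pext : ℝ} (sol : PistonSol P μ Pext) (t y : ℝ) : (lτ sol t y)⁻¹ = eR sol t (eX sol t y) := by
  unfold lτ; rw [inv_inv]

lemma kf_bilip {μ : FF} (hμ : CO μ (Ioi 0)) (hq : ∀ x, 0 < x → 0 < μ x) {ρs r0 r1 : ℝ}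
    (hρs : 0 < ρs) (h0 : 0 < r0) (h1 : r0 ≤ r1) : ∃ m M, 0 < m ∧ 0 < M ∧ ∀ x1 ∈ Icc r0 r1, ∀ x2 ∈ Icc r0 r1,
      ∃ q ∈ Icc m M, kf μ ρs x2 - kf μ ρs x1 = q * (x2 - x1) := by
  have hsub : Icc r0 r1 ⊆ Ioi 0 := fun x hx => h0.trans_le hx.1
  have hc : CO (fun x => μ x / x) (Icc r0 r1) :=
    (hμ.mono hsub).div continuousOn_id (fun x hx => ne_of_gt (hsub hx))
  obtain ⟨z, hz, hmin⟩ := isCompact_Icc.exists_isMinOn (nonempty_Icc.2 h1) hc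
  obtain ⟨w, hw, hmax⟩ := isCompact_Icc.exists_isMaxOn (nonempty_Icc.2 h1) hc
  have pp : ∀ x ∈ Icc r0 r1, 0 < μ x / x := fun x hx => div_pos (hq x (hsub hx)) (hsub hx)
  refine ⟨μ z / z, μ w / w, pp z hz, pp w hw, fun x1 m1 x2 m2 => ?_⟩
  obtain ⟨ζ, hζ, e⟩ := mvt_Icc (f := kf μ ρs) (f' := fun x => μ x / x) (fun x hx => kf_deriv hμ hρs (hsub hx)) m1 m2
  exact ⟨μ ζ / ζ, ⟨hmin hζ, hmax hζ⟩, e⟩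

section
variable {P μ : FF} {Pext : ℝ} (sol : PistonSol P μ Pext)
  (hmass : ∀ t, 0 ≤ t → (∫ x in sol.a t..sol.b t, sol.ρ t x) = 1)
variable (hP : ContDiffOn ℝ 2 P (Ioi 0)) (hμ : ContDiffOn ℝ 2 μ (Ioi 0)) (hq : ∀ x, 0 < x → 0 < μ x)
  (hPm : MonotoneOn P (Ioi 0))

include hmass hP hμ hq hPm in
lemma rho_prop {c0 c1 N1 ρs : ℝ} (hρs : 0 < ρs) (hc0 : 0 ≤ c0) (hN1 : 0 ≤ N1) : ∃ N2, 0 ≤ N2 ∧ ∀ c d, c0 ≤ c → c < d → d ≤ c1 →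
    LipAt sol N1 c → LB sol c d → ∀ t ∈ Icc c d, ∀ x1 x2, |eR sol t x1 - eR sol t x2| ≤ N2 * |x1 - x2| := by
  obtain ⟨r0, r1, S, h0, h01, hS, hw⟩ := win_bd sol c0 c1
  obtain ⟨m, M, hm, hM, hk⟩ := kf_bilip hμ.co hq hρs h0 h01
  have hr1 : 0 < r1 := h0.trans_le h01
  set C := S + M * (N1 * r0⁻¹) with hC
  have hCS : S ≤ C := by rw [hC]; have : 0 ≤ M * (N1 * r0⁻¹) := by positivity
                         linarith
  refine ⟨(C + S) * r1 / m, by have := hS.le.trans hCS; positivity, ?_⟩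
  intro c d hc hcd hd hLc hLB
  have win : ∀ t ∈ Icc c d, t ∈ Icc c0 c1 := fun t ht => ⟨hc.trans ht.1, ht.2.trans hd⟩
  have hcm : c ∈ Icc c d := ⟨le_rfl, hcd.le⟩
  have iV : ∀ t ∈ Icc c d, ∀ y1 y2, |(∫ z in Zr..y2, lV sol t z) - ∫ z in Zr..y1, lV sol t z| ≤ S * |y2 - y1| := by
    intro t ht y1 y2
    have hi : ∀ a b, II (lV sol t) volume a b := fun a b =>
      (slice_right (lV_cont sol) t).ii _ _
    rw [isl (hi _ _) (hi _ _)]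
    exact intervalIntegral.norm_integral_le_of_norm_le_const (f := lV sol t) (C := S) (a := y1) (b := y2) fun z _ => (hw t (win t ht) (eX sol t z)).2
  have hgk : ∀ t y, gk μ ρs (lτ sol t y) = kf μ ρs (eR sol t (eX sol t y)) := fun t y => by
    unfold gk; rw [lτi]
  have hgp : ∀ t y, gp P (lτ sol t y) = P (eR sol t (eX sol t y)) := fun t y => by
    unfold gp; rw [lτi]
  have hzH : ∀ t ∈ Icc c d, ∀ y1 y2, |zH sol ρs t y2 - zH sol ρs t y1 -
      (kf μ ρs (eR sol t (eX sol t y2)) - kf μ ρs (eR sol t (eX sol t y1)))| ≤ S * |y2 - y1| := by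
    intro t ht y1 y2
    have := iV t ht y1 y2
    unfold zH
    rw [hgk, hgk]
    convert this using 2
    ring
  have main : ∀ y1 ∈ UI, ∀ y2 ∈ UI, ∀ t ∈ Icc c d, zH sol ρs t y2 - zH sol ρs t y1 ≤ C * |y2 - y1| := by
    intro y1 m1 y2 m2
    have cz : ∀ y, Continuous fun t => zH sol ρs t y := fun y => slice_left (zH_cont sol hμ hρs) y
    have cp : ∀ y, Continuous fun t => gp P (lτ sol t y) := fun y =>
      slice_left (f := fun t y => gp P (lτ sol t y)) (lG_cont sol (gp_cd hP)) y
    refine damp (g := fun t => gp P (lτ sol t y2) - gp P (lτ sol t y1)) ((cz y2).sub (cz y1)) ?_ ?_ ?_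
    · intro s hs t ht hst
      have e1 := BF sol hmass hP hμ hq (hc0.trans hc) hcd hρs hLB hs ht m1
      have e2 := BF sol hmass hP hμ hq (hc0.trans hc) hcd hρs hLB hs ht m2
      rw [isb ((cp y2).ii _ _) ((cp y1).ii _ _)]
      linarith
    · intro t ht hlt
      have e1 := (abs_le.1 (hzH t ht y1 y2)).2
      have e2 : S * |y2 - y1| ≤ C * |y2 - y1| := mlr hCS (ann _)
      obtain ⟨q, hq, e⟩ := hk _ (hw t (win t ht) (eX sol t y1)).1 _ (hw t (win t ht) (eX sol t y2)).1
      have e3 : 0 < q * (eR sol t (eX sol t y2) - eR sol t (eX sol t y1)) := by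
        rw [← e]; linarith
      have e4 := (pos_iff_pos_of_mul_pos e3).1 (hm.trans_le hq.1)
      rw [hgp, hgp, sub_nonneg]
      exact hPm (eR_pos sol _ _) (eR_pos sol _ _) (by linarith)
    · have e1 := (abs_le.1 (hzH c hcm y1 y2)).2
      obtain ⟨q, hq, e⟩ := hk _ (hw c (win c hcm) (eX sol c y1)).1 _ (hw c (win c hcm) (eX sol c y2)).1
      have e2 := (hLc (eX sol c y2) (eX sol c y1)).1
      obtain ⟨ζ, _, e3⟩ := mvt_uIcc (eX_deriv sol c) y1 y2
      have e4 : |eX sol c y2 - eX sol c y1| ≤ r0⁻¹ * |y2 - y1| := by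
        rw [e3, abs_mul]
        refine mlr ?_ (ann _)
        rw [abs_of_pos (inv_pos.2 (eR_pos sol _ _))]
        exact inv_anti₀ h0 (hw c (win c hcm) _).1.1
      have e5 : kf μ ρs (eR sol c (eX sol c y2)) - kf μ ρs (eR sol c (eX sol c y1)) ≤ M * (N1 * (r0⁻¹ * |y2 - y1|)) := by
        rw [e]
        refine (las _).trans ?_
        rw [abs_mul, abs_of_pos (hm.trans_le hq.1)]
        exact mul_le_mul hq.2 (e2.trans (mll e4 hN1)) (ann _) hM.le
      have e6 : C * |y2 - y1| = S * |y2 - y1| + M * (N1 * (r0⁻¹ * |y2 - y1|)) := by rw [hC]; ring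
      linarith
  intro t ht x1 x2
  have ex : ∀ x, eR sol t x = eR sol t (ecl sol t x) := fun x => by
    unfold eR; rw [ecl_eq sol (ecl_mem sol t x)]
  rw [ex x1, ex x2]
  have L := ecl_lip sol t x1 x2
  set z1 := ecl sol t x1
  set z2 := ecl sol t x2
  have n1 : eY sol t z1 ∈ UI := eY_mem sol hmass (ecl_mem sol t x1)
  have n2 : eY sol t z2 ∈ UI := eY_mem sol hmass (ecl_mem sol t x2)
  have j1 := main _ n1 _ n2 t ht
  have j2 := main _ n2 _ n1 t ht
  have j3 := abs_le.1 (hzH t ht (eY sol t z1) (eY sol t z2))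
  simp only [eXY] at j3
  rw [asc] at j2
  obtain ⟨q, hq, e⟩ := hk _ (hw t (win t ht) z1).1 _ (hw t (win t ht) z2).1
  obtain ⟨ζ, _, e3⟩ := mvt_uIcc (eY_deriv sol t) z1 z2
  have e4 : |eY sol t z2 - eY sol t z1| ≤ r1 * |x1 - x2| := by
    rw [e3, abs_mul, asc z2]
    refine mul_le_mul ?_ L (ann _) hr1.le
    rw [abs_of_pos (eR_pos sol _ _)]
    exact (hw t (win t ht) _).1.2
  have e5 : |kf μ ρs (eR sol t z2) - kf μ ρs (eR sol t z1)| ≤ (C + S) * |eY sol t z2 - eY sol t z1| := by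
    rw [abs_le]; constructor <;> linarith
  have e6 : (C + S) * |eY sol t z2 - eY sol t z1| ≤ (C + S) * (r1 * |x1 - x2|) :=
    mll e4 (by linarith)
  rw [e, abs_mul, abs_of_pos (hm.trans_le hq.1)] at e5
  have e7 : m * |eR sol t z2 - eR sol t z1| ≤ q * |eR sol t z2 - eR sol t z1| :=
    mlr hq.1 (ann _)
  rw [asc]
  have e8 : (C + S) * r1 / m * |x1 - x2| = ((C + S) * (r1 * |x1 - x2|)) / m := by ring
  rw [e8, le_div_iff₀ hm]
  linarith
end

lemma omega_ex {K κ R : ℝ} (hK : 0 ≤ K) (hκ : 0 < κ) (hR : 0 ≤ R) : ∃ ω ω' ω'' : FF, ∃ K' ≥ 0,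
    (∀ r, HD ω (ω' r) r) ∧ (∀ r, HD ω' (ω'' r) r) ∧ (∀ r, ω'' r = - κ * (ω' r + 1)) ∧
    (∀ r ∈ Icc 0 R, K ≤ ω' r ∧ K * r ≤ ω r ∧ ω r ≤ K' * r) := by
  have hlin : ∀ r : ℝ, HD (fun r => κ * (R - r)) (-κ) r := fun r => by
    refine (((hasDerivAt_id' r).const_sub R).const_mul κ).cg (fun _ => rfl) (by ring)
  refine ⟨fun r => (K + 1) * (Real.exp (κ * R) - Real.exp (κ * (R - r))) / κ - r,
    fun r => (K + 1) * Real.exp (κ * (R - r)) - 1, fun r => - κ * ((K + 1) * Real.exp (κ * (R - r)) - 1 + 1),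
    (K + 1) * Real.exp (κ * R), by positivity, fun r => ?_, fun r => ?_, fun r => rfl, fun r hr => ⟨?_, ?_, ?_⟩⟩
  · have := ((((hlin r).exp.const_sub (Real.exp (κ * R))).const_mul (K + 1)).div_const κ).sub (hasDerivAt_id' r)
    refine this.cg (fun _ => rfl) ?_
    field_simp
  · have := ((hlin r).exp.const_mul (K + 1)).sub_const 1
    refine this.cg (fun _ => rfl) ?_
    ring
  · have : 1 ≤ Real.exp (κ * (R - r)) := Real.one_le_exp (mul_nonneg hκ.le (by linarith [hr.2]))
    simp only
    have := mll this (by linarith : 0 ≤ K + 1)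
    linarith
  · have e1 : 1 ≤ Real.exp (κ * (R - r)) := Real.one_le_exp (mul_nonneg hκ.le (by linarith [hr.2]))
    have e2 : Real.exp (κ * R) = Real.exp (κ * (R - r)) * Real.exp (κ * r) := by rw [← Real.exp_add]; congr 1; ring
    have e3 := Real.add_one_le_exp (κ * r)
    have e4 : κ * r ≤ Real.exp (κ * R) - Real.exp (κ * (R - r)) := by
      have : 1 * (κ * r) ≤ Real.exp (κ * (R - r)) * (Real.exp (κ * r) - 1) :=
        mul_le_mul e1 (by linarith) (mul_nonneg hκ.le hr.1) (by positivity)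
      rw [e2]; linarith
    have e5 : (K + 1) * r ≤ (K + 1) * (Real.exp (κ * R) - Real.exp (κ * (R - r))) / κ := by
      rw [le_div_iff₀ hκ]
      have := mll e4 (by linarith : 0 ≤ K + 1)
      linarith
    simp only
    linarith
  · have e2 : Real.exp (κ * (R - r)) = Real.exp (κ * R) * Real.exp (-(κ * r)) := by rw [← Real.exp_add]; congr 1; ring
    have e3 := Real.add_one_le_exp (-(κ * r))
    have e4 : Real.exp (κ * R) - Real.exp (κ * (R - r)) ≤ Real.exp (κ * R) * (κ * r) := by
      rw [e2]
      have := mll e3 (Real.exp_pos (κ * R)).le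
      linarith
    have e5 : (K + 1) * (Real.exp (κ * R) - Real.exp (κ * (R - r))) / κ ≤ (K + 1) * Real.exp (κ * R) * r := by
      rw [div_le_iff₀ hκ]
      have := mll e4 (by linarith : 0 ≤ K + 1)
      linarith
    simp only
    linarith [hr.1]

lemma der_left {h : FF} {l b : ℝ} (hd : HD h l b) (hm : ∀ᶠ x in 𝓝[<] b, h x ≤ h b) : 0 ≤ l := by
  have := (hasDerivAt_iff_tendsto_slope_left_right.1 hd).1
  refine ge_of_tendsto this ?_
  filter_upwards [hm, smn] with x hx hx'
  rw [slope_def_field]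
  exact div_nonneg_of_nonpos (by linarith) (by have : x < b := hx'; linarith)

lemma der_right {h : FF} {l b : ℝ} (hd : HD h l b) (hm : ∀ᶠ x in 𝓝[>] b, h x ≤ h b) : l ≤ 0 := by
  have := (hasDerivAt_iff_tendsto_slope_left_right.1 hd).2
  refine le_of_tendsto this ?_
  filter_upwards [hm, smn] with x hx hx'
  rw [slope_def_field]
  exact div_nonpos_of_nonpos_of_nonneg (by linarith) (by have : b < x := hx'; linarith)

lemma sd_test {f f1 : FF} {x l : ℝ} (hf : ∀ᶠ y in 𝓝 x, HD f (f1 y) y)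
    (hf1 : HD f1 l x) (hm : ∀ᶠ y in 𝓝 x, f y ≤ f x) : l ≤ 0 := by
  refine le_of_tendsto (sd_lemma hf hf1) ?_
  have t1 : Tendsto (fun h : ℝ => x + h) (𝓝[>] 0) (𝓝 x) := by
    have : Continuous (fun h : ℝ => x + h) := by fun_prop
    exact (by simpa using this.tendsto 0 : Tendsto (fun h : ℝ => x + h) (𝓝 0) (𝓝 x)).mono_left nwn
  have t2 : Tendsto (fun h : ℝ => x - h) (𝓝[>] 0) (𝓝 x) := by
    have : Continuous (fun h : ℝ => x - h) := by fun_prop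
    exact (by simpa using this.tendsto 0 : Tendsto (fun h : ℝ => x - h) (𝓝 0) (𝓝 x)).mono_left nwn
  filter_upwards [t1.eventually hm, t2.eventually hm] with h h1 h2
  exact div_nonpos_of_nonpos_of_nonneg (by linarith) (by positivity)

lemma inner_alg {ρ T A q B V D s e w κ S C r1 μ0 : ℝ} (hρ : 0 < ρ) (hr : ρ ≤ r1) (hA : μ0 ≤ A)
    (hB : |B| ≤ C) (hD : |D| ≤ C) (hs : |s| = 1) (he : |e| = 1) (hw : 0 ≤ w) (hsV : s * V = w)
    (hκ : 0 ≤ κ) (hS : 0 ≤ S) (hq : e * s * q ≤ - κ * (w + 1)) (hk : C + 2 * S * r1 ≤ μ0 * κ) (hμ0 : 0 < μ0)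
    (h : ρ * T = A * q + B * V - D) : e * s * T ≤ - (2 * S * (w + 1)) := by
  have h1 : ρ * (e * s * T) = A * (e * s * q) + e * B * w - e * s * D := by
    rw [← hsV]; linear_combination (e * s) * h
  have h2 : A * (e * s * q) ≤ - (μ0 * κ * (w + 1)) := by
    have : A * (e * s * q) ≤ A * (- κ * (w + 1)) := mll hq (by linarith)
    have h3 : μ0 * (κ * (w + 1)) ≤ A * (κ * (w + 1)) := mlr hA (by positivity)
    linarith
  have h4 : e * B * w ≤ C * w := by
    refine mlr ((las _).trans ?_) hw
    rw [abs_mul, he, one_mul]; exact hB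
  have h5 : - (e * s * D) ≤ C := by
    refine (neg_le_abs _).trans ?_
    rw [abs_mul, abs_mul, he, hs, one_mul, one_mul]; exact hD
  have h6 : (C + 2 * S * r1) * (w + 1) ≤ μ0 * κ * (w + 1) := mlr hk (by linarith)
  have h7 : 2 * S * (w + 1) * ρ ≤ 2 * S * (w + 1) * r1 := mll hr (by positivity)
  have h8 : ρ * (e * s * T) ≤ ρ * (- (2 * S * (w + 1))) := by linarith
  exact le_of_mul_le_mul_left h8 hρ

section
variable {P μ : FF} {Pext : ℝ} (sol : PistonSol P μ Pext)
variable (hP : ContDiffOn ℝ 2 P (Ioi 0)) (hμ : ContDiffOn ℝ 2 μ (Ioi 0)) (hq : ∀ x, 0 < x → 0 < μ x)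

include hP hμ hq in
lemma vxx_ex {t x : ℝ} (ht : 0 < t) (hx : x ∈ Ioo (sol.a t) (sol.b t)) : ∃ q, HD (sol.vx t) q x ∧
    sol.ρ t x * (sol.vt t x + sol.v t x * sol.vx t x) = μ (sol.ρ t x) * q +
      (deriv μ (sol.ρ t x) * sol.ρx t x) * sol.vx t x - deriv P (sol.ρ t x) * sol.ρx t x := by
  have hx' := occ hx
  have hp := sol.ρ_pos t ht.le x hx'
  have dρ := sol.hρx t ht.le x hx'
  have dμ : HD (fun y => μ (sol.ρ t y)) (deriv μ (sol.ρ t x) * sol.ρx t x) x :=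
    HasDerivAt.comp x ((cd2 hμ).1 _ hp) dρ
  have dP : HD (fun y => P (sol.ρ t y)) (deriv P (sol.ρ t x) * sol.ρx t x) x :=
    HasDerivAt.comp x ((cd2 hP).1 _ hp) dρ
  have hm := hq _ hp
  have d := ((sol.momentum_eq t ht x hx).add dP).div dμ hm.ne'
  refine ⟨_, d.congr_of_eventuallyEq ?_, ?_⟩
  · filter_upwards [omn hx.1 hx.2] with y hy
    have := hq _ (sol.ρ_pos t ht.le y (occ hy))
    simp only [Pi.add_apply, Pi.div_apply]
    field_simp
    ring
  · simp only [Pi.add_apply]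
    field_simp
    ring

include hP hμ hq in
lemma pt_in {t x s e w κ S C r1 μ0 g'' : ℝ} {g g' : FF} (ht : 0 < t) (hx : x ∈ Ioo (sol.a t) (sol.b t))
    (hr : sol.ρ t x ≤ r1) (hA : μ0 ≤ μ (sol.ρ t x))
    (hB : |deriv μ (sol.ρ t x) * sol.ρx t x| ≤ C) (hD : |deriv P (sol.ρ t x) * sol.ρx t x| ≤ C)
    (hs : |s| = 1) (he : |e| = 1) (hw : 0 ≤ w)
    (hκ : 0 ≤ κ) (hS : 0 ≤ S) (hk : C + 2 * S * r1 ≤ μ0 * κ) (hμ0 : 0 < μ0)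
    (hg : ∀ y, HD g (g' y) y) (hg' : HD g' g'' x) (gw : g' x = e * w) (gw' : g'' = - κ * (w + 1))
    (hm : ∀ᶠ y in 𝓝 x, e * s * sol.v t y - g y ≤ e * s * sol.v t x - g x) :
    e * s * sol.vt t x ≤ - (sol.v t x * (e * w)) - 2 * S * (w + 1) := by
  obtain ⟨q, hq, E⟩ := vxx_ex sol hP hμ hq ht hx
  have d1 : ∀ᶠ y in 𝓝 x, HD (fun y => e * s * sol.v t y - g y) (e * s * sol.vx t y - g' y) y := by
    filter_upwards [omn hx.1 hx.2] with y hy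
    exact ((sol.hvx t ht y (occ hy)).const_mul (e * s)).sub (hg y)
  have d2 : HD (fun y => e * s * sol.vx t y - g' y) (e * s * q - g'') x := (hq.const_mul (e * s)).sub hg'
  have h1 : e * s * sol.vx t x - g' x = 0 := IsLocalMax.hasDerivAt_eq_zero hm d1.self_of_nhds
  have h2 := sd_test d1 d2 hm
  have he2 : e * e = 1 := by rw [← abs_mul_abs_self, he, one_mul]
  have h3 : s * sol.vx t x = w := by
    have : e * (e * s * sol.vx t x - g' x) = 0 := by rw [h1, mul_zero]
    rw [gw] at this
    linear_combination this - (s * sol.vx t x - w) * he2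
  have := inner_alg (sol.ρ_pos t ht.le x (occ hx)) hr hA hB hD hs he hw h3 hκ hS (by linarith) hk hμ0 E
  rw [← h3]
  rw [← h3] at this
  linarith
end

section
variable {P μ : FF} {Pext : ℝ} (sol : PistonSol P μ Pext)
variable (hP : ContDiffOn ℝ 2 P (Ioi 0)) (hμ : ContDiffOn ℝ 2 μ (Ioi 0)) (hq : ∀ x, 0 < x → 0 < μ x)

def PB (t C r1 μ0 : ℝ) : Prop := 
  (∀ x ∈ Ioo (sol.a t) (sol.b t), sol.ρ t x ≤ r1 ∧ |deriv μ (sol.ρ t x) * sol.ρx t x| ≤ C ∧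
    |deriv P (sol.ρ t x) * sol.ρx t x| ≤ C) ∧
  (∀ x ∈ Icc (sol.a t) (sol.b t), μ0 ≤ μ (sol.ρ t x) ∧ |P (sol.ρ t x) - Pext| + |sol.u t| ≤ C)

def PT (t x V z w σ e : ℝ) (ze : Prop) (S : ℝ) : Prop :=
  ∃ (p f : FF) (pe D θ : ℝ), HD p pe t ∧ HD f D t ∧ p t = x ∧ f t = V ∧
    (∀ᶠ τ in 𝓝 t, p τ ∈ Icc (eA sol τ) (eB sol τ) ∧ eV sol τ (p τ) = f τ) ∧
    e * (σ * D) - e * (w * pe) ≤ - (e * (w * V)) - θ ∧ 0 ≤ θ ∧ (ze → θ = 2 * S * (w + 1)) ∧ z = 0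

include hP hμ hq in
lemma PT_in {t x s e w κ S C r1 μ0 g'' : ℝ} {g g' : FF} {ze : Prop} (ht : 0 < t) (hx : x ∈ Ioo (sol.a t) (sol.b t))
    (hb : PB sol t C r1 μ0)
    (hs : |s| = 1) (he : |e| = 1) (hw : 0 ≤ w)
    (hκ : 0 ≤ κ) (hS : 0 ≤ S) (hk : C + 2 * S * r1 ≤ μ0 * κ) (hμ0 : 0 < μ0)
    (hg : ∀ y, HD g (g' y) y) (hg' : HD g' g'' x) (gw : g' x = e * w) (gw' : g'' = - κ * (w + 1))
    (hm : ∀ᶠ y in 𝓝 x, e * s * eV sol t y - g y ≤ e * s * eV sol t x - g x) :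
    PT sol t x (eV sol t x) 0 w s e ze S := by
  have hx' := occ hx
  have hm' : ∀ᶠ y in 𝓝 x, e * s * sol.v t y - g y ≤ e * s * sol.v t x - g x := by
    filter_upwards [hm, eV_evx sol ht.le hx] with y h1 h2
    rwa [h2, eV_eq sol ht.le hx'] at h1
  obtain ⟨b1, b2, b3⟩ := hb.1 x hx
  have := pt_in sol hP hμ hq ht hx b1 (hb.2 x hx').1 b2 b3 hs he hw hκ hS hk hμ0 hg hg' gw gw' hm'
  refine ⟨fun _ => x, fun τ => eV sol τ x, 0, sol.vt t x, 2 * S * (w + 1), hasDerivAt_const _ _, eV_dt sol ht hx, rfl, rfl,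
    ?_, ?_, by positivity, fun _ => rfl, rfl⟩
  · filter_upwards [dom_ev sol ht hx] with τ hτ
    rw [eA_eq sol hτ.1.le, eB_eq sol hτ.1.le]
    exact ⟨occ hτ.2, rfl⟩
  · rw [eV_eq sol ht.le hx']
    linarith

lemma PT_b {t x2 s w S C r1 μ0 : ℝ} {ω ω' : FF} {ze : Prop} (ht : 0 < t) (hx2 : x2 < sol.b t)
    (hx2a : sol.a t ≤ x2) (hb : PB sol t C r1 μ0) (hs : |s| = 1) (hμ0 : 0 < μ0) (hg : ∀ y, HD ω (ω' y) y)
    (hw : ω' (sol.b t - x2) = w) (hw0 : 0 ≤ w) (hC : C ≤ μ0 * w) (hze : ¬ ze)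
    (hm : ∀ y, x2 ≤ y → y ≤ sol.b t → s * eV sol t y - ω (y - x2) ≤ s * eV sol t (sol.b t) - ω (sol.b t - x2)) :
    PT sol t (sol.b t) (eV sol t (sol.b t)) 0 w s 1 ze S := by
  have mb : sol.b t ∈ Icc (sol.a t) (sol.b t) := ⟨(sol.hab t ht.le).le, le_rfl⟩
  have d : HD (fun y => s * sol.v t y - ω (y - x2)) (s * sol.vx t (sol.b t) - w) (sol.b t) := by
    have := ((sol.hvx t ht _ mb).const_mul s).sub ((hg (sol.b t - x2)).comp (sol.b t) ((hasDerivAt_id' (sol.b t)).sub_const x2))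
    exact this.cg (fun _ => rfl) (by rw [hw]; ring)
  have h1 := der_left d (by
    filter_upwards [Ioo_mem_nhdsLT hx2] with y hy
    have := hm y hy.1.le hy.2.le
    rwa [eV_eq sol ht.le mb, eV_eq sol ht.le ⟨hx2a.trans hy.1.le, hy.2.le⟩] at this)
  have hN := sol.newton_b t ht
  obtain ⟨b1, b2⟩ := hb.2 _ mb
  have h2 : s * sol.b'' t ≤ 0 := by
    have e1 : s * sol.b'' t = s * (P (sol.ρ t (sol.b t)) - Pext) - μ (sol.ρ t (sol.b t)) * (s * sol.vx t (sol.b t)) := by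
      rw [hN]; ring
    have e2 : s * (P (sol.ρ t (sol.b t)) - Pext) ≤ C := by
      refine (las _).trans ?_
      rw [abs_mul, hs, one_mul]
      linarith [ann (sol.u t)]
    have e3 : μ0 * w ≤ μ (sol.ρ t (sol.b t)) * (s * sol.vx t (sol.b t)) :=
      mul_le_mul b1 (by linarith) hw0 (by linarith)
    linarith
  have ev : ∀ᶠ τ in 𝓝 t, 0 < τ := lt_mem_nhds ht
  have hv : eV sol t (sol.b t) = sol.b' t := by rw [eV_eq sol ht.le mb, sol.bc_b t ht.le]
  refine ⟨eB sol, sol.b', sol.b' t, sol.b'' t, 0, eB_dt sol ht, sol.hb'' t ht, eB_eq sol ht.le, hv.symm,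
    ?_, ?_, le_rfl, fun h => (hze h).elim, rfl⟩
  · filter_upwards [ev] with τ hτ
    refine ⟨⟨(eAB sol τ).le, le_rfl⟩, ?_⟩
    rw [eB_eq sol hτ.le, eV_eq sol hτ.le ⟨(sol.hab τ hτ.le).le, le_rfl⟩, sol.bc_b τ hτ.le]
  · rw [hv]; linarith

lemma PT_a {t x1 s w S C r1 μ0 : ℝ} {ω ω' : FF} {ze : Prop} (ht : 0 < t) (hx1 : sol.a t < x1)
    (hx1b : x1 ≤ sol.b t) (hb : PB sol t C r1 μ0) (hs : |s| = 1) (hμ0 : 0 < μ0) (hg : ∀ y, HD ω (ω' y) y)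
    (hw : ω' (x1 - sol.a t) = w) (hw0 : 0 ≤ w) (hC : C ≤ μ0 * w) (hze : ¬ ze)
    (hm : ∀ y, sol.a t ≤ y → y ≤ x1 → -(s * eV sol t y) - ω (x1 - y) ≤ -(s * eV sol t (sol.a t)) - ω (x1 - sol.a t)) :
    PT sol t (sol.a t) (eV sol t (sol.a t)) 0 w s (-1) ze S := by
  have mb : sol.a t ∈ Icc (sol.a t) (sol.b t) := ⟨le_rfl, (sol.hab t ht.le).le⟩
  have d : HD (fun y => -(s * sol.v t y) - ω (x1 - y)) (-(s * sol.vx t (sol.a t)) + w) (sol.a t) := by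
    have := ((sol.hvx t ht _ mb).const_mul s).neg.sub ((hg (x1 - sol.a t)).comp (sol.a t) ((hasDerivAt_id' (sol.a t)).const_sub x1))
    exact this.cg (fun _ => rfl) (by rw [hw]; ring)
  have h1 := der_right d (by
    filter_upwards [Ioo_mem_nhdsGT hx1] with y hy
    have := hm y hy.1.le hy.2.le
    rwa [eV_eq sol ht.le mb, eV_eq sol ht.le ⟨hy.1.le, hy.2.le.trans hx1b⟩] at this)
  have hN := sol.newton_a t ht
  obtain ⟨b1, b2⟩ := hb.2 _ mb
  have h2 : -(s * sol.a'' t) ≤ 0 := by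
    have e1 : s * sol.a'' t = s * sol.u t - s * (P (sol.ρ t (sol.a t)) - Pext) + μ (sol.ρ t (sol.a t)) * (s * sol.vx t (sol.a t)) := by
      rw [hN]; ring
    have e2 : s * (P (sol.ρ t (sol.a t)) - Pext) ≤ |P (sol.ρ t (sol.a t)) - Pext| := by
      refine (las _).trans ?_
      rw [abs_mul, hs, one_mul]
    have e4 : -(s * sol.u t) ≤ |sol.u t| := by
      refine (neg_le_abs _).trans ?_
      rw [abs_mul, hs, one_mul]
    have e3 : μ0 * w ≤ μ (sol.ρ t (sol.a t)) * (s * sol.vx t (sol.a t)) :=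
      mul_le_mul b1 (by linarith) hw0 (by linarith)
    linarith
  have ev : ∀ᶠ τ in 𝓝 t, 0 < τ := lt_mem_nhds ht
  have hv : eV sol t (sol.a t) = sol.a' t := by rw [eV_eq sol ht.le mb, sol.bc_a t ht.le]
  refine ⟨eA sol, sol.a', sol.a' t, sol.a'' t, 0, eA_dt sol ht, sol.ha'' t ht, eA_eq sol ht.le, hv.symm,
    ?_, ?_, le_rfl, fun h => (hze h).elim, rfl⟩
  · filter_upwards [ev] with τ hτ
    refine ⟨⟨le_rfl, (eAB sol τ).le⟩, ?_⟩
    rw [eA_eq sol hτ.le, eV_eq sol hτ.le ⟨le_rfl, (sol.hab τ hτ.le).le⟩, sol.bc_a τ hτ.le]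
  · rw [hv]; linarith
end

section
variable {P μ : FF} {Pext : ℝ} (sol : PistonSol P μ Pext)
variable (hP : ContDiffOn ℝ 2 P (Ioi 0)) (hμ : ContDiffOn ℝ 2 μ (Ioi 0)) (hq : ∀ x, 0 < x → 0 < μ x)

include hP hμ hq in
lemma dbl {c d s κ S C r1 μ0 K R rm N1 : ℝ} {ω ω' ω'' : FF} (hc : 0 ≤ c) (hS : 0 < S)
    (hV : ∀ t ∈ Icc c d, ∀ x, |eV sol t x| ≤ S) (hb : ∀ t ∈ Icc c d, 0 < t → PB sol t C r1 μ0)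
    (hs : |s| = 1) (hκ : 0 ≤ κ) (hk : C + 2 * S * r1 ≤ μ0 * κ) (hμ0 : 0 < μ0)
    (o1 : ∀ r, HD ω (ω' r) r) (o2 : ∀ r, HD ω' (ω'' r) r) (o3 : ∀ r, ω'' r = - κ * (ω' r + 1))
    (o4 : ∀ r ∈ Icc 0 R, K ≤ ω' r ∧ K * r ≤ ω r) (hK : 0 ≤ K) (hR : ∀ t ∈ Icc c d, eB sol t - eA sol t ∈ Icc rm R)
    (hrm : 2 * S ≤ K * rm) (hCK : C ≤ μ0 * K) (hNK : N1 ≤ K) (hL : LipAt sol N1 c)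
    {t x1 x2 : ℝ} (ht : t ∈ Icc c d) (hx2 : eA sol t ≤ x2) (h12 : x2 ≤ x1) (hx1 : x1 ≤ eB sol t) :
    s * (eV sol t x1 - eV sol t x2) ≤ ω (x1 - x2) := by
  have oc : Continuous ω := cif fun r => (o1 r).continuousAt
  let F : ℝ × ℝ × ℝ → ℝ := fun z => s * (eV sol z.1 z.2.1 - eV sol z.1 z.2.2) - ω (z.2.1 - z.2.2)
  have Fc : Continuous F := by
    have v1 : Continuous fun z : ℝ × ℝ × ℝ => eV sol z.1 z.2.1 :=
      (eV_cont sol).comp (by fun_prop : Continuous fun z : ℝ × ℝ × ℝ => (z.1, z.2.1))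
    have v2 : Continuous fun z : ℝ × ℝ × ℝ => eV sol z.1 z.2.2 :=
      (eV_cont sol).comp (by fun_prop : Continuous fun z : ℝ × ℝ × ℝ => (z.1, z.2.2))
    have v3 : Continuous fun z : ℝ × ℝ × ℝ => ω (z.2.1 - z.2.2) := oc.comp (by fun_prop)
    exact (continuous_const.mul (v1.sub v2)).sub v3
  obtain ⟨m, hm⟩ := isCompact_Icc.ebc (s := Icc c d) (eA_cont sol).co
  obtain ⟨M, hM⟩ := isCompact_Icc.ebc (s := Icc c d) (eB_cont sol).co
  let KK : Set (ℝ × ℝ × ℝ) := {z | z.1 ∈ Icc c d ∧ eA sol z.1 ≤ z.2.2 ∧ z.2.2 ≤ z.2.1 ∧ z.2.1 ≤ eB sol z.1}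
  have hcomp : IsCompact KK := by
    have h1 : IsCompact (Icc c d ×ˢ (Icc (-m) M ×ˢ Icc (-m) M)) := isCompact_Icc.prod (isCompact_Icc.prod isCompact_Icc)
    have hA := eA_cont sol
    have hB := eB_cont sol
    refine h1.of_isClosed_subset ?_ ?_
    · have c1 : IsClosed {z : ℝ × ℝ × ℝ | z.1 ∈ Icc c d} := isClosed_Icc.preimage cfs
      have c2 : IsClosed {z : ℝ × ℝ × ℝ | eA sol z.1 ≤ z.2.2} := isClosed_le (by fun_prop) (by fun_prop)
      have c3 : IsClosed {z : ℝ × ℝ × ℝ | z.2.2 ≤ z.2.1} := isClosed_le (by fun_prop) (by fun_prop)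
      have c4 : IsClosed {z : ℝ × ℝ × ℝ | z.2.1 ≤ eB sol z.1} := isClosed_le (by fun_prop) (by fun_prop)
      exact c1.inter (c2.inter (c3.inter c4))
    · rintro ⟨t, x1, x2⟩ ⟨k1, k2, k3, k4⟩
      simp only at k1 k2 k3 k4
      have e1 := (abs_le.1 (hm t k1)).1
      have e2 := (abs_le.1 (hM t k1)).2
      exact ⟨k1, ⟨by simp only; linarith, by simp only; linarith⟩, ⟨by simp only; linarith, by simp only; linarith⟩⟩
  obtain ⟨⟨t0, y1, y2⟩, hz, hmax⟩ := hcomp.exists_isMaxOn ⟨(t, x1, x2), ht, hx2, h12, hx1⟩ Fc.co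
  have hmax' : ∀ τ q1 q2, τ ∈ Icc c d → eA sol τ ≤ q2 → q2 ≤ q1 → q1 ≤ eB sol τ →
      s * (eV sol τ q1 - eV sol τ q2) - ω (q1 - q2) ≤ s * (eV sol t0 y1 - eV sol t0 y2) - ω (y1 - y2) :=
    fun τ q1 q2 a b c d => hmax (show (τ, q1, q2) ∈ KK from ⟨a, b, c, d⟩)
  suffices h : s * (eV sol t0 y1 - eV sol t0 y2) - ω (y1 - y2) ≤ 0 by
    have := hmax' t x1 x2 ht hx2 h12 hx1
    linarith
  obtain ⟨k1, k2, k3, k4⟩ := hz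
  simp only at k1 k2 k3 k4
  by_contra hpos
  push Not at hpos
  have hrR : y1 - y2 ∈ Icc 0 R := ⟨by linarith, by linarith [(hR t0 k1).2]⟩
  obtain ⟨w1, w2⟩ := o4 _ hrR
  have t0c : c < t0 := by
    rcases eq_or_lt_of_le k1.1 with h | h
    · exfalso
      have e1 := (hL y1 y2).2
      rw [h] at e1
      have e2 : s * (eV sol t0 y1 - eV sol t0 y2) ≤ N1 * |y1 - y2| := by
        refine (las _).trans ?_
        rw [abs_mul, hs, one_mul]; exact e1
      rw [abs_of_nonneg hrR.1] at e2
      have e3 : N1 * (y1 - y2) ≤ K * (y1 - y2) := mlr hNK hrR.1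
      linarith
    · exact h
  have tp : 0 < t0 := hc.trans_lt t0c
  have k3' : y2 < y1 := by
    rcases eq_or_lt_of_le k3 with h | h
    · exfalso
      have := w2
      rw [h] at this hpos
      simp only [sub_self, mul_zero] at this hpos
      linarith
    · exact h
  have hPB := hb t0 k1 tp
  set w := ω' (y1 - y2) with hw
  have hw0 : 0 ≤ w := hK.trans w1
  have hCw : C ≤ μ0 * w := hCK.trans (mll w1 hμ0.le)
  rw [eA_eq sol tp.le] at k2
  rw [eB_eq sol tp.le] at k4
  have q1 : PT sol t0 y1 (eV sol t0 y1) 0 w s 1 (y1 < sol.b t0) S := by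
    have hm1 : ∀ y, y2 ≤ y → y ≤ sol.b t0 → s * eV sol t0 y - ω (y - y2) ≤ s * eV sol t0 y1 - ω (y1 - y2) := by
      intro y h1 h2
      have := hmax' t0 y y2 k1 (by rwa [eA_eq sol tp.le]) h1 (by rwa [eB_eq sol tp.le])
      linarith
    rcases eq_or_lt_of_le k4 with h | h
    · rw [h]; rw [h] at hm1 hw
      exact PT_b sol tp (by linarith) k2 hPB hs hμ0 o1 hw.symm hw0 hCw (lt_irrefl _) hm1
    · refine PT_in sol hP hμ hq (g := fun y => ω (y - y2)) (g' := fun y => ω' (y - y2)) (g'' := ω'' (y1 - y2))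
        tp ⟨by linarith, h⟩ hPB hs (by simp) hw0 hκ hS.le hk hμ0 (fun y => ?_) ?_ (by simp [hw]) (o3 _) ?_
      · exact ((o1 (y - y2)).comp y ((hasDerivAt_id' y).sub_const y2)).cg (fun _ => rfl) (by ring)
      · exact ((o2 (y1 - y2)).comp y1 ((hasDerivAt_id' y1).sub_const y2)).cg (fun _ => rfl) (by ring)
      · filter_upwards [omn k3' h] with y hy
        rw [one_mul]
        exact hm1 y hy.1.le hy.2.le
  have q2 : PT sol t0 y2 (eV sol t0 y2) 0 w s (-1) (sol.a t0 < y2) S := by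
    have hm1 : ∀ y, sol.a t0 ≤ y → y ≤ y1 → -(s * eV sol t0 y) - ω (y1 - y) ≤ -(s * eV sol t0 y2) - ω (y1 - y2) := by
      intro y h1 h2
      have := hmax' t0 y1 y k1 (by rwa [eA_eq sol tp.le]) h2 (by rwa [eB_eq sol tp.le])
      linarith
    rcases eq_or_lt_of_le k2 with h | h
    · rw [← h]; rw [← h] at hm1 hw
      exact PT_a sol tp (by linarith) k4 hPB hs hμ0 o1 hw.symm hw0 hCw (lt_irrefl _) hm1
    · refine PT_in sol hP hμ hq (g := fun y => ω (y1 - y)) (g' := fun y => -ω' (y1 - y)) (g'' := ω'' (y1 - y2))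
        tp ⟨h, by linarith⟩ hPB hs (by simp) hw0 hκ hS.le hk hμ0 (fun y => ?_) ?_ (by simp [hw]) (o3 _) ?_
      · exact ((o1 (y1 - y)).comp y ((hasDerivAt_id' y).const_sub y1)).cg (fun _ => rfl) (by ring)
      · exact ((o2 (y1 - y2)).comp y2 ((hasDerivAt_id' y2).const_sub y1)).neg.cg (fun _ => rfl) (by ring)
      · filter_upwards [omn h k3'] with y hy
        have := hm1 y hy.1.le hy.2.le
        linarith
  obtain ⟨p1, f1, pe1, D1, θ1, a1, a2, a3, a4, a5, a6, a7, a8, -⟩ := q1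
  obtain ⟨p2, f2, pe2, D2, θ2, b1, b2, b3, b4, b5, b6, b7, b8, -⟩ := q2
  have dG : HD (fun τ => s * (f1 τ - f2 τ) - ω (p1 τ - p2 τ)) (s * (D1 - D2) - w * (pe1 - pe2)) t0 := by
    have e1 := (o1 (p1 t0 - p2 t0)).comp t0 (a1.sub b1)
    refine (((a2.sub b2).const_mul s).sub e1).cg (fun _ => rfl) ?_
    rw [a3, b3]
  have hlt : ∀ᶠ τ in 𝓝 t0, p2 τ < p1 τ := b1.continuousAt.eventually_lt a1.continuousAt (by rw [a3, b3]; exact k3')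
  have h0 := der_left dG (by
    have n1 : ∀ᶠ τ in 𝓝[<] t0, τ ∈ Icc c d := by
      filter_upwards [Ioo_mem_nhdsLT t0c] with τ hτ
      exact ⟨hτ.1.le, hτ.2.le.trans k1.2⟩
    filter_upwards [n1, nwn hlt, nwn a5, nwn b5] with τ i1 i2 i3 i4
    rw [a3, b3, a4, b4, ← i3.2, ← i4.2]
    exact hmax' τ _ _ i1 i4.1.1 i2.le i3.1.2)
  have hθ : 2 * S * (w + 1) ≤ θ1 + θ2 := by
    rcases eq_or_lt_of_le k4 with h | h
    · rcases eq_or_lt_of_le k2 with h' | h'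
      · exfalso
        have e1 := (hR t0 k1).1
        rw [eB_eq sol tp.le, eA_eq sol tp.le, ← h, h'] at e1
        have e2 : K * rm ≤ K * (y1 - y2) := mll e1 hK
        have e3 : s * (eV sol t0 y1 - eV sol t0 y2) ≤ S + S := by
          refine (las _).trans ?_
          rw [abs_mul, hs, one_mul]
          exact (abs_sub _ _).trans (add_le_add (hV t0 k1 _) (hV t0 k1 _))
        linarith
      · rw [b8 h']; linarith
    · rw [a8 h]; linarith
  have hv1 := abs_le.1 (hV t0 k1 y1)
  have hv2 := abs_le.1 (hV t0 k1 y2)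
  have hfin : w * (eV sol t0 y2 - eV sol t0 y1) ≤ w * (2 * S) := mll (by linarith) hw0
  have : w * (eV sol t0 y2 - eV sol t0 y1) = w * eV sol t0 y2 - w * eV sol t0 y1 := by ring
  linarith
end

section
variable {P μ : FF} {Pext : ℝ} (sol : PistonSol P μ Pext)
  (hmass : ∀ t, 0 ≤ t → (∫ x in sol.a t..sol.b t, sol.ρ t x) = 1)
variable (hP : ContDiffOn ℝ 2 P (Ioi 0)) (hμ : ContDiffOn ℝ 2 μ (Ioi 0)) (hq : ∀ x, 0 < x → 0 < μ x)
  (hPm : MonotoneOn P (Ioi 0))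

include hP hμ hq in
lemma v_prop {c0 c1 N1 Nρ : ℝ} (hc0 : 0 ≤ c0) (hc1 : c0 ≤ c1) (hN1 : 0 ≤ N1) (hNρ : 0 ≤ Nρ) : ∃ N2, 0 ≤ N2 ∧ ∀ c d, c0 ≤ c → d ≤ c1 →
    LipAt sol N1 c → (∀ t ∈ Icc c d, ∀ x1 x2, |eR sol t x1 - eR sol t x2| ≤ Nρ * |x1 - x2|) →
    ∀ t ∈ Icc c d, ∀ x1 x2, |eV sol t x1 - eV sol t x2| ≤ N2 * |x1 - x2| := by
  obtain ⟨r0, r1, S, h0, h01, hS, hw⟩ := win_bd sol c0 c1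
  have hr1 : 0 < r1 := h0.trans_le h01
  have hsub : Icc r0 r1 ⊆ Ioi 0 := fun x hx => h0.trans_le hx.1
  obtain ⟨z, hz, hmin⟩ := isCompact_Icc.exists_isMinOn (nonempty_Icc.2 h01) (hμ.co.mono hsub)
  have hdc : ∀ {G : FF}, ContDiffOn ℝ 2 G (Ioi 0) → CO (deriv G) (Icc r0 r1) := fun hG x hx =>
    ((cd2 hG).2.1 x (hsub hx)).cw
  obtain ⟨C1, hC1⟩ := bIcc (hdc hμ)
  obtain ⟨C2, hC2⟩ := bIcc (hdc hP)
  obtain ⟨C3, hC3⟩ := bIcc ((hP.co.mono hsub).sub (continuousOn_const (c := Pext)))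
  obtain ⟨C4, hC4⟩ := isCompact_Icc.ebc (s := Icc c0 c1) (sol.u_cont.mono fun t ht => mem_Ici.2 (hc0.trans ht.1))
  simp only [nea] at hC1 hC2 hC3 hC4
  have hBA : Continuous fun t => eB sol t - eA sol t := (eB_cont sol).sub (eA_cont sol)
  obtain ⟨tm, htm, hrm⟩ := isCompact_Icc.exists_isMinOn (nonempty_Icc.2 hc1) hBA.co
  obtain ⟨tM, htM, hRM⟩ := isCompact_Icc.exists_isMaxOn (nonempty_Icc.2 hc1) hBA.co
  set rm := eB sol tm - eA sol tm
  set R := eB sol tM - eA sol tM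
  have hrm0 : 0 < rm := sub_pos.2 (eAB sol tm)
  have hR0 : 0 ≤ R := (sub_pos.2 (eAB sol tM)).le
  have hμ0 : 0 < μ z := hq z (hsub hz)
  have z0 : r0 ∈ Icc r0 r1 := ⟨le_rfl, h01⟩
  have p1 : 0 ≤ C1 := (ann _).trans (hC1 r0 z0)
  have p2 : 0 ≤ C2 := (ann _).trans (hC2 r0 z0)
  have p3 : 0 ≤ C3 := (ann _).trans (hC3 r0 z0)
  have p4 : 0 ≤ C4 := (ann _).trans (hC4 c0 ⟨le_rfl, hc1⟩)
  set C := C1 * Nρ + C2 * Nρ + (C3 + C4) with hC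
  have q1 : 0 ≤ C1 * Nρ := by positivity
  have q2 : 0 ≤ C2 * Nρ := by positivity
  have hC0 : 0 ≤ C := by positivity
  set κ := (C + 2 * S * r1) / μ z with hκ
  have hκ0 : 0 < κ := by positivity
  set K := N1 + C / μ z + 2 * S / rm with hK
  have k1 : 0 ≤ C / μ z := by positivity
  have k2 : 0 ≤ 2 * S / rm := by positivity
  obtain ⟨ω, ω', ω'', K', hK', o1, o2, o3, o4⟩ := omega_ex (by positivity : 0 ≤ K) hκ0 hR0
  refine ⟨K', hK', ?_⟩
  intro c d hc hd hL hρ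
  have win : ∀ t ∈ Icc c d, t ∈ Icc c0 c1 := fun t ht => ⟨hc.trans ht.1, ht.2.trans hd⟩
  have hPB : ∀ t ∈ Icc c d, 0 < t → PB sol t C r1 (μ z) := by
    intro t ht tp
    have hr : ∀ x ∈ Icc (sol.a t) (sol.b t), sol.ρ t x ∈ Icc r0 r1 := fun x hx => by
      rw [← eR_eq sol tp.le hx]; exact (hw t (win t ht) x).1
    refine ⟨fun x hx => ?_, fun x hx => ⟨hmin (hr x hx), ?_⟩⟩
    · have i := hr x (occ hx)
      have hx' : |sol.ρx t x| ≤ Nρ := lip_deriv (eR_dx sol tp hx) (hρ t ht) hNρ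
      refine ⟨i.2, ?_, ?_⟩
      · rw [abs_mul]
        have := mul_le_mul (hC1 _ i) hx' (ann _) p1
        linarith
      · rw [abs_mul]
        have := mul_le_mul (hC2 _ i) hx' (ann _) p2
        linarith
    · have e1 : |P (sol.ρ t x) - Pext| ≤ C3 := hC3 _ (hr x hx)
      have e2 := hC4 _ (win t ht)
      linarith
  have main : ∀ t ∈ Icc c d, ∀ x1 x2, eA sol t ≤ x2 → x2 ≤ x1 → x1 ≤ eB sol t → |eV sol t x1 - eV sol t x2| ≤ K' * (x1 - x2) := by
    intro t ht x1 x2 i1 i2 i3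
    have hRR : ∀ t ∈ Icc c d, eB sol t - eA sol t ∈ Icc rm R := fun t ht => ⟨hrm (win t ht), hRM (win t ht)⟩
    have key : ∀ s : ℝ, |s| = 1 → s * (eV sol t x1 - eV sol t x2) ≤ ω (x1 - x2) := fun s hs =>
      dbl sol hP hμ hq (hc0.trans hc) hS (fun t ht x => (hw t (win t ht) x).2) hPB hs hκ0.le
        (by rw [hκ]; field_simp; exact le_rfl) hμ0 o1 o2 o3 (fun r hr => ⟨(o4 r hr).1, (o4 r hr).2.1⟩) (by positivity) hRR
        (by rw [← div_le_iff₀ hrm0]; linarith) (by rw [← div_le_iff₀' hμ0]; linarith) (by linarith) hL ht i1 i2 i3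
    have e := (o4 (x1 - x2) ⟨by linarith, by linarith [(hRR t ht).2]⟩).2.2
    have a1 := key 1 (by simp)
    have a2 := key (-1) (by simp)
    rw [abs_le]
    constructor <;> linarith
  intro t ht x1 x2
  have ex : ∀ x, eV sol t x = eV sol t (ecl sol t x) := fun x => by
    unfold eV; rw [ecl_eq sol (ecl_mem sol t x)]
  rw [ex x1, ex x2]
  have L := ecl_lip sol t x1 x2
  have m1 := ecl_mem sol t x1
  have m2 := ecl_mem sol t x2
  refine le_trans ?_ (mll L hK')
  rcases le_total (ecl sol t x2) (ecl sol t x1) with h | h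
  · rw [abs_of_nonneg (sub_nonneg.2 h)]
    exact main t ht _ _ m2.1 h m1.2
  · rw [asc, asc (ecl sol t x1), abs_of_nonneg (sub_nonneg.2 h)]
    exact main t ht _ _ m1.1 h m2.2

include hmass hP hμ hq hPm in
lemma propag {c0 c1 N1 : ℝ} (hc0 : 0 ≤ c0) (hc1 : c0 ≤ c1) (hN1 : 0 ≤ N1) : ∃ N2, ∀ c d, c0 ≤ c → c < d → d ≤ c1 →
    LipAt sol N1 c → LB sol c d → ∀ t ∈ Icc c d, LipAt sol N2 t := by
  obtain ⟨Nρ, a1, a2⟩ := rho_prop sol hmass hP hμ hq hPm (c1 := c1) one_pos hc0 hN1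
  obtain ⟨Nv, b1, b2⟩ := v_prop sol hP hμ hq hc0 hc1 hN1 a1
  refine ⟨max Nρ Nv, fun c d hc hcd hd hL hLB t ht x1 x2 => ?_⟩
  have hr := a2 c d hc hcd hd hL hLB
  have hv := b2 c d hc hd hL hr
  exact ⟨(hr t ht x1 x2).trans (mlr (lml _ _) (ann _)),
    (hv t ht x1 x2).trans (mlr (lmr _ _) (ann _))⟩

def LBat (t : ℝ) : Prop := ∃ N, ∀ᶠ s in 𝓝 t, LipAt sol N s

lemma LB_of {c d : ℝ} (h : ∀ t ∈ Ioo c d, LBat sol t) : LB sol c d := by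
  intro s t hs hst ht
  refine isCompact_Icc.induction_on (p := fun A => ∃ N, ∀ r ∈ A, LipAt sol N r) ⟨0, by simp⟩ ?_ ?_ ?_
  · rintro A B hAB ⟨N, hN⟩
    exact ⟨N, fun r hr => hN r (hAB hr)⟩
  · rintro A B ⟨N, hN⟩ ⟨N', hN'⟩
    refine ⟨max N N', fun r hr => ?_⟩
    rcases hr with hr | hr
    · exact (hN r hr).mono (lml _ _)
    · exact (hN' r hr).mono (lmr _ _)
  · intro x hx
    obtain ⟨N, hN⟩ := h x ⟨hs.trans_le hx.1, hx.2.trans_lt ht⟩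
    exact ⟨{r | LipAt sol N r}, nwn hN, N, fun r hr => hr⟩

include hmass hP hμ hq hPm in
lemma LB_all {t : ℝ} (ht : 0 < t) : LBat sol t := by
  by_contra hbad
  have hFo : IsOpen {t | LBat sol t} := by
    rw [isOpen_iff_mem_nhds]
    rintro s ⟨N, hN⟩
    filter_upwards [hN.eventually_nhds] with r hr
    exact ⟨N, hr⟩
  let F : Set ℝ := {s | ¬ LBat sol s} ∩ Ioi 0
  have hFc : IsLocallyClosed F := (hFo.isClosed_compl.isLocallyClosed).inter isOpen_Ioi.isLocallyClosed
  have : LocallyCompactSpace F := hFc.locallyCompactSpace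
  have : Nonempty F := ⟨⟨t, hbad, ht⟩⟩
  obtain ⟨N, ⟨⟨t1, ht1⟩, hN⟩⟩ := nonempty_interior_of_iUnion_of_closed (X := F) (f := fun N : ℕ => {s : F | LipAt sol N s})
    (fun N => (LipAt_closed sol N).preimage continuous_subtype_val) (by
      rw [eq_univ_iff_forall]
      rintro ⟨s, hs⟩
      obtain ⟨N, hN⟩ := LipAt_ex sol hs.2
      obtain ⟨n, hn⟩ := exists_nat_ge N
      exact mem_iUnion.2 ⟨n, hN.mono hn⟩)
  rw [mem_interior_iff_mem_nhds, nhds_subtype_eq_comap] at hN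
  have hN' : ∀ᶠ s in 𝓝 t1, s ∈ F → LipAt sol N s := by
    obtain ⟨U, hU, hUs⟩ := hN
    filter_upwards [hU] with s hs hF
    exact hUs (show (⟨s, hF⟩ : F) ∈ Subtype.val ⁻¹' U from hs)
  have ht1p : 0 < t1 := ht1.2
  obtain ⟨ε, hε, hb⟩ := Metric.eventually_nhds_iff.1 (hN'.and (eventually_gt_nhds ht1p))
  set c0 := t1 - ε / 2 with hc0
  set c1 := t1 + ε / 2 with hc1
  have hJ : ∀ s ∈ Icc c0 c1, (s ∈ F → LipAt sol N s) ∧ 0 < s := fun s hs => hb (by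
    rw [Real.dist_eq, abs_lt]; constructor <;> linarith [hs.1, hs.2])
  have hc0p : 0 < c0 := (hJ c0 ⟨le_rfl, by linarith⟩).2
  obtain ⟨M, hM⟩ := LipAt_ex sol hc0p
  have hM0 := hM.nonneg
  obtain ⟨N2, hN2⟩ := propag sol hmass hP hμ hq hPm (c1 := c1) hc0p.le (by linarith) (le_max_of_le_right hM0 : 0 ≤ max (N : ℝ) M)
  apply ht1.1
  refine ⟨max (max (N : ℝ) M) N2, ?_⟩
  filter_upwards [omn (show c0 < t1 by linarith) (show t1 < c1 by linarith)] with s hs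
  let A : Set ℝ := ({c0} ∪ {s | ¬ LBat sol s}) ∩ Icc c0 s
  have hA : IsCompact A := isCompact_Icc.inter_left (isClosed_singleton.union hFo.isClosed_compl)
  have hAn : A.Nonempty := ⟨c0, Or.inl rfl, le_rfl, hs.1.le⟩
  obtain ⟨c, hcA, hcm⟩ := hA.exists_isGreatest hAn
  have hcL : LipAt sol (max (N : ℝ) M) c := by
    rcases hcA.1 with h | h
    · rw [mem_singleton_iff.1 h]; exact hM.mono (lmr _ _)
    · have := hJ c ⟨hcA.2.1, hcA.2.2.trans hs.2.le⟩
      exact (this.1 ⟨h, this.2⟩).mono (lml _ _)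
  rcases hcA.2.2.eq_or_lt with h | h
  · rw [← h]; exact hcL.mono (lml _ _)
  · refine (hN2 c s hcA.2.1 h hs.2.le hcL (LB_of sol fun r hr => ?_) s ⟨h.le, le_rfl⟩).mono (lmr _ _)
    by_contra hb
    exact absurd (hcm ⟨Or.inr hb, hcA.2.1.trans hr.1.le, hr.2.le⟩) (not_le.2 hr.1)
end

lemma C1I.within {f f' : FF} (h : C1I f f') {y0 : ℝ} (hy : y0 ∈ UI) :
    HasDerivWithinAt f (f' y0) (Icc 0 1) y0 := by
  set g : FF := IccExtend (zero_le_one' ℝ) (domRestrict (Icc 0 1) f') with hg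
  have hgc : Continuous g := (continuousOn_iff_continuous_domRestrict.1 h.c').Icc_extend' 
  have hge : ∀ y ∈ UI, g y = f' y := fun y hy => by
    rw [hg, IccExtend_of_mem _ _ hy]; rfl
  have hF : HD (fun y => f 0 + ∫ z in Zr..y, g z) (g y0) y0 :=
    (hgc.integral_hasStrictDerivAt 0 y0).hasDerivAt.const_add _
  rw [hge y0 hy] at hF
  refine hF.hasDerivWithinAt.congr_of_mem (fun y hy' => ?_) hy
  have e : ∫ z in Zr..y, g z = ∫ z in Zr..y, f' z := intervalIntegral.integral_congr fun z hz =>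
    hge z (oIs (by simp) hy' hz)
  rw [e, (h.ftc (by simp) hy').2]; ring

section
variable {α β L : ℝ} {X V τ Vy τy : FFF}

lemma LD.bdry (D : LD α β L X V τ Vy τy) {s t y0 : ℝ} (hs : s ∈ Icc α β) (ht : t ∈ Icc α β) (hy : y0 ∈ UI) :
    II (fun r => Vy r y0) volume s t ∧ ∫ r in s..t, Vy r y0 = τ t y0 - τ s y0 := by
  have hsub : uIcc s t ⊆ Icc α β := oIs hs ht
  let l := 𝓝[Icc 0 1 \ {y0}] y0
  have : l.NeBot := by
    rw [← mem_closure_iff_nhdsWithin_neBot]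
    have h1 : UO \ {y0} ⊆ Icc 0 1 \ {y0} := sdiff_subset_sdiff_left occ
    refine closure_mono h1 ?_
    have : closure (UO \ {y0}) = closure (UO) := by
      apply subset_antisymm (closure_mono sdiff_subset)
      refine closure_minimal ?_ isClosed_closure
      have := (dense_compl_singleton y0).open_subset_closure_inter (isOpen_Ioo (a := Zr) (b := 1))
      rwa [← sdiff_eq] at this
    rw [this, closure_Ioo zero_ne_one]; exact hy
  let q : FFF := fun y r => (y - y0)⁻¹ * (V r y - V r y0)
  have hq : ∀ r ∈ Icc α β, Tendsto (fun y => q y r) l (𝓝 (Vy r y0)) := by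
    intro r hr
    have := hasDerivWithinAt_iff_tendsto_slope.1 ((D.VC r hr).within hy)
    refine this.congr fun y => ?_
    simp [slope, q]
  have hqc : ∀ y, Continuous (q y) := fun y =>
    continuous_const.mul ((slice_left D.Vc y).sub (slice_left D.Vc y0))
  have hqb : ∀ r ∈ Icc α β, ∀ y ∈ UI \ {y0}, ‖q y r‖ ≤ L := by
    intro r hr y hy'
    have h := (D.VC r hr).lip (D.Vyb r hr) y0 hy y hy'.1
    have h0 : 0 < |y - y0| := abs_pos.2 (sub_ne_zero.2 hy'.2)
    rw [nea, abs_mul, abs_inv, inv_mul_le_iff₀ h0]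
    linarith
  have hmem : ∀ᶠ y in l, y ∈ UI \ {y0} := smn
  have hs2 : ∀ r ∈ uIoc s t, r ∈ Icc α β := fun r hr => hsub (ouc hr)
  have hm : AEStronglyMeasurable (fun r => Vy r y0) (volume.restrict (uIoc s t)) := by
    refine aestronglyMeasurable_of_tendsto_ae l (fun y => (hqc y).aestronglyMeasurable) ?_
    filter_upwards [ae_restrict_mem measurableSet_uIoc] with r hr
    exact hq r (hs2 r hr)
  have hi : II (fun r => Vy r y0) volume s t := by
    rw [intervalIntegrable_iff]
    have : IsFiniteMeasure (volume.restrict (uIoc s t)) := ⟨by simp [uIoc]⟩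
    refine Integrable.of_bound hm L ?_
    filter_upwards [ae_restrict_mem measurableSet_uIoc] with r hr
    exact D.Vyb r (hs2 r hr) y0 hy
  refine ⟨hi, ?_⟩
  have lim1 : Tendsto (fun y => ∫ r in s..t, q y r) l (𝓝 (∫ r in s..t, Vy r y0)) := by
    refine intervalIntegral.tendsto_integral_filter_of_dominated_convergence (fun _ => L)
      (Eventually.of_forall fun y => (hqc y).aestronglyMeasurable) ?_ (by simp) ?_
    · filter_upwards [hmem] with y hy'
      exact Eventually.of_forall fun r hr => hqb r (hs2 r hr) y hy'
    · exact Eventually.of_forall fun r hr => hq r (hs2 r hr)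
  have hX : ∀ r, Tendsto (fun y => (y - y0)⁻¹ * (X r y - X r y0)) l (𝓝 (τ r y0)) := by
    intro r
    have := hasDerivWithinAt_iff_tendsto_slope.1 ((D.Xy r y0).hasDerivWithinAt (s := Icc 0 1))
    refine this.congr fun y => ?_
    simp [slope]
  have lim2 := (hX t).sub (hX s)
  refine tendsto_nhds_unique lim1 (lim2.congr' ?_)
  filter_upwards [hmem] with y hy'
  have : ∫ r in s..t, q y r = (y - y0)⁻¹ * (X t y - X t y0) - (y - y0)⁻¹ * (X s y - X s y0) := by
    refine intervalIntegral.integral_eq_sub_of_hasDerivAt (f := fun r => (y - y0)⁻¹ * (X r y - X r y0)) (fun r hr => ?_) ((hqc y).ii _ _)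
    exact ((D.Xt r (hsub hr) y hy'.1).sub (D.Xt r (hsub hr) y0 hy)).const_mul _
  exact this.symm

/-- derivative of `A + K(τ)` at a boundary point -/
lemma LD.bdry_deriv (D : LD α β L X V τ Vy τy) {y0 t : ℝ} (ht : t ∈ Ioo α β) (hy : y0 ∈ UI)
    {A A' c K g : FF} (hK : ∀ x, 0 < x → HD K (-g x) x) (hg : CO g (Ioi 0))
    (hc : CO c (Icc α β)) (hA : ∀ r ∈ Icc α β, HD A (A' r) r)
    (hA' : ∀ r ∈ Icc α β, A' r = c r + g (τ r y0) * Vy r y0) :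
    HD (fun r => A r + K (τ r y0)) (c t) t := by
  have ht' := occ ht
  have hTc : Continuous fun r => τ r y0 := slice_left D.τc y0
  have hgT : Continuous fun r => g (τ r y0) := hg.comp_continuous hTc fun r => D.τpos r y0
  set g0 := g (τ t y0) with hg0
  let ψ : FF := fun r => c r + (g (τ r y0) - g0) * Vy r y0
  have hi : ∀ s ∈ Icc α β, ∀ r ∈ Icc α β, II ψ volume s r := fun s hs r hr =>
    ((hc.mono (oIs hs hr)).ii).add
      ((D.bdry hs hr hy).1.continuousOn_mul (hgT.sub ccn).co)
  have hAd : ∀ r ∈ Icc α β, A r - g0 * τ r y0 = (A t - g0 * τ t y0) + ∫ s in t..r, ψ s := by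
    intro r hr
    have hsub : uIcc t r ⊆ Icc α β := oIs ht' hr
    obtain ⟨b1, b2⟩ := D.bdry ht' hr hy
    have hAi : II A' volume t r := by
      have h0 : II (fun r => c r + g (τ r y0) * Vy r y0) volume t r :=
        ((hc.mono hsub).ii).add (b1.continuousOn_mul hgT.co)
      refine h0.congr (fun x hx => (hA' x (hsub (ouc hx))).symm)
    have e1 : ∫ s in t..r, A' s = A r - A t :=
      intervalIntegral.integral_eq_sub_of_hasDerivAt (fun x hx => hA x (hsub hx)) hAi
    have e2 : ∫ s in t..r, ψ s = (∫ s in t..r, A' s) - g0 * ∫ s in t..r, Vy s y0 := by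
      rw [← icm, ← isb hAi (b1.const_mul g0)]
      refine intervalIntegral.integral_congr fun x hx => ?_
      simp only [ψ]
      rw [hA' x (hsub hx)]; ring
    rw [e2, e1, b2]; ring
  have hnb : Icc α β ∈ 𝓝 t := Icc_mem_nhds ht.1 ht.2
  have hψc : ContinuousAt ψ t := by
    refine (hc.continuousAt hnb).add ?_
    have : Tendsto (fun r => (g (τ r y0) - g0) * Vy r y0) (𝓝 t) (𝓝 0) := by
      refine Filter.Tendsto.zero_mul_isBoundedUnder_le ?_ ?_
      · have h0 : Continuous fun r => g (τ r y0) - g0 := hgT.sub ccn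
        have := h0.tendsto t
        rwa [← hg0, sub_self] at this
      · refine isBoundedUnder_of_eventually_le (a := L) ?_
        filter_upwards [hnb] with r hr using D.Vyb r hr y0 hy
    have e : (g (τ t y0) - g0) * Vy t y0 = 0 := by rw [hg0]; ring
    show Tendsto (fun r => (g (τ r y0) - g0) * Vy r y0) (𝓝 t) (𝓝 ((g (τ t y0) - g0) * Vy t y0))
    rw [e]; exact this
  have hψ0 : ψ t = c t := by simp only [ψ]; rw [hg0]; ring
  have hψm : StronglyMeasurableAtFilter ψ (𝓝 t) := by
    refine ⟨Ioc α β, Ioc_mem_nhds ht.1 ht.2, ?_⟩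
    have := (hi α ⟨le_rfl, D.hαβ.le⟩ β ⟨D.hαβ.le, le_rfl⟩).1.aestronglyMeasurable
    exact this
  have h1 : HD (fun r => A r - g0 * τ r y0) (c t) t := by
    have h := ihr (IntervalIntegrable.refl (a := t) (f := ψ) (μ := volume)) hψm hψc
    rw [hψ0] at h
    refine (h.const_add (A t - g0 * τ t y0)).congr_of_eventuallyEq ?_
    filter_upwards [hnb] with r hr using hAd r hr
  have h2 : HD (fun r => K (τ r y0) + g0 * τ r y0) 0 t := by
    have hJ : HD (fun x => K x + g0 * x) 0 (τ t y0) :=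
      ((hK _ (D.τpos t y0)).add ((hasDerivAt_id _).const_mul g0)).cg (fun _ => rfl) (by rw [hg0]; ring)
    rw [hasDerivAt_iff_isLittleO] at hJ ⊢
    simp only [smul_zero, sub_zero] at hJ ⊢
    have hT : Tendsto (fun r => τ r y0) (𝓝 t) (𝓝 (τ t y0)) := hTc.tendsto t
    refine (hJ.comp_tendsto hT).trans_isBigO ?_
    refine Asymptotics.IsBigO.of_bound L ?_
    filter_upwards [hnb] with r hr using D.τLip ht' hr hy
  exact (h1.add h2).cg (fun r => by simp) (by ring)
end

section
variable {α β L : ℝ} {X V τ Vy τy : FFF}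

lemma LD.Zmain (D : LD α β L X V τ Vy τy) {K g p : FF} (hK : ∀ x, 0 < x → HD K (-g x) x)
    (hg : CO g (Ioi 0)) (hgp : ∀ x, 0 < x → 0 < g x) (hp : ContDiffOn ℝ 2 p (Ioi 0))
    (hB : ∀ s ∈ Icc α β, ∀ t ∈ Icc α β, ∃ B, ∀ y ∈ UI,
      ((∫ z in Zr..y, V t z) + K (τ t y)) - ((∫ z in Zr..y, V s z) + K (τ s y)) + ∫ r in s..t, p (τ r y) = B)
    {t : ℝ} (ht : t ∈ Ioo α β) :
    HD (fun s => ∫ y in Zr..1, (V s y - g (τ s y) * τy s y) ^ 2)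
      (∫ y in Zr..1, 2 * (V t y - g (τ t y) * τy t y) * (- (deriv p (τ t y) * τy t y))) t := by
  have ht' := occ ht
  obtain ⟨hp1, hp2, -⟩ := cd2 hp
  have hpc : CO (deriv p) (Ioi 0) := fun x hx => (hp2 x hx).cw
  have hdp : Continuous fun z : RR => deriv p (τ z.1 z.2) := hpc.comp_continuous D.τc fun z => D.τpos _ _
  have hpτ : Continuous fun z : RR => p (τ z.1 z.2) := hp.co.comp_continuous D.τc fun z => D.τpos _ _
  have hgτ : Continuous fun z : RR => g (τ z.1 z.2) := hg.comp_continuous D.τc fun z => D.τpos _ _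
  obtain ⟨C0, hC0⟩ := (bx_compact α β).ebc hdp.co
  have hC0' : 0 ≤ C0 := (norm_nonneg _).trans (hC0 _ (mem_bx ht' (by simp : Zr ∈ UI)))
  set C := C0 * L with hC
  have hCn : 0 ≤ C := mul_nonneg hC0' D.hL
  let q : FFF := fun r y => deriv p (τ r y) * τy r y
  have hqb : ∀ r ∈ Icc α β, ∀ y ∈ UI, ‖q r y‖ ≤ C := fun r hr y hy => by
    rw [norm_mul]
    exact mul_le_mul (hC0 _ (mem_bx hr hy)) (D.τyb r hr y hy) (norm_nonneg _) hC0'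
  let Z : FFF := fun s y => V s y - g (τ s y) * τy s y
  have hH : ∀ s ∈ Icc α β, ∀ y ∈ UO, HD (fun y => (∫ z in Zr..y, V s z) + K (τ s y)) (Z s y) y := by
    intro s hs y hy
    have h1 := par_dy D.Vc s y
    have h2 := (hK _ (D.τpos s y)).comp y ((D.τC s hs).d y hy)
    exact (h1.add h2).cg (fun _ => rfl) (by simp only [Z]; ring)
  have hZy : ∀ s ∈ Icc α β, CO (Z s) (Icc 0 1) := fun s hs =>
    ((slice_right D.Vc s).co).sub (((slice_right (f := fun s y => g (τ s y)) hgτ s).co).mul (D.τC s hs).c')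
  have hpC : ∀ r ∈ Icc α β, C1I (fun y => p (τ r y)) (q r) := fun r hr =>
    (D.τC r hr).comp (fun y _ => D.τpos r y) hp1 hpc
  have hZL0 : ∀ s ∈ Icc α β, ∀ r ∈ Icc α β, ∀ y ∈ UO, |Z r y - Z s y| ≤ C * |r - s| := by
    intro s hs r hr y hy
    obtain ⟨B, hB'⟩ := hB s hs r hr
    have hd := (hH r hr y hy).sub (hH s hs y hy)
    have := hd.le_of_lip' (C := C * |r - s|) (mul_nonneg hCn (ann _)) (by
      filter_upwards [omn hy.1 hy.2] with y2 h2
      have hy' := occ hy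
      have h2' := occ h2
      have e1 := hB' y hy'
      have e2 := hB' y2 h2'
      have hi : ∀ y, II (fun x => p (τ x y)) volume s r := fun y =>
        (slice_left (f := fun s y => p (τ s y)) hpτ y).ii _ _
      have e3 : (∫ x in s..r, p (τ x y)) - (∫ x in s..r, p (τ x y2)) = ∫ x in s..r, (p (τ x y) - p (τ x y2)) :=
        (isb (hi y) (hi y2)).symm
      have e4 : ‖∫ x in s..r, (p (τ x y) - p (τ x y2))‖ ≤ C * |y - y2| * |r - s| := by
        refine intervalIntegral.norm_integral_le_of_norm_le_const fun x hx => ?_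
        have hx' : x ∈ Icc α β := oIs hs hr (ouc hx)
        exact (hpC x hx').lip (hqb x hx') y2 h2' y hy'
      rw [← e3] at e4
      have e5 : ((fun y => (∫ z in Zr..y, V r z) + K (τ r y)) - fun y => (∫ z in Zr..y, V s z) + K (τ s y)) y2 -
        ((fun y => (∫ z in Zr..y, V r z) + K (τ r y)) - fun y => (∫ z in Zr..y, V s z) + K (τ s y)) y
        = (∫ x in s..r, p (τ x y)) - (∫ x in s..r, p (τ x y2)) := by
        simp only [Pi.sub_apply]
        linarith
      rw [e5]
      refine e4.trans (le_of_eq ?_)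
      rw [nea, asc y y2]; ring)
    simpa using this
  have hcl : closure (UO) = Icc 0 1 := closure_Ioo zero_ne_one
  have hZL : ∀ s ∈ Icc α β, ∀ r ∈ Icc α β, ∀ y ∈ UI, |Z r y - Z s y| ≤ C * |r - s| := by
    intro s hs r hr y hy
    have hc : CO (fun y => |Z r y - Z s y|) (Icc 0 1) := ((hZy r hr).sub (hZy s hs)).abs
    rw [← hcl] at hy
    exact le_on_closure (f := fun y => |Z r y - Z s y|) (hZL0 s hs r hr) (by rwa [hcl]) continuousOn_const hy
  have hZc : CO (fun z : RR => Z z.1 z.2) (bx α β) := by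
    rintro ⟨s, y⟩ ⟨hs, hy⟩
    have h1 : Tendsto (fun z : RR => Z s z.2) (𝓝[bx α β] (s, y)) (𝓝 (Z s y)) := by
      have := (hZy s hs) y hy
      refine Tendsto.comp this ?_
      refine tendsto_nhdsWithin_iff.2 ⟨continuous_snd.continuousAt.tendsto.mono_left nwn, ?_⟩
      filter_upwards [smn] with z hz using hz.2
    have h2 : Tendsto (fun z : RR => Z z.1 z.2 - Z s z.2) (𝓝[bx α β] (s, y)) (𝓝 0) := by
      refine squeeze_zero_norm' (a := fun z : RR => C * |z.1 - s|) ?_ ?_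
      · filter_upwards [smn] with z hz using hZL s hs z.1 hz.1 z.2 hz.2
      · have : Continuous fun z : RR => C * |z.1 - s| := by fun_prop
        have := this.tendsto (s, y)
        simp only [sub_self, abs_zero, mul_zero] at this
        exact this.mono_left nwn
    have := h2.add h1
    simp only [sub_add_cancel, zero_add] at this
    exact this
  have hqc : CO (fun z : RR => q z.1 z.2) (bx α β) := by
    have : CO (fun z : RR => deriv p (τ z.1 z.2) * ((V z.1 z.2 - Z z.1 z.2) / g (τ z.1 z.2))) (bx α β) :=
      hdp.co.mul ((D.Vc.co.sub hZc).div hgτ.co fun z _ => (hgp _ (D.τpos _ _)).ne')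
    refine this.congr fun z _ => ?_
    have := (hgp _ (D.τpos z.1 z.2)).ne'
    simp only [q, Z]
    congr 1
    field_simp
    ring
  have hqt : ∀ y ∈ UI, CO (fun r => q r y) (Icc α β) := fun y hy =>
    hqc.comp (f := fun r => (r, y)) (by fun_prop) fun r hr => mem_bx hr hy
  have hZi : ∀ s ∈ Icc α β, ∀ r ∈ Icc α β, ∀ y ∈ UO, Z r y = Z s y - ∫ x in s..r, q x y := by
    intro s hs r hr y hy
    obtain ⟨B, hB'⟩ := hB s hs r hr
    have hsub : ∀ x ∈ uIoc s r, x ∈ Icc α β := fun x hx => oIs hs hr (ouc hx)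
    have hy' := occ hy
    have hd := (intervalIntegral.hasDerivAt_integral_of_dominated_loc_of_deriv_le (μ := volume) (F := fun y x => p (τ x y)) (F' := fun y x => q x y)
      (bound := fun _ => C) (a := s) (b := r) (omn hy.1 hy.2)
      (Eventually.of_forall fun y => (slice_left (f := fun s y => p (τ s y)) hpτ y).aestronglyMeasurable)
      ((slice_left (f := fun s y => p (τ s y)) hpτ y).ii _ _)
      (((hqt y hy').mono (oIs hs hr)).ii.def'.aestronglyMeasurable)
      (Eventually.of_forall fun x hx y hy => hqb x (hsub x hx) y (occ hy)) (by simp)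
      (Eventually.of_forall fun x hx y hy => (hpC x (hsub x hx)).d y hy)).2
    have hd2 := ((hH r hr y hy).sub (hH s hs y hy)).add hd
    have hd3 : HD (fun y => ((∫ z in Zr..y, V r z) + K (τ r y)) - ((∫ z in Zr..y, V s z) + K (τ s y)) + ∫ x in s..r, p (τ x y)) 0 y := by
      refine (hasDerivAt_const y B).congr_of_eventuallyEq ?_
      filter_upwards [omn hy.1 hy.2] with y2 h2 using hB' y2 (occ h2)
    have := hd2.unique hd3
    linarith
  have hZt : ∀ s ∈ Ioo α β, ∀ y ∈ UO, HD (fun r => Z r y) (- q s y) s := by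
    intro s hs y hy
    have hs' := occ hs
    have hnb : Icc α β ∈ 𝓝 s := Icc_mem_nhds hs.1 hs.2
    have hc := hqt y (occ hy)
    have h := ihr (IntervalIntegrable.refl (a := s) (f := fun r => q r y) (μ := volume))
      ⟨Icc α β, hnb, hc.aestronglyMeasurable measurableSet_Icc⟩ (hc.continuousAt hnb)
    refine ((h.const_sub (Z s y)).congr_of_eventuallyEq ?_)
    filter_upwards [hnb] with r hr using hZi s hs' r hr y hy
  obtain ⟨M, hM⟩ := (bx_compact α β).ebc hZc
  have hM0 : 0 ≤ M := (norm_nonneg _).trans (hM _ (mem_bx ht' (by simp : Zr ∈ UI)))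
  have hu : uIcc Zr 1 = Icc 0 1 := uol zlo
  have hZ2 : ∀ s ∈ Icc α β, CO (fun y => Z s y ^ 2) (uIcc 0 1) := fun s hs => by
    rw [hu]; exact (hZy s hs).pow 2
  have hae : ∀ᵐ y : ℝ, y ∈ uIoc Zr 1 → y ∈ UO := by
    have : ∀ᵐ y : ℝ, y ≠ 1 := by simp [ae_iff]
    filter_upwards [this] with y hy h
    rw [uIoc_of_le zlo] at h
    exact ⟨h.1, lt_of_le_of_ne h.2 hy⟩
  refine (intervalIntegral.hasDerivAt_integral_of_dominated_loc_of_deriv_le (μ := volume) (F := fun s y => Z s y ^ 2) (F' := fun s y => 2 * Z s y * (- q s y))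
      (bound := fun _ => 2 * M * C) (omn ht.1 ht.2) ?_ (hZ2 t ht').ii ?_ ?_ (by simp) ?_).2
  · filter_upwards [omn ht.1 ht.2] with s hs
    exact (hZ2 s (occ hs)).ii.def'.aestronglyMeasurable
  · refine ContinuousOn.aestronglyMeasurable (s := uIoc Zr 1) ?_ measurableSet_uIoc
    have : CO (fun y => 2 * Z t y * (- q t y)) (Icc 0 1) :=
      (continuousOn_const.mul (hZy t ht')).mul (hpC t ht').c'.neg
    exact this.mono (by rw [← hu]; exact ouc)
  · refine Eventually.of_forall fun y hy s hs => ?_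
    have hs' := occ hs
    have hy' : y ∈ UI := by rw [← hu]; exact ouc hy
    rw [norm_mul, norm_mul, norm_neg, nea 2, abs_two]
    exact mul_le_mul (mll (hM _ (mem_bx hs' hy')) zero_le_two) (hqb s hs' y hy') (norm_nonneg _) (by positivity)
  · filter_upwards [hae] with y hy h s hs
    exact ((hZt s hs y (hy h)).pow 2).cg (fun _ => rfl) (by simp)
end

lemma Qf_eq (P : FF) (ρs x : ℝ) : Qf P ρs x = x * kf (fun τ => P τ / τ) ρs x - (P ρs / ρs) * x + P ρs := by
  unfold Qf kf
  simp only [div_div, pow_two]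

noncomputable def eG (P : FF) (ρs τ : ℝ) : ℝ := gk (fun τ => P τ / τ) ρs τ - P ρs / ρs + P ρs * τ

lemma eG_deriv {P : FF} (hP : CO P (Ioi 0)) {ρs x : ℝ} (hs : 0 < ρs) (hx : 0 < x) :
    HD (eG P ρs) (-(gp P x - P ρs)) x := by
  have h1 : CO (fun τ => P τ / τ) (Ioi 0) := hP.div continuousOn_id fun x hx => (ne_of_gt hx)
  have h2 := gk_deriv (μ := fun τ => P τ / τ) h1 hs hx
  refine ((h2.sub_const (P ρs / ρs)).add ((hasDerivAt_id x).const_mul (P ρs))).cg (fun _ => rfl) ?_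
  unfold gp gm
  field_simp
  ring

section
variable {P μ : FF} {Pext : ℝ} (sol : PistonSol P μ Pext)
  (hmass : ∀ t, 0 ≤ t → (∫ x in sol.a t..sol.b t, sol.ρ t x) = 1)

include hmass in
lemma chg {s : ℝ} (hs : 0 ≤ s) {f g : FF} (hf : CO f (Icc (sol.a s) (sol.b s)))
    (hg : ∀ y ∈ UI, g y = f (eX sol s y) * lτ sol s y) :
    ∫ x in sol.a s..sol.b s, f x = ∫ y in Zr..1, g y := by
  have hu : uIcc Zr 1 = Icc 0 1 := uol zlo
  have h := intervalIntegral.integral_comp_mul_deriv'' (a := 0) (b := 1) (f := eX sol s) (f' := lτ sol s) (g := f)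
    (fun y _ => (eX_deriv sol s y).cw)
    (fun y _ => (eX_deriv sol s y).hasDerivWithinAt) ((slice_right (lτ_cont sol) s).co) (hf.mono (by
      rintro _ ⟨y, hy, rfl⟩
      rw [hu] at hy
      exact eX_memI sol hmass hs hy))
  rw [eX_zero, eX_one sol hmass, eA_eq sol hs, eB_eq sol hs] at h
  rw [← h]
  refine intervalIntegral.integral_congr fun y hy => ?_
  rw [hu] at hy
  exact (hg y hy).symm

include hmass in
lemma lag {s y : ℝ} (hs : 0 ≤ s) (hy : y ∈ UI) :
    sol.ρ s (eX sol s y) = (lτ sol s y)⁻¹ ∧ sol.v s (eX sol s y) = lV sol s y := by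
  have h := eX_memI sol hmass hs hy
  rw [lτi, ← eR_eq sol hs h, ← eV_eq sol hs h]
  exact ⟨rfl, rfl⟩

include hmass in
lemma W_eq (hP : ContDiffOn ℝ 2 P (Ioi 0)) (hμ : ContDiffOn ℝ 2 μ (Ioi 0)) {ρs s : ℝ} (hρs : 0 < ρs) (hs : 0 ≤ s) :
    Wf P μ ρs (sol.a s) (sol.b s) (sol.ρ s) (sol.ρx s) (sol.v s) =
    (1/2) * (∫ y in Zr..1, (lV sol s y - gm μ (lτ sol s y) * lτy sol s y) ^ 2)
    + (1/2) * (-sol.b' s + gk μ ρs (lτ sol s 1)) ^ 2 + (1/2) * (sol.a' s + gk μ ρs (lτ sol s 0)) ^ 2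
    + ∫ y in Zr..1, eG P ρs (lτ sol s y) := by
  have hρc : CO (sol.ρ s) (Icc (sol.a s) (sol.b s)) := fun x hx =>
    (sol.hρx s hs x hx).cw
  have hρp := sol.ρ_pos s hs
  have hvc : CO (sol.v s) (Icc (sol.a s) (sol.b s)) :=
    sol.v_cont.comp (f := fun x => (s, x)) (by fun_prop) fun x hx => ⟨hs, hx⟩
  have hinv : CO (fun x => (sol.ρ s x)⁻¹) (Icc (sol.a s) (sol.b s)) := hρc.inv₀ fun x hx => (hρp x hx).ne'
  have hμc : CO (fun x => μ (sol.ρ s x)) (Icc (sol.a s) (sol.b s)) := hμ.co.comp hρc hρp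
  have e1 : ∫ x in sol.a s..sol.b s, (sol.ρ s x)⁻¹ * (sol.ρ s x * sol.v s x + μ (sol.ρ s x) * (sol.ρ s x)⁻¹ * sol.ρx s x) ^ 2
      = ∫ y in Zr..1, (lV sol s y - gm μ (lτ sol s y) * lτy sol s y) ^ 2 := by
    refine chg sol hmass hs (hinv.mul (((hρc.mul hvc).add ((hμc.mul hinv).mul (sol.ρx_cont s hs))).pow 2)) fun y hy => ?_
    obtain ⟨l1, l2⟩ := lag sol hmass hs hy
    have := (lτ_pos sol s y).ne'
    rw [l1, l2]
    unfold gm lτy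
    field_simp
    ring
  have hkc : CO (fun x => Qf P ρs (sol.ρ s x)) (Icc (sol.a s) (sol.b s)) := by
    have h1 : CO (fun τ => P τ / τ) (Ioi 0) := hP.co.div continuousOn_id fun x hx => (ne_of_gt hx)
    have h2 : CO (kf (fun τ => P τ / τ) ρs) (Ioi 0) := fun x hx =>
      (kf_deriv h1 hρs hx).cw
    have h3 : CO (fun x => x * kf (fun τ => P τ / τ) ρs x - (P ρs / ρs) * x + P ρs) (Ioi 0) :=
      ((continuousOn_id.mul h2).sub (continuousOn_const.mul continuousOn_id)).add continuousOn_const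
    have h4 : CO (Qf P ρs) (Ioi 0) := h3.congr fun x _ => Qf_eq P ρs x
    exact h4.comp hρc hρp
  have e2 : Uf P ρs (sol.a s) (sol.b s) (sol.ρ s) = ∫ y in Zr..1, eG P ρs (lτ sol s y) := by
    unfold Uf
    refine chg sol hmass hs hkc fun y hy => ?_
    have h0 := (lτ_pos sol s y).ne'
    rw [(lag sol hmass hs hy).1, Qf_eq]
    unfold eG gk
    field_simp
  have x0 : eX sol s 0 = sol.a s := by rw [eX_zero, eA_eq sol hs]
  have x1 : eX sol s 1 = sol.b s := by rw [eX_one sol hmass, eB_eq sol hs]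
  have l0 := lag sol hmass hs (y := 0) (by simp)
  have l1 := lag sol hmass hs (y := 1) (by simp)
  rw [x0] at l0
  rw [x1] at l1
  unfold Wf
  rw [e1, e2, l0.1, l1.1, sol.bc_a s hs, sol.bc_b s hs]
  unfold gk
  ring
end

theorem W_final
    (P μ P' : FF) (Pext ρs : ℝ)
    (hP : ContDiffOn ℝ 2 P (Ioi 0)) (hμ : ContDiffOn ℝ 2 μ (Ioi 0))
    (hq : ∀ x, 0 < x → 0 < μ x)
    (hP' : ∀ x, 0 < x → HD P (P' x) x)
    (hP'pos : ∀ x, 0 < x → 0 < P' x)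
    (hρs : 0 < ρs) (hPρs : P ρs = Pext)
    (sol : PistonSol P μ Pext)
    (hmass : ∀ t, 0 ≤ t → (∫ x in sol.a t..sol.b t, sol.ρ t x) = 1) :
    ∀ t, 0 < t →
      HD
        (fun s => Wf P μ ρs (sol.a s) (sol.b s) (sol.ρ s) (sol.ρx s) (sol.v s))
        (-(∫ x in sol.a t..sol.b t,
            ((sol.ρ t x) ^ 2)⁻¹ * P' (sol.ρ t x) * μ (sol.ρ t x) * (sol.ρx t x) ^ 2)
          - kf μ ρs (sol.ρ t (sol.b t)) * (P (sol.ρ t (sol.b t)) - Pext)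
          - kf μ ρs (sol.ρ t (sol.a t)) * (P (sol.ρ t (sol.a t)) - Pext)
          + (sol.v t (sol.a t) + kf μ ρs (sol.ρ t (sol.a t))) * sol.u t) t := by
  intro t ht
  have hPm : MonotoneOn P (Ioi 0) := by
    refine monotoneOn_of_deriv_nonneg (convex_Ioi 0) hP.co ?_ ?_
    · rw [interior_Ioi]; exact fun x hx => (hP' x hx).differentiableAt.differentiableWithinAt
    · rw [interior_Ioi]; intro x hx; rw [(hP' x hx).deriv]; exact (hP'pos x hx).le
  obtain ⟨N, hN⟩ := LB_all sol hmass hP hμ hq hPm ht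
  obtain ⟨ε, hε, hb⟩ := Metric.eventually_nhds_iff.1 (hN.and (eventually_gt_nhds ht))
  have hJ : ∀ s ∈ Ioo (t - ε) (t + ε), LipAt sol N s ∧ 0 < s := fun s hs => hb (by
    rw [Real.dist_eq, abs_lt]; constructor <;> linarith [hs.1, hs.2])
  set α := t - ε / 4 with hα
  set β := t + ε / 4 with hβ
  have hα0 : 0 < α := (hJ α ⟨by linarith, by linarith⟩).2
  obtain ⟨L, D⟩ := LD_sol sol hmass (α0 := t - ε / 2) (β0 := t + ε / 2) (α := α) (β := β) (N := N)
    (hJ _ ⟨by linarith, by linarith⟩).2.le (by linarith) (by linarith) (by linarith)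
    (fun s hs => (hJ s ⟨by linarith [hs.1], by linarith [hs.2]⟩).1)
  have hLB : LB sol α β := fun s r h1 h2 h3 => ⟨N, fun x hx => (hJ x ⟨by linarith [hx.1], by linarith [hx.2]⟩).1⟩
  have htI : t ∈ Ioo α β := ⟨by linarith, by linarith⟩
  have ht' := occ htI
  have hpos : ∀ r ∈ Icc α β, 0 < r := fun r hr => hα0.trans_le hr.1
  have hgmc : CO (gm μ) (Ioi 0) := (gm_cd hμ).co
  have hgk : ∀ x, 0 < x → HD (gk μ ρs) (- gm μ x) x := fun x hx => gk_deriv hμ.co hρs hx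
  have d1 := D.Zmain hgk hgmc (fun x hx => gm_pos hq hx) (gp_cd hP) (fun s hs r hr =>
    ⟨_, fun y hy => BF sol hmass hP hμ hq hα0.le D.hαβ hρs hLB hs hr hy⟩) htI
  have x0 : ∀ s, 0 ≤ s → eX sol s 0 = sol.a s := fun s hs => by rw [eX_zero, eA_eq sol hs]
  have x1 : ∀ s, 0 ≤ s → eX sol s 1 = sol.b s := fun s hs => by rw [eX_one sol hmass, eB_eq sol hs]
  have l0 : ∀ s, 0 ≤ s → sol.ρ s (sol.a s) = (lτ sol s 0)⁻¹ ∧ sol.v s (sol.a s) = lV sol s 0 := fun s hs => by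
    have := lag sol hmass hs (y := 0) (by simp)
    rwa [x0 s hs] at this
  have l1 : ∀ s, 0 ≤ s → sol.ρ s (sol.b s) = (lτ sol s 1)⁻¹ ∧ sol.v s (sol.b s) = lV sol s 1 := fun s hs => by
    have := lag sol hmass hs (y := 1) (by simp)
    rwa [x1 s hs] at this
  have hpc : ∀ y, Continuous fun r => gp P (lτ sol r y) := fun y =>
    slice_left (f := fun r y => gp P (lτ sol r y)) (lG_cont sol (gp_cd hP)) y
  have d2 := D.bdry_deriv (y0 := 1) (t := t) htI (by simp) (A := fun r => - sol.b' r) (A' := fun r => - sol.b'' r)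
    (c := fun r => -(gp P (lτ sol r 1) - Pext)) hgk hgmc
    ((hpc 1).sub ccn).neg.co (fun r hr => (sol.hb'' r (hpos r hr)).neg) (fun r hr => by
      rw [sol.newton_b r (hpos r hr), (l1 r (hpos r hr).le).1]
      have := (lτ_pos sol r 1).ne'
      unfold gp gm lVy
      rw [x1 r (hpos r hr).le]
      field_simp
      ring)
  have d3 := D.bdry_deriv (y0 := 0) (t := t) htI (by simp) (A := fun r => sol.a' r) (A' := fun r => sol.a'' r)
    (c := fun r => sol.u r + Pext - gp P (lτ sol r 0)) hgk hgmc
    (((sol.u_cont.mono fun r hr => mem_Ici.2 (hpos r hr).le).add continuousOn_const).sub (hpc 0).co)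
    (fun r hr => sol.ha'' r (hpos r hr)) (fun r hr => by
      rw [sol.newton_a r (hpos r hr), (l0 r (hpos r hr).le).1]
      have := (lτ_pos sol r 0).ne'
      unfold gp gm lVy
      rw [x0 r (hpos r hr).le]
      field_simp)
  obtain ⟨hp1, hp2, -⟩ := cd2 (gp_cd hP)
  have hpcc : CO (deriv (gp P)) (Ioi 0) := fun x hx => (hp2 x hx).cw
  have d4 := D.ID (G := eG P ρs) (G' := fun x => -(gp P x - P ρs)) (G'' := fun x => -(deriv (gp P) x)) (ψ := fun _ => 1) (ψ' := fun _ => 0)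
    (fun x hx => eG_deriv hP.co hρs hx) (fun x hx => ((hp1 x hx).sub_const _).neg) hpcc.neg
    (fun y => hasDerivAt_const _ _) ccn (y := 1) htI (by simp)
  have hpC : C1I (fun y => -(gp P (lτ sol t y) - P ρs)) (fun y => -(deriv (gp P) (lτ sol t y)) * lτy sol t y) :=
    (D.τC t ht').comp (g := fun x => -(gp P x - P ρs)) (fun y _ => lτ_pos sol t y) (fun x hx => ((hp1 x hx).sub_const _).neg) hpcc.neg
  simp only [one_mul] at d4
  rw [hpC.ibp (D.VC t ht') (y := 1) (by simp)] at d4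
  have dW := (((d1.const_mul (1/2)).add ((d2.pow 2).const_mul (1/2))).add ((d3.pow 2).const_mul (1/2))).add d4
  have hev : (fun s => Wf P μ ρs (sol.a s) (sol.b s) (sol.ρ s) (sol.ρx s) (sol.v s)) =ᶠ[𝓝 t] fun s =>
      (1/2) * (∫ y in Zr..1, (lV sol s y - gm μ (lτ sol s y) * lτy sol s y) ^ 2)
      + (1/2) * (-sol.b' s + gk μ ρs (lτ sol s 1)) ^ 2 + (1/2) * (sol.a' s + gk μ ρs (lτ sol s 0)) ^ 2
      + ∫ y in Zr..1, eG P ρs (lτ sol s y) := by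
    filter_upwards [omn htI.1 htI.2] with s hs
    exact W_eq sol hmass hP hμ hρs (hpos s (occ hs)).le
  refine (HasDerivAt.cg dW (fun _ => rfl) ?_).congr_of_eventuallyEq hev
  have hu : uIcc Zr 1 = Icc 0 1 := uol zlo
  have hρc : CO (sol.ρ t) (Icc (sol.a t) (sol.b t)) := fun x hx =>
    (sol.hρx t ht.le x hx).cw
  have hρp := sol.ρ_pos t ht.le
  have hP'c : CO P' (Ioi 0) := by
    have h0 : CO (deriv P) (Ioi 0) := fun x hx => ((cd2 hP).2.1 x hx).cw
    exact h0.congr fun x hx => (hP' x hx).deriv.symm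
  have hgd : ∀ x, 0 < x → deriv (gp P) x = - P' x⁻¹ / x ^ 2 := fun x hx => by
    have := (hP' x⁻¹ (inv_pos.2 hx)).comp x (hasDerivAt_inv hx.ne')
    refine HasDerivAt.deriv (this.cg (fun _ => rfl) ?_)
    field_simp
  have e5 : ∫ x in sol.a t..sol.b t, ((sol.ρ t x) ^ 2)⁻¹ * P' (sol.ρ t x) * μ (sol.ρ t x) * (sol.ρx t x) ^ 2 =
      ∫ y in Zr..1, (- gm μ (lτ sol t y) * lτy sol t y) * (deriv (gp P) (lτ sol t y) * lτy sol t y) := by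
    refine chg sol hmass ht.le (((((hρc.pow 2).inv₀ fun x hx => (pow_pos (hρp x hx) 2).ne').mul (hP'c.comp hρc hρp)).mul (hμ.co.comp hρc hρp)).mul ((sol.ρx_cont t ht.le).pow 2)) fun y hy => ?_
    rw [(lag sol hmass ht.le hy).1]
    have := (lτ_pos sol t y).ne'
    rw [hgd _ (lτ_pos sol t y)]
    unfold gm lτy
    field_simp
  have cV : CO (lV sol t) (Icc 0 1) := (D.VC t ht').c
  have cτ : CO (lτ sol t) (Icc 0 1) := (D.τC t ht').c
  have cτy : CO (lτy sol t) (Icc 0 1) := (D.τC t ht').c'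
  have cg : CO (fun y => gm μ (lτ sol t y)) (Icc 0 1) := hgmc.comp cτ fun y _ => lτ_pos sol t y
  have cd : CO (fun y => deriv (gp P) (lτ sol t y)) (Icc 0 1) := hpcc.comp cτ fun y _ => lτ_pos sol t y
  have ii : ∀ {f : FF}, CO f (Icc 0 1) → II f volume 0 1 := fun h => by
    rw [← hu] at h; exact h.ii
  have i1 : II (fun y => (- gm μ (lτ sol t y) * lτy sol t y) * (deriv (gp P) (lτ sol t y) * lτy sol t y)) volume 0 1 :=
    ii ((cg.neg.mul cτy).mul (cd.mul cτy))
  have i2 : II (fun y => -(deriv (gp P) (lτ sol t y)) * lτy sol t y * lV sol t y) volume 0 1 :=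
    ii ((cd.neg.mul cτy).mul cV)
  have e6 : (1/2) * (∫ y in Zr..1, 2 * (lV sol t y - gm μ (lτ sol t y) * lτy sol t y) * (- (deriv (gp P) (lτ sol t y) * lτy sol t y)))
      = (∫ y in Zr..1, -(deriv (gp P) (lτ sol t y)) * lτy sol t y * lV sol t y)
       - ∫ y in Zr..1, (- gm μ (lτ sol t y) * lτy sol t y) * (deriv (gp P) (lτ sol t y) * lτy sol t y) := by
    rw [← icm, ← isb i2 i1]
    refine intervalIntegral.integral_congr fun y _ => ?_
    ring
  rw [e5, e6, (l0 t ht.le).2, (l0 t ht.le).1, (l1 t ht.le).1, hPρs]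
  have b1 : sol.b' t = lV sol t 1 := by rw [← (l1 t ht.le).2, sol.bc_b t ht.le]
  have b0 : sol.a' t = lV sol t 0 := by rw [← (l0 t ht.le).2, sol.bc_a t ht.le]
  rw [b0, b1]
  unfold gk gp
  ring

/-- **Equation (3.24) of Lemma 2.**  Along every classical solution of the two-piston
system with unit total mass, for all `t > 0`,
`d/dt W(a(t), b(t), ρ[t], v[t]) = −∫ ρ⁻² P'(ρ) μ(ρ) ρ_x² dx
− k(ρ(t,b(t)))(P(ρ(t,b(t))) − P_ext) − k(ρ(t,a(t)))(P(ρ(t,a(t))) − P_ext)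
+ (v(t,a(t)) + k(ρ(t,a(t)))) u(t)`. -/
theorem W_derivative_along_solutions
    (P μ P' : ℝ → ℝ) (Pext ρs : ℝ)
    (hP : ContDiffOn ℝ 2 P (Ioi 0)) (hμ : ContDiffOn ℝ 2 μ (Ioi 0))
    (hPpos : ∀ x, 0 < x → 0 < P x) (hμpos : ∀ x, 0 < x → 0 < μ x)
    (hP' : ∀ x, 0 < x → HasDerivAt P (P' x) x)
    (hP'pos : ∀ x, 0 < x → 0 < P' x)
    (hPrange : P '' Ioi 0 = Ioi 0)
    (hPext : 0 < Pext) (hρs : 0 < ρs) (hPρs : P ρs = Pext)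
    (sol : PistonSol P μ Pext)
    (hmass : ∀ t, 0 ≤ t → (∫ x in sol.a t..sol.b t, sol.ρ t x) = 1) :
    ∀ t, 0 < t →
      HasDerivAt
        (fun s => Wf P μ ρs (sol.a s) (sol.b s) (sol.ρ s) (sol.ρx s) (sol.v s))
        (-(∫ x in sol.a t..sol.b t,
            ((sol.ρ t x) ^ 2)⁻¹ * P' (sol.ρ t x) * μ (sol.ρ t x) * (sol.ρx t x) ^ 2)
          - kf μ ρs (sol.ρ t (sol.b t)) * (P (sol.ρ t (sol.b t)) - Pext)
          - kf μ ρs (sol.ρ t (sol.a t)) * (P (sol.ρ t (sol.a t)) - Pext)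
          + (sol.v t (sol.a t) + kf μ ρs (sol.ρ t (sol.a t))) * sol.u t) t := by
  exact W_final P μ P' Pext ρs hP hμ hμpos hP' hP'pos hρs hPρs sol hmass
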